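/- arXiv:1812.11616 — 3 statements merged into one kernel-verified Lean document; each statement's English description precedes it below -/
import Mathlib

section
/- Let n ≥ 1, λ₀ > 0, and let m : ℝⁿ → ℂ be a bounded continuous function supported in the annulus {ξ : λ₀/2 < |ξ| < 2λ₀}. For t > 0 define A_t f(x) := (2π)^{−n} ∫_{ℝⁿ} e^{i⟨x,ξ⟩} m(tξ) f̂(ξ) dξ for f ∈ S(ℝⁿ). Let 2 ≤ p < ∞ and suppose there is a constant C̄ such that (∫_{ℝⁿ} sup_{t∈[1,2]} |A_t f(x)|^p dx)^{1/p} ≤ C̄ ‖f‖_{L^p(ℝⁿ)} for all f ∈ S(ℝⁿ). Then there is a constant C, depending only on n and p (and in particular independent of m, λ₀ and C̄), such that (∫_{ℝⁿ} sup_{t>0} |A_t f(x)|^p dx)^{1/p} ≤ C·C̄ ‖f‖_{L^p(ℝⁿ)} for all f ∈ S(ℝⁿ). -/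
open MeasureTheory
open scoped RealInnerProductSpace ENNReal

noncomputable section

/-- `ℝⁿ` as a euclidean space. -/
abbrev V (n : ℕ) := EuclideanSpace ℝ (Fin n)

/-- The Fourier transform `f̂(ξ) = ∫_{ℝⁿ} e^{−i⟨y,ξ⟩} f(y) dy`. -/
def FT {n : ℕ} (f : V n → ℂ) (ξ : V n) : ℂ :=
  ∫ y : V n, Complex.exp (-(Complex.I * ((⟪y, ξ⟫ : ℝ) : ℂ))) * f y

/-- The multiplier operator `A_t f(x) = (2π)^{−n} ∫ e^{i⟨x,ξ⟩} m(tξ) f̂(ξ) dξ`. -/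
def multOp {n : ℕ} (m : V n → ℂ) (t : ℝ) (f : V n → ℂ) (x : V n) : ℂ :=
  ((((2 * Real.pi) ^ n)⁻¹ : ℝ) : ℂ) *
    ∫ ξ : V n, Complex.exp (Complex.I * ((⟪x, ξ⟫ : ℝ) : ℂ)) * m (t • ξ) * FT f ξ


open Set Filter Topology
open scoped SchwartzMap ContDiff

/-- Smooth truncation of a Schwartz function at height `δ`. -/
lemma SchwartzMap.exists_truncation {n : ℕ} (f : 𝓢(V n, ℂ)) {δ : ℝ} (hδ : 0 < δ) :
    ∃ g h : 𝓢(V n, ℂ), f = g + h ∧ (∀ x, ‖h x‖ ≤ 2 * δ) ∧ (∀ x, ‖g x‖ ≤ ‖f x‖) ∧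
      ∀ x, ‖f x‖ ≤ δ → g x = 0 := by
  set c : V n → ℝ := fun x => Real.smoothTransition (‖f x‖ ^ 2 / δ ^ 2 - 1) with hc
  have hc_smooth : ContDiff ℝ ∞ c := by
    have h1 : ContDiff ℝ ∞ (fun x => ‖f x‖ ^ 2 / δ ^ 2 - 1) :=
      (((f.smooth ⊤).norm_sq ℝ).div_const _).sub contDiff_const
    exact Real.smoothTransition.contDiff.comp h1
  have hc_zero : ∀ x, ‖f x‖ ≤ δ → c x = 0 := fun x hx => by
    apply Real.smoothTransition.zero_of_nonpos
    rw [sub_nonpos, div_le_one (by positivity)]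
    gcongr
  have hc_one : ∀ x, 2 * δ ≤ ‖f x‖ → c x = 1 := fun x hx => by
    apply Real.smoothTransition.one_of_one_le
    rw [le_sub_iff_add_le, le_div_iff₀ (by positivity)]
    nlinarith
  have hc_nonneg : ∀ x, 0 ≤ c x := fun x => Real.smoothTransition.nonneg _
  have hc_le : ∀ x, c x ≤ 1 := fun x => Real.smoothTransition.le_one _
  have hsupp : HasCompactSupport (fun x => (c x : ℂ) * f x) := by
    have hev : ∀ᶠ x in cocompact (V n), ‖f x‖ ≤ δ := by
      have := (f.tendsto_cocompact).norm
      rw [norm_zero] at this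
      exact this.eventually_le_const hδ
    obtain ⟨K, hK, hKs⟩ := mem_cocompact.1 hev
    refine HasCompactSupport.intro hK fun x hx => ?_
    rw [hc_zero x (hKs hx)]
    simp
  have hsmooth : ContDiff ℝ ∞ (fun x => (c x : ℂ) * f x) :=
    (Complex.ofRealCLM.contDiff.comp hc_smooth).mul (f.smooth ⊤)
  have hnorm : ∀ x, ‖(c x : ℂ) * f x‖ = c x * ‖f x‖ := fun x => by
    rw [norm_mul, Complex.norm_real, Real.norm_of_nonneg (hc_nonneg x)]
  refine ⟨hsupp.toSchwartzMap hsmooth, f - hsupp.toSchwartzMap hsmooth, by simp, fun x => ?_,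
    fun x => ?_, fun x hx => ?_⟩
  · have h1 : (f - hsupp.toSchwartzMap hsmooth) x = ((1 - c x : ℝ) : ℂ) * f x := by
      simp; ring
    rw [h1, norm_mul, Complex.norm_real, Real.norm_of_nonneg (sub_nonneg.2 (hc_le x))]
    rcases le_total (2 * δ) ‖f x‖ with h | h
    · rw [hc_one x h]; simp [hδ.le]
    · nlinarith [hc_nonneg x, norm_nonneg (f x)]
  · change ‖(c x : ℂ) * f x‖ ≤ _
    rw [hnorm]
    exact mul_le_of_le_one_left (norm_nonneg _) (hc_le x)
  · change (c x : ℂ) * f x = 0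
    rw [hc_zero x hx]; simp

lemma lintegral_Ioo_rpow {a R : ℝ} (ha : -1 < a) (hR : 0 ≤ R) :
    ∫⁻ t in Ioo 0 R, ENNReal.ofReal (t ^ a) = ENNReal.ofReal (R ^ (a + 1) / (a + 1)) := by
  have h_int : IntegrableOn (fun t : ℝ => t ^ a) (Ioc 0 R) :=
    (intervalIntegrable_iff_integrableOn_Ioc_of_le hR).1
      (intervalIntegral.intervalIntegrable_rpow' ha)
  rw [restrict_Ioo_eq_restrict_Ioc, ← ofReal_integral_eq_lintegral_ofReal h_int
    ((ae_restrict_iff' measurableSet_Ioc).2 (ae_of_all _ fun t ht => Real.rpow_nonneg ht.1.le a)),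
    ← intervalIntegral.integral_of_le hR, integral_rpow (Or.inl ha),
    Real.zero_rpow (by linarith), sub_zero]

/-- Marcinkiewicz interpolation, between `L² → ℓ²(L²)` and `L^∞ → ℓ^∞(L^∞)`, for a
countable family of operators on the Schwartz space. -/
lemma SchwartzMap.tsum_lintegral_rpow_le {n : ℕ} {ι : Type*} [Countable ι] {p A B : ℝ}
    (hp : 2 < p) (hA : 0 < A) (hB : 0 ≤ B) (T : ι → 𝓢(V n, ℂ) →L[ℂ] 𝓢(V n, ℂ))
    (hT2 : ∀ f, ∑' k, ∫⁻ x, ‖T k f x‖ₑ ^ 2 ≤ ENNReal.ofReal B * ∫⁻ x, ‖f x‖ₑ ^ 2)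
    (hTinf : ∀ k f M, (∀ x, ‖f x‖ ≤ M) → ∀ x, ‖T k f x‖ ≤ A * M) (f : 𝓢(V n, ℂ)) :
    ∑' k, ∫⁻ x, ‖T k f x‖ₑ ^ p ≤
      ENNReal.ofReal (p * (4 * B * ((4 * A) ^ (p - 2) / (p - 2)))) * ∫⁻ x, ‖f x‖ₑ ^ p := by
  have hp0 : 0 < p := by linarith
  have hofReal : ∀ z : ℂ, ∀ q : ℝ, 0 ≤ q → ‖z‖ₑ ^ q = ENNReal.ofReal (‖z‖ ^ q) := fun z q hq => by
    rw [← ENNReal.ofReal_rpow_of_nonneg (norm_nonneg _) hq, ofReal_norm]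
  set F : ℝ → V n → ℝ≥0∞ := fun t x => {y : ℝ × V n | y.1 < 4 * A * ‖f y.2‖}.indicator
    (fun y => ENNReal.ofReal (y.1 ^ (p - 3)) * ‖f y.2‖ₑ ^ 2) (t, x) with hF
  have hF_meas : Measurable (Function.uncurry F) := by
    refine Measurable.indicator ?_ ?_
    · exact (ENNReal.measurable_ofReal.comp (measurable_fst.pow_const _)).mul
        ((f.continuous.measurable.comp measurable_snd).enorm.pow_const 2)
    · exact measurableSet_lt measurable_fst (by have := f.continuous; fun_prop)
  have key : ∀ t : ℝ, 0 < t → ∑' k, volume {x | t < ‖T k f x‖} * ENNReal.ofReal (t ^ (p - 1)) ≤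
      ENNReal.ofReal (4 * B) * ∫⁻ x, F t x := by
    intro t ht
    obtain ⟨g, h, hfgh, hh, hg, hg0⟩ := f.exists_truncation (δ := t / (4 * A)) (by positivity)
    have hTh : ∀ k x, ‖T k h x‖ ≤ t / 2 := fun k x => by
      refine (hTinf k h _ hh x).trans (le_of_eq ?_)
      field_simp
      norm_num
    have hsub : ∀ k, {x | t < ‖T k f x‖} ⊆ {x | ENNReal.ofReal ((t / 2) ^ 2) ≤ ‖T k g x‖ₑ ^ 2} := by
      intro k x hx
      have h1 : ‖T k f x‖ ≤ ‖T k g x‖ + ‖T k h x‖ := by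
        rw [hfgh, map_add, _root_.add_apply]
        exact norm_add_le _ _
      have h2 : t / 2 ≤ ‖T k g x‖ := by
        have := hTh k x
        have : t < ‖T k f x‖ := hx
        linarith
      change ENNReal.ofReal ((t / 2) ^ 2) ≤ ‖T k g x‖ₑ ^ 2
      rw [← ofReal_norm, ENNReal.ofReal_pow (by positivity)]
      gcongr
    have hvol : ∀ k, volume {x | t < ‖T k f x‖} ≤
        ENNReal.ofReal (4 / t ^ 2) * ∫⁻ x, ‖T k g x‖ₑ ^ 2 := fun k => by
      refine (measure_mono (hsub k)).trans ((meas_ge_le_lintegral_div ?_ ?_ ?_).trans ?_)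
      · have := (T k g).continuous
        fun_prop
      · simpa using ht.ne'
      · simp
      · rw [ENNReal.div_eq_inv_mul, ← ENNReal.ofReal_inv_of_pos (by positivity)]
        gcongr
        apply le_of_eq
        field_simp
        norm_num
    calc ∑' k, volume {x | t < ‖T k f x‖} * ENNReal.ofReal (t ^ (p - 1))
        ≤ ∑' k, (ENNReal.ofReal (4 / t ^ 2) * ∫⁻ x, ‖T k g x‖ₑ ^ 2) *
            ENNReal.ofReal (t ^ (p - 1)) := by
          gcongr with k
          exact hvol k
      _ = ENNReal.ofReal (4 / t ^ 2) * (∑' k, ∫⁻ x, ‖T k g x‖ₑ ^ 2) *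
            ENNReal.ofReal (t ^ (p - 1)) := by
          rw [ENNReal.tsum_mul_right, ENNReal.tsum_mul_left]
      _ ≤ ENNReal.ofReal (4 / t ^ 2) * (ENNReal.ofReal B * ∫⁻ x, ‖g x‖ₑ ^ 2) *
            ENNReal.ofReal (t ^ (p - 1)) := by
          gcongr
          exact hT2 g
      _ = ENNReal.ofReal (4 * B) * (ENNReal.ofReal (t ^ (p - 3)) * ∫⁻ x, ‖g x‖ₑ ^ 2) := by
          have h3 : ENNReal.ofReal (4 / t ^ 2) * ENNReal.ofReal B * ENNReal.ofReal (t ^ (p - 1)) =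
              ENNReal.ofReal (4 * B) * ENNReal.ofReal (t ^ (p - 3)) := by
            rw [← ENNReal.ofReal_mul (by positivity), ← ENNReal.ofReal_mul (by positivity),
              ← ENNReal.ofReal_mul (by positivity)]
            congr 1
            rw [show p - 1 = (p - 3) + 2 by ring, Real.rpow_add ht, Real.rpow_two]
            field_simp
          rw [← mul_assoc, ← mul_assoc, ← h3]
          ring
      _ ≤ ENNReal.ofReal (4 * B) * ∫⁻ x, F t x := by
          gcongr
          rw [← lintegral_const_mul' _ _ ENNReal.ofReal_ne_top]
          refine lintegral_mono fun x => ?_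
          by_cases hx : t < 4 * A * ‖f x‖
          · simp only [hF, indicator, mem_ofPred_eq, hx, if_true]
            gcongr
            exact enorm_le_iff_norm_le.2 (hg x)
          · rw [hg0 x (by rw [le_div_iff₀ (by positivity)]; linarith)]
            simp
  have hinner : ∀ x, ∫⁻ t in Ioi 0, F t x =
      ENNReal.ofReal ((4 * A) ^ (p - 2) / (p - 2)) * ‖f x‖ₑ ^ p := by
    intro x
    have h1 : ∀ t : ℝ, F t x = (Iio (4 * A * ‖f x‖)).indicator
        (fun t => ENNReal.ofReal (t ^ (p - 3)) * ‖f x‖ₑ ^ 2) t := fun t => by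
      simp [hF, indicator]
    simp_rw [h1]
    rw [lintegral_indicator measurableSet_Iio, Measure.restrict_restrict measurableSet_Iio,
      inter_comm, Ioi_inter_Iio, lintegral_mul_const' _ _ (by simp),
      lintegral_Ioo_rpow (by linarith) (by positivity),
      hofReal _ _ hp0.le, ← ofReal_norm, ← ENNReal.ofReal_pow (norm_nonneg _),
      ← ENNReal.ofReal_mul (by have : 0 ≤ p - 3 + 1 := by linarith
                               positivity),
      ← ENNReal.ofReal_mul (by have : 0 ≤ p - 2 := by linarith
                               positivity)]
    congr 1
    rw [show p - 3 + 1 = p - 2 by ring, Real.mul_rpow (by positivity) (norm_nonneg _)]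
    rcases eq_or_ne ‖f x‖ 0 with h0 | h0
    · rw [h0, Real.zero_rpow hp0.ne']; simp
    · have : ‖f x‖ ^ p = ‖f x‖ ^ (p - 2) * ‖f x‖ ^ 2 := by
        rw [← Real.rpow_two, ← Real.rpow_add (by positivity)]
        ring_nf
      rw [this]
      ring
  have hmono : ∀ k, Antitone fun t : ℝ => volume {x | t < ‖T k f x‖} :=
    fun k s t hst => measure_mono fun x hx => lt_of_le_of_lt hst hx
  calc ∑' k, ∫⁻ x, ‖T k f x‖ₑ ^ p
      = ∑' k, ENNReal.ofReal p * ∫⁻ t in Ioi 0,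
          volume {x | t < ‖T k f x‖} * ENNReal.ofReal (t ^ (p - 1)) := by
        congr with k
        simp_rw [hofReal _ p hp0.le]
        exact lintegral_rpow_eq_lintegral_meas_lt_mul volume (ae_of_all _ fun x => norm_nonneg _)
          (T k f).continuous.norm.aemeasurable hp0
    _ = ENNReal.ofReal p * ∫⁻ t in Ioi 0,
          ∑' k, volume {x | t < ‖T k f x‖} * ENNReal.ofReal (t ^ (p - 1)) := by
        rw [ENNReal.tsum_mul_left, lintegral_tsum]
        intro k
        have := (hmono k).measurable
        fun_prop
    _ ≤ ENNReal.ofReal p * ∫⁻ t in Ioi 0, ENNReal.ofReal (4 * B) * ∫⁻ x, F t x := by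
        refine mul_le_mul_right ?_ _
        exact setLIntegral_mono' measurableSet_Ioi fun t ht => key t ht
    _ = ENNReal.ofReal p * (ENNReal.ofReal (4 * B) * ∫⁻ x, ∫⁻ t in Ioi 0, F t x) := by
        rw [lintegral_const_mul' _ _ ENNReal.ofReal_ne_top,
          lintegral_lintegral_swap hF_meas.aemeasurable]
    _ = _ := by
        simp_rw [hinner]
        rw [lintegral_const_mul' _ _ ENNReal.ofReal_ne_top, ENNReal.ofReal_mul hp0.le,
          ENNReal.ofReal_mul (p := 4 * B) (by positivity), mul_assoc, mul_assoc]

open scoped FourierTransform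

lemma integral_comp_smul_of_pos {n : ℕ} {a : ℝ} (ha : 0 < a) (F : V n → ℂ) :
    ∫ x, F (a • x) = ((a ^ n : ℝ) : ℂ)⁻¹ * ∫ x, F x := by
  rw [Measure.integral_comp_smul_of_nonneg volume F a (hR := ha.le), finrank_euclideanSpace,
    Fintype.card_fin, Complex.real_smul, Complex.ofReal_inv]

lemma lintegral_comp_smul_of_pos {n : ℕ} {a : ℝ} (ha : 0 < a) (F : V n → ℝ≥0∞) :
    ∫⁻ x, F (a • x) = ENNReal.ofReal ((a ^ n)⁻¹) * ∫⁻ x, F x := by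
  have h := lintegral_map_equiv F (MeasurableEquiv.smul₀ (α := V n) a ha.ne') (μ := volume)
  simp only [MeasurableEquiv.coe_smul₀] at h
  rw [← h, Measure.map_addHaar_smul volume ha.ne', lintegral_smul_measure,
    finrank_euclideanSpace, Fintype.card_fin, abs_of_pos (by positivity), smul_eq_mul]

namespace SchwartzMap

variable {n : ℕ}

/-- The dilation `f ↦ f (a •)` on the Schwartz space. -/
def dilation (a : ℝˣ) : 𝓢(V n, ℂ) →L[ℂ] 𝓢(V n, ℂ) :=
  compCLMOfContinuousLinearEquiv ℂ (ContinuousLinearEquiv.smulLeft a)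

@[simp] lemma dilation_apply (a : ℝˣ) (f : 𝓢(V n, ℂ)) (x : V n) :
    dilation a f x = f ((a : ℝ) • x) := rfl

lemma fourier_dilation {a : ℝˣ} (ha : 0 < (a : ℝ)) (f : 𝓢(V n, ℂ)) (ξ : V n) :
    𝓕 (dilation a f) ξ = (((a : ℝ) ^ n : ℝ) : ℂ)⁻¹ * 𝓕 f ((a : ℝ)⁻¹ • ξ) := by
  rw [fourier_coe, fourier_coe, Real.fourier_eq', Real.fourier_eq',
    ← integral_comp_smul_of_pos ha]
  congr with x
  rw [real_inner_smul_left, real_inner_smul_right, mul_inv_cancel_left₀ ha.ne', dilation_apply]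

/-- Convolution with the kernel `K` rescaled by `a`. -/
def scaledConvolution (K : 𝓢(V n, ℂ)) (a : ℝˣ) : 𝓢(V n, ℂ) →L[ℂ] 𝓢(V n, ℂ) :=
  dilation a⁻¹ ∘L convolution (ContinuousLinearMap.mul ℂ ℂ) K ∘L dilation a

lemma fourier_scaledConvolution (K : 𝓢(V n, ℂ)) {a : ℝˣ} (ha : 0 < (a : ℝ)) (f : 𝓢(V n, ℂ))
    (ξ : V n) : 𝓕 (scaledConvolution K a f) ξ = 𝓕 K ((a : ℝ) • ξ) * 𝓕 f ξ := by
  have ha' : 0 < ((a⁻¹ : ℝˣ) : ℝ) := by simpa using ha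
  have hc : (((a : ℝ) ^ n : ℝ) : ℂ) ≠ 0 := by exact_mod_cast (pow_pos ha n).ne'
  change 𝓕 (dilation a⁻¹ (convolution (ContinuousLinearMap.mul ℂ ℂ) K (dilation a f))) ξ = _
  rw [fourier_dilation ha', fourier_convolution, pairing_apply_apply, fourier_dilation ha]
  simp only [Units.val_inv_eq_inv_val, inv_inv, inv_pow, Complex.ofReal_inv,
    ContinuousLinearMap.mul_apply', smul_smul, inv_mul_cancel₀ ha.ne', one_smul]
  field_simp

lemma norm_scaledConvolution_le (K : 𝓢(V n, ℂ)) (a : ℝˣ) (f : 𝓢(V n, ℂ)) {M : ℝ}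
    (hf : ∀ x, ‖f x‖ ≤ M) (x : V n) : ‖scaledConvolution K a f x‖ ≤ (∫ y, ‖K y‖) * M := by
  change ‖convolution (ContinuousLinearMap.mul ℂ ℂ) K (dilation a f) _‖ ≤ _
  rw [convolution_apply, convolution_mul, ← integral_mul_const]
  refine norm_integral_le_of_norm_le (K.integrable.norm.mul_const M) (ae_of_all _ fun y => ?_)
  rw [norm_mul]
  gcongr
  exact hf _

lemma lintegral_enorm_sq_fourier (f : 𝓢(V n, ℂ)) :
    ∫⁻ ξ, ‖𝓕 f ξ‖ₑ ^ 2 = ∫⁻ x, ‖f x‖ₑ ^ 2 := by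
  have h : ∀ g : 𝓢(V n, ℂ), ∫⁻ x, ‖g x‖ₑ ^ 2 = ENNReal.ofReal (∫ x, ‖g x‖ ^ 2) := fun g => by
    rw [ofReal_integral_eq_lintegral_ofReal ((g.memLp 2 volume).integrable_norm_pow two_ne_zero)
      (ae_of_all _ fun x => by positivity)]
    simp_rw [ENNReal.ofReal_pow (norm_nonneg _), ofReal_norm]
  rw [h, h, integral_norm_sq_fourier]

/-- A smooth function adapted to the annulus `1/4 ≤ ‖ξ‖ ≤ 2`. -/
lemma exists_annulus_cutoff (n : ℕ) : ∃ ψ : 𝓢(V n, ℂ), (∀ ξ, ‖ψ ξ‖ ≤ 1) ∧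
    (∀ ξ, 1 / 4 ≤ ‖ξ‖ → ‖ξ‖ ≤ 2 → ψ ξ = 1) ∧ ∀ ξ, ψ ξ ≠ 0 → 1 / 8 ≤ ‖ξ‖ ∧ ‖ξ‖ < 4 := by
  let b₁ : ContDiffBump (0 : V n) := ⟨2, 4, by norm_num, by norm_num⟩
  let b₂ : ContDiffBump (0 : V n) := ⟨1 / 8, 1 / 4, by norm_num, by norm_num⟩
  have h₁ : ∀ ξ : V n, ‖ξ‖ ≤ 2 → b₁ ξ = 1 := fun ξ h => b₁.one_of_mem_closedBall (mem_closedBall_zero_iff.2 h)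
  have h₁' : ∀ ξ : V n, 4 ≤ ‖ξ‖ → b₁ ξ = 0 := fun ξ h => b₁.zero_of_le_dist ((dist_zero_right ξ).symm ▸ h)
  have h₂ : ∀ ξ : V n, ‖ξ‖ ≤ 1 / 8 → b₂ ξ = 1 :=
    fun ξ h => b₂.one_of_mem_closedBall (mem_closedBall_zero_iff.2 h)
  have h₂' : ∀ ξ : V n, 1 / 4 ≤ ‖ξ‖ → b₂ ξ = 0 := fun ξ h => b₂.zero_of_le_dist ((dist_zero_right ξ).symm ▸ h)
  have hcs : HasCompactSupport fun ξ => ((b₁ ξ - b₂ ξ : ℝ) : ℂ) :=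
    (b₁.hasCompactSupport.sub b₂.hasCompactSupport).comp_left (g := Complex.ofReal) (by simp)
  have hsm : ContDiff ℝ ∞ fun ξ => ((b₁ ξ - b₂ ξ : ℝ) : ℂ) :=
    Complex.ofRealCLM.contDiff.comp (b₁.contDiff.sub b₂.contDiff)
  refine ⟨hcs.toSchwartzMap hsm, fun ξ => ?_, fun ξ h h' => ?_, fun ξ h => ?_⟩
  · change ‖((b₁ ξ - b₂ ξ : ℝ) : ℂ)‖ ≤ 1
    rw [Complex.norm_real, Real.norm_eq_abs, abs_le]
    constructor <;> linarith [b₁.nonneg (x := ξ), b₂.nonneg (x := ξ), b₁.le_one (x := ξ),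
      b₂.le_one (x := ξ)]
  · change ((b₁ ξ - b₂ ξ : ℝ) : ℂ) = 1
    simp [h₁ ξ h', h₂' ξ h]
  · change ((b₁ ξ - b₂ ξ : ℝ) : ℂ) ≠ 0 at h
    contrapose! h
    rcases le_or_gt (1 / 8) ‖ξ‖ with h8 | h8
    · simp [h₁' ξ (h h8), h₂' ξ (by linarith [h h8])]
    · simp [h₁ ξ (by linarith), h₂ ξ h8.le]

lemma tsum_dyadic_le {ψ : V n → ℂ} (hψ : ∀ ξ, ‖ψ ξ‖ ≤ 1)
    (hsupp : ∀ ξ, ψ ξ ≠ 0 → 1 / 8 ≤ ‖ξ‖ ∧ ‖ξ‖ < 4) (ξ : V n) :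
    ∑' k : ℤ, ‖ψ ((2 : ℝ) ^ k • ξ)‖ₑ ^ 2 ≤ 5 := by
  rcases eq_or_ne ξ 0 with rfl | hξ
  · have : ψ 0 = 0 := by
      by_contra h
      have := (hsupp 0 h).1
      norm_num at this
    simp [this]
  obtain ⟨j, hj, hj'⟩ := exists_mem_Ico_zpow (norm_pos_iff.2 hξ) (one_lt_two (α := ℝ))
  have hzero : ∀ k ∉ Finset.Icc (-3 - j) (1 - j), ‖ψ ((2 : ℝ) ^ k • ξ)‖ₑ ^ 2 = 0 := by
    intro k hk
    by_contra h
    have h' : ψ ((2 : ℝ) ^ k • ξ) ≠ 0 := by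
      rintro h0
      simp [h0] at h
    obtain ⟨hl, hu⟩ := hsupp _ h'
    rw [norm_smul, Real.norm_of_nonneg (by positivity)] at hl hu
    have h1 : (2 : ℝ) ^ (k + j) < 2 ^ (2 : ℤ) := by
      rw [zpow_add₀ two_ne_zero]
      calc (2 : ℝ) ^ k * 2 ^ j ≤ 2 ^ k * ‖ξ‖ := by gcongr
        _ < 4 := hu
        _ = _ := by norm_num
    have h2 : (2 : ℝ) ^ (-3 : ℤ) < 2 ^ (k + (j + 1)) := by
      rw [zpow_add₀ two_ne_zero]
      calc (2 : ℝ) ^ (-3 : ℤ) = 1 / 8 := by norm_num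
        _ ≤ 2 ^ k * ‖ξ‖ := hl
        _ < 2 ^ k * 2 ^ (j + 1) := by gcongr
    have h3 := (zpow_lt_zpow_iff_right₀ one_lt_two).1 h1
    have h4 := (zpow_lt_zpow_iff_right₀ one_lt_two).1 h2
    exact hk (Finset.mem_Icc.2 ⟨by omega, by omega⟩)
  rw [tsum_eq_sum hzero]
  calc _ ≤ ∑ k ∈ Finset.Icc (-3 - j) (1 - j), (1 : ℝ≥0∞) := by
        refine Finset.sum_le_sum fun k _ => pow_le_one₀ zero_le ?_
        rw [← ofReal_norm]
        exact ENNReal.ofReal_le_one.2 (hψ _)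
    _ = 5 := by
        rw [Finset.sum_const, Int.card_Icc, show 1 - j + 1 - (-3 - j) = 5 by ring]
        simp

/-- Smooth dyadic frequency localizations, at any scale `b`, are bounded
`L^p → ℓ^p(L^p)` for `2 ≤ p < ∞`, uniformly in `b`. -/
lemma exists_dyadic_localization (n : ℕ) {p : ℝ} (hp : 2 ≤ p) :
    ∃ C : ℝ, 0 < C ∧ ∀ b : ℝ, 0 < b → ∃ T : ℤ → 𝓢(V n, ℂ) →L[ℂ] 𝓢(V n, ℂ),
      (∀ k f ξ, 1 / 4 ≤ 2 ^ k * b * ‖ξ‖ → 2 ^ k * b * ‖ξ‖ ≤ 2 → 𝓕 (T k f) ξ = 𝓕 f ξ) ∧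
      ∀ f, ∑' k, ∫⁻ x, ‖T k f x‖ₑ ^ p ≤ ENNReal.ofReal C * ∫⁻ x, ‖f x‖ₑ ^ p := by
  obtain ⟨ψ, hψ, hψ1, hsupp⟩ := exists_annulus_cutoff n
  set K : 𝓢(V n, ℂ) := 𝓕⁻ ψ with hK
  have hKψ : 𝓕 K = ψ := by simp [hK]
  set A : ℝ := (∫ y, ‖K y‖) + 1 with hA
  have hK0 : 0 ≤ ∫ y, ‖K y‖ := integral_nonneg fun _ => norm_nonneg _
  have hA0 : 0 < A := by positivity
  set C : ℝ := max 5 (p * (4 * 5 * ((4 * A) ^ (p - 2) / (p - 2)))) with hC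
  refine ⟨C, by positivity, fun b hb => ?_⟩
  have ha : ∀ k : ℤ, (2 : ℝ) ^ k * b ≠ 0 := fun k => by positivity
  set T : ℤ → 𝓢(V n, ℂ) →L[ℂ] 𝓢(V n, ℂ) := fun k => scaledConvolution K (Units.mk0 _ (ha k))
  have hT : ∀ k f ξ, 𝓕 (T k f) ξ = ψ (((2 : ℝ) ^ k * b) • ξ) * 𝓕 f ξ := fun k f ξ => by
    rw [fourier_scaledConvolution K (by simpa using by positivity), hKψ, Units.val_mk0]
  have hnorm : ∀ (k : ℤ) (ξ : V n), ‖((2 : ℝ) ^ k * b) • ξ‖ = 2 ^ k * b * ‖ξ‖ := fun k ξ => by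
    rw [norm_smul, Real.norm_of_nonneg (by positivity)]
  refine ⟨T, fun k f ξ h h' => ?_, fun f => ?_⟩
  · rw [hT, hψ1 _ (by rwa [hnorm]) (by rwa [hnorm]), one_mul]
  have hT2 : ∀ f, ∑' k, ∫⁻ x, ‖T k f x‖ₑ ^ 2 ≤ ENNReal.ofReal 5 * ∫⁻ x, ‖f x‖ₑ ^ 2 := by
    intro f
    simp_rw [← lintegral_enorm_sq_fourier (T _ f), hT, enorm_mul, mul_pow]
    rw [← lintegral_tsum, ← lintegral_enorm_sq_fourier f,
      ← lintegral_const_mul' _ _ ENNReal.ofReal_ne_top]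
    · refine lintegral_mono fun ξ => ?_
      rw [ENNReal.tsum_mul_right]
      gcongr
      simp_rw [mul_smul]
      exact (tsum_dyadic_le hψ hsupp (b • ξ)).trans (by norm_num)
    · intro k
      have h1 := ψ.continuous
      have h2 := (𝓕 f).continuous
      fun_prop
  have hTinf : ∀ k f M, (∀ x, ‖f x‖ ≤ M) → ∀ x, ‖T k f x‖ ≤ A * M := fun k f M hf x => by
    have hM : 0 ≤ M := (norm_nonneg _).trans (hf 0)
    exact (norm_scaledConvolution_le K _ f hf x).trans (by rw [hA]; linarith)
  rcases hp.eq_or_lt with rfl | hp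
  · simp_rw [ENNReal.rpow_two]
    refine (hT2 f).trans ?_
    gcongr
    exact le_max_left _ _
  · refine (tsum_lintegral_rpow_le hp hA0 (by norm_num) T hT2 hTinf f).trans ?_
    gcongr
    exact le_max_right _ _

end SchwartzMap

section MultiplierOperator

variable {n : ℕ} {m : V n → ℂ}

lemma FT_eq_fourier (f : SchwartzMap (V n) ℂ) (ξ : V n) :
    FT f ξ = 𝓕 f ((2 * Real.pi)⁻¹ • ξ) := by
  rw [SchwartzMap.fourier_coe, Real.fourier_eq', FT]
  congr with x
  rw [real_inner_smul_right, smul_eq_mul]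
  congr 2
  push_cast
  field_simp

lemma FT_dilation {a : ℝˣ} (ha : 0 < (a : ℝ)) (f : SchwartzMap (V n) ℂ) (ξ : V n) :
    FT (f.dilation a) ξ = (((a : ℝ) ^ n : ℝ) : ℂ)⁻¹ * FT f ((a : ℝ)⁻¹ • ξ) := by
  rw [FT_eq_fourier, FT_eq_fourier, SchwartzMap.fourier_dilation ha, smul_comm]

lemma integrable_FT (f : SchwartzMap (V n) ℂ) : Integrable (FT f) := by
  rw [funext (FT_eq_fourier f)]
  exact (𝓕 f).integrable.comp_smul (by positivity)

lemma continuous_multOp (hm : Continuous m) (hb : ∃ M : ℝ, ∀ ξ, ‖m ξ‖ ≤ M) (t : ℝ)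
    (f : SchwartzMap (V n) ℂ) : Continuous (multOp m t f) := by
  obtain ⟨M, hM⟩ := hb
  refine continuous_const.mul (continuous_of_dominated (bound := fun ξ => M * ‖FT f ξ‖)
    (fun x => ?_) (fun x => ae_of_all _ fun ξ => ?_) ((integrable_FT f).norm.const_mul M)
    (ae_of_all _ fun ξ => by fun_prop))
  · refine AEStronglyMeasurable.mul (Continuous.aestronglyMeasurable (by fun_prop))
      (integrable_FT f).aestronglyMeasurable
  · rw [norm_mul, norm_mul, mul_comm Complex.I, Complex.norm_exp_ofReal_mul_I, one_mul]
    gcongr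
    exact hM _

lemma multOp_congr {t : ℝ} {f g : V n → ℂ} (h : ∀ ξ, m (t • ξ) ≠ 0 → FT f ξ = FT g ξ) :
    multOp m t f = multOp m t g := by
  funext x
  simp only [multOp]
  congr 2 with ξ
  by_cases hξ : m (t • ξ) = 0
  · simp [hξ]
  · rw [h ξ hξ]

lemma multOp_mul_eq_dilation {a : ℝˣ} (ha : 0 < (a : ℝ)) (u : ℝ) (f : SchwartzMap (V n) ℂ)
    (x : V n) : multOp m (a * u) f x = multOp m u (f.dilation a) ((a : ℝ)⁻¹ • x) := by
  have hc : (((a : ℝ) ^ n : ℝ) : ℂ) ≠ 0 := by exact_mod_cast (pow_pos ha n).ne'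
  set G : V n → ℂ := fun ξ => Complex.exp (Complex.I * ((⟪(a : ℝ)⁻¹ • x, ξ⟫ : ℝ) : ℂ)) *
    m (u • ξ) * FT (f.dilation a) ξ with hG
  have h := integral_comp_smul_of_pos ha G
  have hpt : ∀ ξ, G ((a : ℝ) • ξ) = (((a : ℝ) ^ n : ℝ) : ℂ)⁻¹ *
      (Complex.exp (Complex.I * ((⟪x, ξ⟫ : ℝ) : ℂ)) * m (((a : ℝ) * u) • ξ) * FT f ξ) := by
    intro ξ
    simp only [hG]
    rw [FT_dilation ha, inv_smul_smul₀ ha.ne', real_inner_smul_left, real_inner_smul_right,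
      inv_mul_cancel_left₀ ha.ne', smul_smul, mul_comm u]
    ring
  simp_rw [hpt] at h
  rw [integral_const_mul] at h
  simp only [multOp]
  rw [mul_left_cancel₀ (inv_ne_zero hc) h]

/-- The maximal operator over `[a, 2a]` obeys the same `L^p` bound as the one over `[1, 2]`. -/
lemma lintegral_iSup_multOp_le {p : ℝ} (hp : 0 < p) {c : ℝ≥0∞}
    (H : ∀ f : SchwartzMap (V n) ℂ,
      (∫⁻ x : V n, (⨆ t : Icc (1 : ℝ) 2, (‖multOp m t f x‖₊ : ℝ≥0∞)) ^ p) ^ (1 / p) ≤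
        c * eLpNorm f (ENNReal.ofReal p) volume)
    {a : ℝ} (ha : 0 < a) (f : SchwartzMap (V n) ℂ) :
    ∫⁻ x : V n, (⨆ t : Icc (1 : ℝ) 2, ‖multOp m (a * t) f x‖ₑ) ^ p ≤
      c ^ p * ∫⁻ x, ‖f x‖ₑ ^ p := by
  have H' : ∀ g : SchwartzMap (V n) ℂ,
      ∫⁻ x : V n, (⨆ t : Icc (1 : ℝ) 2, ‖multOp m t g x‖ₑ) ^ p ≤
        c ^ p * ∫⁻ x, ‖g x‖ₑ ^ p := fun g => by
    have h := ENNReal.rpow_le_rpow (H g) hp.le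
    rwa [eLpNorm_eq_lintegral_rpow_enorm_toReal (by simpa using hp) ENNReal.ofReal_ne_top,
      ENNReal.toReal_ofReal hp.le, ENNReal.mul_rpow_of_nonneg _ _ hp.le, ← ENNReal.rpow_mul,
      ← ENNReal.rpow_mul, one_div_mul_cancel hp.ne', ENNReal.rpow_one, ENNReal.rpow_one] at h
  let a' : ℝˣ := Units.mk0 a ha.ne'
  have h1 := lintegral_comp_smul_of_pos (inv_pos.2 ha)
    fun x : V n => (⨆ t : Icc (1 : ℝ) 2, ‖multOp m t (f.dilation a') x‖ₑ) ^ p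
  have h2 := lintegral_comp_smul_of_pos ha fun x : V n => ‖f x‖ₑ ^ p
  have h3 : ∀ (t : ℝ) (x : V n),
      multOp m (a * t) f x = multOp m t (f.dilation a') (a⁻¹ • x) :=
    fun t x => multOp_mul_eq_dilation (a := a') ha t f x
  have h4 : ENNReal.ofReal ((a⁻¹ ^ n)⁻¹) * ENNReal.ofReal ((a ^ n)⁻¹) = 1 := by
    rw [← ENNReal.ofReal_mul (by positivity), inv_pow, inv_inv,
      mul_inv_cancel₀ (by positivity), ENNReal.ofReal_one]
  simp_rw [h3]
  rw [h1]
  calc _ ≤ ENNReal.ofReal ((a⁻¹ ^ n)⁻¹) * (c ^ p * ∫⁻ x, ‖f (a • x)‖ₑ ^ p) := by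
        gcongr
        exact H' (f.dilation a')
    _ = _ := by
        rw [h2, mul_left_comm, ← mul_assoc (ENNReal.ofReal _) (ENNReal.ofReal _), h4, one_mul]

lemma multOp_eq_of_annulus {lam : ℝ} (hlam : 0 < lam)
    (hsupp : ∀ ξ, m ξ ≠ 0 → lam / 2 < ‖ξ‖ ∧ ‖ξ‖ < 2 * lam) {a : ℝ} (ha : 0 < a)
    {f g : SchwartzMap (V n) ℂ}
    (hfg : ∀ ξ, 1 / 4 ≤ a * (2 * Real.pi / lam) * ‖ξ‖ → a * (2 * Real.pi / lam) * ‖ξ‖ ≤ 2 →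
      𝓕 g ξ = 𝓕 f ξ)
    {t : ℝ} (ht : t ∈ Icc (1 : ℝ) 2) : multOp m (a * t) f = multOp m (a * t) g := by
  refine multOp_congr fun ξ hξ => ?_
  obtain ⟨h1, h2⟩ := hsupp _ hξ
  have ht0 : 0 < t := by linarith [ht.1]
  rw [norm_smul, Real.norm_of_nonneg (by positivity)] at h1 h2
  have heq : a * (2 * Real.pi / lam) * ‖(2 * Real.pi)⁻¹ • ξ‖ = a * ‖ξ‖ / lam := by
    rw [norm_smul, Real.norm_of_nonneg (by positivity)]
    field_simp
  have hr : 0 ≤ a * ‖ξ‖ := by positivity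
  rw [FT_eq_fourier, FT_eq_fourier, hfg _ (by
    rw [heq, le_div_iff₀ hlam]; nlinarith [ht.2]) (by
    rw [heq, div_le_iff₀ hlam]; nlinarith [ht.1])]

end MultiplierOperator

/-- transference of maximal bounds from dyadic time intervals to all `t > 0`.
If the maximal operator `sup_{t∈[1,2]}|A_t f|` associated to a bounded continuous
multiplier `m` supported in the annulus `{λ₀/2 < |ξ| < 2λ₀}` is bounded on `L^p`
(`2 ≤ p < ∞`) with constant `C̄`, then `sup_{t>0}|A_t f|` is bounded on `L^p` with
constant `C·C̄`, where `C` depends only on `n` and `p`. -/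
theorem maximal_dyadic_transference (n : ℕ) (hn : 1 ≤ n) (p : ℝ) (hp : 2 ≤ p) :
    ∃ C : ℝ, 0 < C ∧
      ∀ lam : ℝ, 0 < lam →
      ∀ m : V n → ℂ, Continuous m → (∃ M : ℝ, ∀ ξ : V n, ‖m ξ‖ ≤ M) →
        (∀ ξ : V n, m ξ ≠ 0 → lam / 2 < ‖ξ‖ ∧ ‖ξ‖ < 2 * lam) →
      ∀ Cb : ℝ,
        (∀ f : SchwartzMap (V n) ℂ,
          (∫⁻ x : V n,
              (⨆ t : (Set.Icc (1 : ℝ) 2), (‖multOp m (t : ℝ) (⇑f) x‖₊ : ℝ≥0∞)) ^ p)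
            ^ (1 / p)
            ≤ ENNReal.ofReal Cb * eLpNorm (⇑f) (ENNReal.ofReal p) volume) →
        ∀ f : SchwartzMap (V n) ℂ,
          (∫⁻ x : V n,
              (⨆ t : {t : ℝ // 0 < t}, (‖multOp m (t : ℝ) (⇑f) x‖₊ : ℝ≥0∞)) ^ p)
            ^ (1 / p)
            ≤ ENNReal.ofReal (C * Cb) * eLpNorm (⇑f) (ENNReal.ofReal p) volume := by
  have hp0 : 0 < p := by linarith
  obtain ⟨C, hC, hT⟩ := SchwartzMap.exists_dyadic_localization n hp
  refine ⟨C ^ (1 / p), by positivity, fun lam hlam m hm hb hsupp Cb H f => ?_⟩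
  obtain ⟨T, hTF, hTp⟩ := hT (2 * Real.pi / lam) (by positivity)
  set S : ℤ → V n → ℝ≥0∞ := fun k x => ⨆ t : Icc (1 : ℝ) 2, ‖multOp m (2 ^ k * t) f x‖ₑ with hS
  have hS_meas : ∀ k, Measurable (S k) := fun k =>
    (lowerSemicontinuous_iSup fun t : Icc (1 : ℝ) 2 =>
      (continuous_multOp hm hb _ f).enorm.lowerSemicontinuous).measurable
  have hS_le : ∀ k, ∫⁻ x, S k x ^ p ≤ ENNReal.ofReal Cb ^ p * ∫⁻ x, ‖T k f x‖ₑ ^ p := by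
    intro k
    have h : S k = fun x => ⨆ t : Icc (1 : ℝ) 2, ‖multOp m (2 ^ k * t) (T k f) x‖ₑ := by
      funext x
      simp only [hS]
      congr with t
      rw [multOp_eq_of_annulus hlam hsupp (zpow_pos two_pos k) (hTF k f) t.2]
    rw [h]
    exact lintegral_iSup_multOp_le hp0 H (zpow_pos two_pos k) (T k f)
  have hsup : ∀ x, (⨆ t : {t : ℝ // 0 < t}, (‖multOp m (t : ℝ) (⇑f) x‖₊ : ℝ≥0∞)) ^ p ≤
      ∑' k, S k x ^ p := by
    intro x
    rw [← ENNReal.le_rpow_inv_iff hp0]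
    refine iSup_le fun ⟨t, ht⟩ => ?_
    rw [ENNReal.le_rpow_inv_iff hp0]
    obtain ⟨k, hk, hk'⟩ := exists_mem_Ico_zpow ht (one_lt_two (α := ℝ))
    have h2k : (0 : ℝ) < 2 ^ k := zpow_pos two_pos k
    rw [zpow_add_one₀ two_ne_zero] at hk'
    have hmem : t / 2 ^ k ∈ Icc (1 : ℝ) 2 :=
      ⟨(one_le_div h2k).2 hk, (div_le_iff₀ h2k).2 (by linarith)⟩
    have hle : ‖multOp m t f x‖ₑ ≤ S k x := by
      refine le_iSup_of_le (⟨_, hmem⟩ : Icc (1 : ℝ) 2) ?_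
      rw [mul_div_cancel₀ _ h2k.ne']
    exact (ENNReal.rpow_le_rpow hle hp0.le).trans (ENNReal.le_tsum k)
  have hmain : ∫⁻ x : V n, (⨆ t : {t : ℝ // 0 < t}, (‖multOp m (t : ℝ) (⇑f) x‖₊ : ℝ≥0∞)) ^ p ≤
      ENNReal.ofReal Cb ^ p * (ENNReal.ofReal C * ∫⁻ x, ‖f x‖ₑ ^ p) :=
    calc _ ≤ ∫⁻ x, ∑' k, S k x ^ p := lintegral_mono hsup
      _ = ∑' k, ∫⁻ x, S k x ^ p := lintegral_tsum fun k => ((hS_meas k).pow_const p).aemeasurable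
      _ ≤ ∑' k, ENNReal.ofReal Cb ^ p * ∫⁻ x, ‖T k f x‖ₑ ^ p := ENNReal.tsum_le_tsum hS_le
      _ ≤ _ := by
        rw [ENNReal.tsum_mul_left]
        gcongr
        exact hTp f
  refine (ENNReal.rpow_le_rpow hmain (by positivity)).trans (le_of_eq ?_)
  have hp' : 0 ≤ 1 / p := by positivity
  rw [eLpNorm_eq_lintegral_rpow_enorm_toReal (by simpa using hp0) ENNReal.ofReal_ne_top,
    ENNReal.toReal_ofReal hp0.le, ENNReal.mul_rpow_of_nonneg _ _ hp',
    ENNReal.mul_rpow_of_nonneg _ _ hp', ← ENNReal.rpow_mul, mul_one_div_cancel hp0.ne',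
    ENNReal.rpow_one, ENNReal.ofReal_mul (by positivity),
    ENNReal.ofReal_rpow_of_nonneg hC.le hp', ← mul_assoc, mul_comm (ENNReal.ofReal Cb)]
end
end

section
/- Suppose F : [1,2] → ℂ is continuously differentiable and p > 1. Then sup_{1≤t≤2} |F(t)|^p ≤ |F(1)|^p + p (∫₁² |F(t)|^p dt)^{(p−1)/p} (∫₁² |F′(t)|^p dt)^{1/p}. -/
open MeasureTheory

noncomputable section

/-- Chain rule for `‖f‖ ^ p` along a curve. -/
lemma hasDerivAt_norm_rpow_comp {E : Type*} [NormedAddCommGroup E] [InnerProductSpace ℝ E]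
    {f : ℝ → E} {f' : E} {t p : ℝ} (hp : 1 < p) (hf : HasDerivAt f f' t) :
    HasDerivAt (fun x ↦ ‖f x‖ ^ p) (p * ‖f t‖ ^ (p - 2) * inner ℝ (f t) f') t := by
  simpa using! (hasFDerivAt_norm_rpow (f t) hp).comp_hasDerivAt t hf

lemma abs_mul_norm_rpow_mul_inner_le {E : Type*} [NormedAddCommGroup E] [InnerProductSpace ℝ E]
    {p : ℝ} (hp : 1 < p) (x y : E) :
    |p * ‖x‖ ^ (p - 2) * inner ℝ x y| ≤ p * (‖x‖ ^ (p - 1) * ‖y‖) := by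
  have hx : ‖x‖ ^ (p - 2) * ‖x‖ = ‖x‖ ^ (p - 1) := by
    rw [← Real.rpow_add_one' (norm_nonneg x) (by linarith)]
    ring_nf
  calc |p * ‖x‖ ^ (p - 2) * inner ℝ x y| = p * ‖x‖ ^ (p - 2) * |inner ℝ x y| := by
        rw [abs_mul, abs_of_nonneg (by positivity)]
    _ ≤ p * ‖x‖ ^ (p - 2) * (‖x‖ * ‖y‖) := by
        gcongr
        exact abs_real_inner_le_norm x y
    _ = p * (‖x‖ ^ (p - 1) * ‖y‖) := by rw [← hx]; ring

/-- A continuous function on a compact interval is in every `Lᵖ`. -/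
lemma ContinuousOn.memLp_restrict_Ioc {E : Type*} [NormedAddCommGroup E] {f : ℝ → E} {a b : ℝ}
    (hf : ContinuousOn f (Set.Icc a b)) (q : ENNReal) :
    MemLp f q (volume.restrict (Set.Ioc a b)) := by
  obtain ⟨C, hC⟩ := isCompact_Icc.exists_bound_of_continuousOn hf
  refine MemLp.of_bound ((hf.aestronglyMeasurable_of_isCompact isCompact_Icc
    measurableSet_Icc).mono_measure (Measure.restrict_mono Set.Ioc_subset_Icc_self le_rfl)) C ?_
  filter_upwards [ae_restrict_mem measurableSet_Ioc] with t ht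
  exact hC t (Set.Ioc_subset_Icc_self ht)

/-- Hölder's inequality for `‖f‖ ^ (p - 1) * ‖g‖` on a compact interval. -/
lemma integral_norm_rpow_sub_one_mul_norm_le {E G : Type*} [NormedAddCommGroup E]
    [NormedAddCommGroup G] {f : ℝ → E} {g : ℝ → G} {a b p : ℝ} (hab : a ≤ b) (hp : 1 < p)
    (hf : ContinuousOn f (Set.Icc a b)) (hg : ContinuousOn g (Set.Icc a b)) :
    ∫ t in a..b, ‖f t‖ ^ (p - 1) * ‖g t‖ ≤
      (∫ t in a..b, ‖f t‖ ^ p) ^ ((p - 1) / p) * (∫ t in a..b, ‖g t‖ ^ p) ^ (1 / p) := by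
  have hp0 : 0 < p - 1 := sub_pos.2 hp
  have hfp : ContinuousOn (fun t ↦ ‖f t‖ ^ (p - 1)) (Set.Icc a b) :=
    hf.norm.rpow_const fun _ _ ↦ Or.inr hp0.le
  have holder := integral_mul_le_Lp_mul_Lq_of_nonneg
    (μ := volume.restrict (Set.Ioc a b)) (Real.HolderConjugate.conjExponent hp).symm
    (.of_forall fun t ↦ Real.rpow_nonneg (norm_nonneg (f t)) (p - 1))
    (.of_forall fun t ↦ norm_nonneg (g t))
    (hfp.memLp_restrict_Ioc _) (hg.norm.memLp_restrict_Ioc _)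
  have hpow (t : ℝ) : (‖f t‖ ^ (p - 1)) ^ p.conjExponent = ‖f t‖ ^ p := by
    rw [← Real.rpow_mul (norm_nonneg _), Real.conjExponent, mul_div_cancel₀ _ hp0.ne']
  simp_rw [hpow, Real.conjExponent, one_div_div] at holder
  simpa only [intervalIntegral.integral_of_le hab] using holder

/-- Integrating the derivative of `‖f‖ ^ p`. -/
lemma norm_rpow_le_add_integral {E : Type*} [NormedAddCommGroup E] [InnerProductSpace ℝ E]
    {f f' : ℝ → E} {a b p : ℝ} (hp : 1 < p)
    (hf : ∀ t ∈ Set.Icc a b, HasDerivWithinAt f (f' t) (Set.Icc a b) t)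
    (hf' : ContinuousOn f' (Set.Icc a b)) {t : ℝ} (ht : t ∈ Set.Icc a b) :
    ‖f t‖ ^ p ≤ ‖f a‖ ^ p + p * ∫ s in a..b, ‖f s‖ ^ (p - 1) * ‖f' s‖ := by
  have hfc : ContinuousOn f (Set.Icc a b) := fun s hs ↦ (hf s hs).continuousWithinAt
  have hint : IntervalIntegrable (fun s ↦ p * (‖f s‖ ^ (p - 1) * ‖f' s‖)) volume a b := by
    refine ContinuousOn.intervalIntegrable_of_Icc (ht.1.trans ht.2) ?_
    exact continuousOn_const.mul
      ((hfc.norm.rpow_const fun _ _ ↦ Or.inr (sub_pos.2 hp).le).mul hf'.norm)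
  have hderiv (s : ℝ) (hs : s ∈ Set.Ioo a t) :
      HasDerivAt (fun x ↦ ‖f x‖ ^ p) (p * ‖f s‖ ^ (p - 2) * inner ℝ (f s) (f' s)) s :=
    hasDerivAt_norm_rpow_comp hp ((hf s ⟨hs.1.le, hs.2.le.trans ht.2⟩).hasDerivAt
      (Icc_mem_nhds hs.1 (hs.2.trans_le ht.2)))
  have hbound := norm_sub_le_integral_of_norm_deriv_le_of_le ht.1
    ((hfc.norm.rpow_const fun _ _ ↦ Or.inr (by linarith)).mono (Set.Icc_subset_Icc_right ht.2))
    (fun s hs ↦ (hderiv s hs).differentiableAt.differentiableWithinAt)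
    (.of_forall fun s hs ↦ by
      rw [(hderiv s hs).deriv]
      exact abs_mul_norm_rpow_mul_inner_le hp (f s) (f' s))
    (hint.mono_set (by
      rw [Set.uIcc_of_le ht.1, Set.uIcc_of_le (ht.1.trans ht.2)]
      exact Set.Icc_subset_Icc_right ht.2))
  have hmono : ∫ s in a..t, p * (‖f s‖ ^ (p - 1) * ‖f' s‖) ≤
      ∫ s in a..b, p * (‖f s‖ ^ (p - 1) * ‖f' s‖) :=
    intervalIntegral.integral_mono_interval le_rfl ht.1 ht.2
      (.of_forall fun s ↦ by
        have : 0 ≤ p := by linarith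
        simp only [Pi.zero_apply]
        positivity) hint
  rw [← intervalIntegral.integral_const_mul]
  linarith [(le_abs_self _).trans hbound]

/-- if `F : [1,2] → ℂ` is continuously differentiable and `p > 1`, then
`sup_{1≤t≤2}|F(t)|^p ≤ |F(1)|^p + p (∫₁²|F(t)|^p dt)^{(p−1)/p} (∫₁²|F′(t)|^p dt)^{1/p}`. -/
theorem sup_pow_le_of_C1 (p : ℝ) (hp : 1 < p) (F F' : ℝ → ℂ)
    (hF : ∀ t ∈ Set.Icc (1 : ℝ) 2, HasDerivWithinAt F (F' t) (Set.Icc (1 : ℝ) 2) t)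
    (hF' : ContinuousOn F' (Set.Icc (1 : ℝ) 2)) :
    (⨆ t : (Set.Icc (1 : ℝ) 2), ‖F (t : ℝ)‖ ^ p)
      ≤ ‖F 1‖ ^ p
        + p * (∫ t in (1 : ℝ)..2, ‖F t‖ ^ p) ^ ((p - 1) / p)
            * (∫ t in (1 : ℝ)..2, ‖F' t‖ ^ p) ^ (1 / p) := by
  have hFc : ContinuousOn F (Set.Icc 1 2) := fun t ht ↦ (hF t ht).continuousWithinAt
  have : Nonempty (Set.Icc (1 : ℝ) 2) := ⟨⟨1, by norm_num⟩⟩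
  refine ciSup_le fun t ↦ (norm_rpow_le_add_integral hp hF hF' t.2).trans ?_
  rw [mul_assoc]
  gcongr
  exact integral_norm_rpow_sub_one_mul_norm_le one_le_two hp hFc hF'
end
end

section
/- Let n ≥ 2 and 2(n+1)/(n−1) ≤ p < ∞. Let ϕ be a smooth real-valued phase on ℝⁿ×ℝ^{n−1} satisfying the Carleson–Sjölin condition with amplitude a ∈ C_c^∞(ℝⁿ×ℝ^{n−1}), and set T_λ f(x) := ∫_{ℝ^{n−1}} e^{iλϕ(x;y′)} a(x;y′) f(y′) dy′. Then for every ε > 0 there is a constant C_ε such that ‖T_λ f‖_{L^p(ℝⁿ)} ≤ C_ε λ^{−n/p+ε} ‖f‖_{L^p(ℝ^{n−1})} for all λ ≥ 1 and all f ∈ S(ℝ^{n−1}). (A weaker version of Stein's oscillatory integral theorem, recovered from the sharp local smoothing estimates for Fourier integral operators.) -/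
open MeasureTheory
open scoped RealInnerProductSpace ENNReal

noncomputable section

/-- The gradient `∇_xϕ(x;y′) ∈ ℝⁿ`. -/
def gradX {n m : ℕ} (ϕ : V n × V m → ℝ) (x : V n) (y : V m) : V n :=
  (EuclideanSpace.equiv (Fin n) ℝ).symm fun i =>
    fderiv ℝ (fun x' => ϕ (x', y)) x (EuclideanSpace.single i 1)

/-- The `n × (n−1)` mixed Hessian `∂²_{xy′}ϕ(x;y′)`. -/
def csMixed {n m : ℕ} (ϕ : V n × V m → ℝ) (x : V n) (y : V m) :
    Matrix (Fin n) (Fin m) ℝ :=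
  Matrix.of fun i j =>
    fderiv ℝ (fun y' => fderiv ℝ (fun x' => ϕ (x', y')) x (EuclideanSpace.single i 1)) y
      (EuclideanSpace.single j 1)

/-- The curvature matrix `∂²_{y′y′}⟨∇_xϕ(x₀;y′), N⟩|_{y′=y₀′}`. -/
def csCurv {n m : ℕ} (ϕ : V n × V m → ℝ) (x : V n) (y : V m) (N : V n) :
    Matrix (Fin m) (Fin m) ℝ :=
  Matrix.of fun j k =>
    fderiv ℝ (fun y' => fderiv ℝ (fun y'' => (⟪gradX ϕ x y'', N⟫ : ℝ)) y'
      (EuclideanSpace.single k 1)) y (EuclideanSpace.single j 1)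

/-- The Carleson–Sjölin condition for a smooth phase `ϕ` on `ℝⁿ × ℝ^{n−1}` with
amplitude `a ∈ C_c^∞`: (i) `rank ∂²_{xy′}ϕ = n−1` on `supp a`; (ii) for every unit
vector `N(x₀;y₀′)` orthogonal to the vectors `∂_{y′_j}∇_xϕ(x₀;y₀′)`, the matrix
`∂²_{y′y′}⟨∇_xϕ(x₀;y′), N(x₀;y₀′)⟩|_{y′=y₀′}` is nonsingular. -/
def CarlesonSjolin (n : ℕ) (a : V n × V (n - 1) → ℂ) (ϕ : V n × V (n - 1) → ℝ) : Prop :=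
  (∀ p ∈ tsupport a, (csMixed ϕ p.1 p.2).rank = n - 1) ∧
  (∀ p ∈ tsupport a, ∀ N : V n, ‖N‖ = 1 →
    (∀ j : Fin (n - 1),
      (⟪N, (EuclideanSpace.equiv (Fin n) ℝ).symm fun i => csMixed ϕ p.1 p.2 i j⟫ : ℝ) = 0) →
    (csCurv ϕ p.1 p.2 N).det ≠ 0)

/-- The oscillatory integral operator
`T_λ f(x) = ∫_{ℝ^{n−1}} e^{iλϕ(x;y′)} a(x;y′) f(y′) dy′`. -/
def oscInt {n : ℕ} (lam : ℝ) (ϕ : V n × V (n - 1) → ℝ) (a : V n × V (n - 1) → ℂ)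
    (f : V (n - 1) → ℂ) (x : V n) : ℂ :=
  ∫ y : V (n - 1), Complex.exp (Complex.I * ((lam * ϕ (x, y) : ℝ) : ℂ)) * a (x, y) * f y

lemma contDiff_nat_intervalIntegral {P : Type} [NormedAddCommGroup P] [NormedSpace ℝ P]
    [FiniteDimensional ℝ P] (k : ℕ) :
    ∀ {G : Type} [NormedAddCommGroup G] [NormedSpace ℝ G] [CompleteSpace G] (H : P × ℝ → G),
      ContDiff ℝ k H → ContDiff ℝ k (fun p => ∫ t in (0 : ℝ)..1, H (p, t)) := by
  induction k with
  | zero =>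
    intro G _ _ _ H hH
    have hc : Continuous H := hH.continuous
    exact contDiff_zero.2 (intervalIntegral.continuous_parametric_intervalIntegral_of_continuous'
      (f := fun p t => H (p, t)) (by simpa [Function.uncurry_def] using hc) 0 1)
  | succ k ih =>
    intro G _ _ _ H hH
    push_cast at hH ⊢
    have hc : Continuous H := hH.continuous
    have hd : Differentiable ℝ H := hH.differentiable (by simp)
    have hfd : ContDiff ℝ k (fderiv ℝ H) := hH.fderiv_right le_rfl
    let H' : P × ℝ → (P →L[ℝ] G) := fun q => (fderiv ℝ H q).comp (ContinuousLinearMap.inl ℝ P ℝ)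
    have hH' : ContDiff ℝ k H' := hfd.clm_comp contDiff_const
    have hcH' : Continuous H' := hH'.continuous
    refine contDiff_succ_iff_hasFDerivAt.2 ⟨fun p => ∫ t in (0 : ℝ)..1, H' (p, t), ih H' hH', ?_⟩
    intro p
    have hK : IsCompact (Metric.closedBall p 1 ×ˢ Set.uIcc (0 : ℝ) 1) :=
      (isCompact_closedBall p 1).prod isCompact_uIcc
    obtain ⟨C, hC⟩ := hK.exists_bound_of_continuousOn hcH'.continuousOn
    refine intervalIntegral.hasFDerivAt_integral_of_dominated_of_fderiv_le
      (F := fun p t => H (p, t)) (F' := fun p t => H' (p, t)) (bound := fun _ => C)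
      (Metric.closedBall_mem_nhds p one_pos) ?_ ?_ ?_ ?_ ?_ ?_
    · exact Filter.Eventually.of_forall fun q =>
        (hc.comp (by fun_prop : Continuous fun t : ℝ => (q, t))).aestronglyMeasurable
    · exact (hc.comp (by fun_prop : Continuous fun t : ℝ => (p, t))).intervalIntegrable _ _
    · exact (hcH'.comp (by fun_prop : Continuous fun t : ℝ => (p, t))).aestronglyMeasurable
    · exact Filter.Eventually.of_forall fun t ht q hq =>
        hC (q, t) ⟨hq, Set.uIoc_subset_uIcc ht⟩
    · exact intervalIntegrable_const
    · refine Filter.Eventually.of_forall fun t _ q _ => ?_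
      exact (hd (q, t)).hasFDerivAt.comp q (hasFDerivAt_prodMk_left q t)

lemma ContDiff.intervalIntegral_param {P G : Type} [NormedAddCommGroup P] [NormedSpace ℝ P]
    [FiniteDimensional ℝ P] [NormedAddCommGroup G] [NormedSpace ℝ G] [CompleteSpace G]
    {H : P × ℝ → G} (hH : ContDiff ℝ (⊤ : ℕ∞) H) :
    ContDiff ℝ (⊤ : ℕ∞) (fun p => ∫ t in (0 : ℝ)..1, H (p, t)) :=
  contDiff_infty.2 fun k => contDiff_nat_intervalIntegral k H (contDiff_infty.1 hH k)

lemma integral_fderiv_apply_eq_zero {E : Type} [NormedAddCommGroup E] [NormedSpace ℝ E]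
    [FiniteDimensional ℝ E] [MeasurableSpace E] [BorelSpace E] (μ : Measure E)
    [μ.IsAddHaarMeasure] {h : E → ℂ} (hh : ContDiff ℝ 1 h) (hs : HasCompactSupport h) (v : E) :
    ∫ x, fderiv ℝ h x v ∂μ = 0 := by
  have hi : Integrable (fun x => fderiv ℝ h x v) μ :=
    ((hh.continuous_fderiv one_ne_zero).clm_apply continuous_const).integrable_of_hasCompactSupport
      (hs.fderiv_apply ℝ v)
  have := integral_smul_fderiv_eq_neg_fderiv_smul_of_integrable (μ := μ) (𝕜 := ℝ)
    (f := fun _ : E => (1 : ℝ)) (g := h) (v := v) (by simp) (by simpa using hi)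
    (by simpa using hh.continuous.integrable_of_hasCompactSupport hs) (by simp)
    (fun x _ => hh.differentiable one_ne_zero x)
  simpa using this

/-- Non-stationary phase with smooth dependence on parameters: if the derivative of the phase in
the direction `v` does not vanish on the support of the amplitude, the integral decays rapidly,
even in presence of a cutoff `c` that is invariant in the direction `v`. -/
theorem nonstationary_phase {P E : Type} [NormedAddCommGroup P] [NormedSpace ℝ P]
    [NormedAddCommGroup E] [NormedSpace ℝ E]
    [FiniteDimensional ℝ E] [MeasurableSpace E] [BorelSpace E] (μ : Measure E)
    [μ.IsAddHaarMeasure] {Ψ : P × E → ℝ} (hΨ : ContDiff ℝ (⊤ : ℕ∞) Ψ) (v : E) {B : Set E}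
    (hB : IsCompact B) (N : ℕ) :
    ∀ b : P × E → ℂ, ContDiff ℝ (⊤ : ℕ∞) b → HasCompactSupport b →
      (∀ q ∈ tsupport b, q.2 ∈ B) → (∀ q ∈ tsupport b, fderiv ℝ Ψ q (0, v) ≠ 0) →
      ∃ C : ℝ, 0 ≤ C ∧ ∀ (p : P) (lam : ℝ) (c : E → ℝ), ContDiff ℝ 1 c →
        (∀ x, fderiv ℝ c x v = 0) →
        |lam| ^ N * ‖∫ x, (c x : ℂ) *
            (Complex.exp (Complex.I * ((lam * Ψ (p, x) : ℝ) : ℂ)) * b (p, x)) ∂μ‖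
          ≤ C * ∫ x in B, |c x| ∂μ := by
  induction N with
  | zero =>
    intro b hb hbs hbB _
    obtain ⟨C, hC⟩ := hbs.exists_bound_of_continuous hb.continuous
    refine ⟨max C 0, le_max_right _ _, fun p lam c hc _ => ?_⟩
    have hci : IntegrableOn (fun x => |c x|) B μ := hc.continuous.abs.continuousOn.integrableOn_compact hB
    rw [pow_zero, one_mul, ← integral_const_mul, ← integral_indicator hB.measurableSet]
    refine norm_integral_le_of_norm_le ((integrable_indicator_iff hB.measurableSet).2
      (Integrable.const_mul hci (max C 0))) ?_
    refine Filter.Eventually.of_forall fun x => ?_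
    by_cases hx : x ∈ B
    · rw [Set.indicator_of_mem hx, norm_mul, norm_mul, mul_comm Complex.I,
        Complex.norm_exp_ofReal_mul_I, one_mul, Complex.norm_real, Real.norm_eq_abs, mul_comm]
      gcongr
      exact (hC _).trans (le_max_left _ _)
    · have : b (p, x) = 0 := by
        by_contra h0
        exact hx (hbB (p, x) (subset_tsupport b h0))
      simp [this, hx]
  | succ N ih =>
    intro b hb hbs hbB hbΨ
    let G : P × E → ℝ := fun q => fderiv ℝ Ψ q (0, v)
    have hG : ContDiff ℝ (⊤ : ℕ∞) G := (hΨ.fderiv_right (by simp)).clm_apply contDiff_const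
    let g : P × E → ℂ := fun q => b q / (G q : ℂ)
    have hg0 : ∀ q, q ∉ tsupport b → g =ᶠ[nhds q] fun _ => 0 := fun q hq => by
      filter_upwards [(isClosed_tsupport b).isOpen_compl.mem_nhds hq] with q' hq'
      simp [g, image_eq_zero_of_notMem_tsupport hq']
    have hg : ContDiff ℝ (⊤ : ℕ∞) g := by
      refine contDiff_iff_contDiffAt.2 fun q => ?_
      by_cases hq : q ∈ tsupport b
      · have h1 : ContDiffAt ℝ (⊤ : ℕ∞) (fun q => (G q : ℂ)⁻¹) q :=
          ContDiffAt.inv (Complex.ofRealCLM.contDiff.comp hG).contDiffAt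
            (by simpa [G] using hbΨ q hq)
        simpa only [g, div_eq_mul_inv] using hb.contDiffAt.mul h1
      · exact contDiffAt_const.congr_of_eventuallyEq (hg0 q hq)
    have hgb : tsupport g ⊆ tsupport b := by
      intro q hq
      by_contra h
      exact (notMem_tsupport_iff_eventuallyEq.2 (hg0 q h)) hq
    have hgs : HasCompactSupport g := hbs.of_isClosed_subset (isClosed_tsupport g) hgb
    let b' : P × E → ℂ := fun q => fderiv ℝ g q (0, v)
    have hb' : ContDiff ℝ (⊤ : ℕ∞) b' := (hg.fderiv_right (by simp)).clm_apply contDiff_const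
    have hb's : HasCompactSupport b' := hgs.fderiv_apply ℝ _
    have hb'b : tsupport b' ⊆ tsupport b := (tsupport_fderiv_apply_subset ℝ _).trans hgb
    obtain ⟨C, hC0, hC⟩ := ih b' hb' hb's (fun q hq => hbB q (hb'b hq))
      (fun q hq => hbΨ q (hb'b hq))
    refine ⟨C, hC0, fun p lam c hc hcv => ?_⟩
    refine le_trans (le_of_eq ?_) (hC p lam c hc hcv)
    rw [pow_succ, mul_assoc]
    congr 1
    have hι : ∀ x, HasFDerivAt (fun x : E => (p, x)) (ContinuousLinearMap.inr ℝ P E) x :=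
      fun x => hasFDerivAt_prodMk_right p x
    let e : E → ℂ := fun x => Complex.exp (Complex.I * ((lam * Ψ (p, x) : ℝ) : ℂ))
    have hιs : ContDiff ℝ 1 (fun x : E => (p, x)) := by fun_prop
    have he : ContDiff ℝ 1 e := by
      refine ContDiff.cexp (contDiff_const.mul (Complex.ofRealCLM.contDiff.comp ?_))
      exact contDiff_const.mul ((hΨ.of_le (by simp)).comp hιs)
    have hgp : ContDiff ℝ 1 (fun x => g (p, x)) := (hg.of_le (by simp)).comp hιs
    let h : E → ℂ := fun x => (c x : ℂ) * (e x * g (p, x))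
    have hh : ContDiff ℝ 1 h := (Complex.ofRealCLM.contDiff.comp hc).mul (he.mul hgp)
    have hgps : HasCompactSupport (fun x => g (p, x)) := by
      refine HasCompactSupport.intro hB fun x hx => ?_
      by_contra h0
      exact hx (hbB (p, x) (hgb (subset_tsupport g h0)))
    have hhs : HasCompactSupport h := (hgps.mul_left (f := e)).mul_left
    have hder : ∀ x, fderiv ℝ h x v = Complex.I * lam * ((c x : ℂ) * (e x * b (p, x)))
        + (c x : ℂ) * (e x * b' (p, x)) := by
      intro x
      have d1 : HasFDerivAt (fun x => (c x : ℂ)) (Complex.ofRealCLM.comp (fderiv ℝ c x)) x :=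
        Complex.ofRealCLM.hasFDerivAt.comp x (hc.differentiable one_ne_zero x).hasFDerivAt
      have d2 : HasFDerivAt (fun x => g (p, x))
          ((fderiv ℝ g (p, x)).comp (ContinuousLinearMap.inr ℝ P E)) x :=
        (hg.differentiable (by simp) (p, x)).hasFDerivAt.comp x (hι x)
      have d3 : HasFDerivAt (fun x => Ψ (p, x))
          ((fderiv ℝ Ψ (p, x)).comp (ContinuousLinearMap.inr ℝ P E)) x :=
        (hΨ.differentiable (by simp) (p, x)).hasFDerivAt.comp x (hι x)
      have d4 : HasFDerivAt e _ x :=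
        ((Complex.ofRealCLM.hasFDerivAt.comp x (d3.const_mul lam)).const_mul Complex.I).cexp
      have d5 : HasFDerivAt h _ x := d1.mul (d4.mul d2)
      rw [d5.fderiv]
      have hbg : b (p, x) = (fderiv ℝ Ψ (p, x) (0, v) : ℂ) * g (p, x) := by
        by_cases hq : (p, x) ∈ tsupport b
        · have : (fderiv ℝ Ψ (p, x) (0, v) : ℂ) ≠ 0 := by exact_mod_cast hbΨ _ hq
          simp only [g, G]
          field_simp
        · simp [g, image_eq_zero_of_notMem_tsupport hq]
      simp [hcv x, hbg, b', e]
      ring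
    have hz := integral_fderiv_apply_eq_zero μ hh hhs v
    simp_rw [hder] at hz
    have hbps : HasCompactSupport (fun x => b (p, x)) := by
      refine HasCompactSupport.intro hB fun x hx => ?_
      by_contra h0
      exact hx (hbB (p, x) (subset_tsupport b h0))
    have hb'ps : HasCompactSupport (fun x => b' (p, x)) := by
      refine HasCompactSupport.intro hB fun x hx => ?_
      by_contra h0
      exact hx (hbB (p, x) (hb'b (subset_tsupport b' h0)))
    have hcc : Continuous fun x => (c x : ℂ) := Complex.continuous_ofReal.comp hc.continuous
    have i1 : Integrable (fun x => (c x : ℂ) * (e x * b (p, x))) μ :=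
      (hcc.mul (he.continuous.mul (hb.continuous.comp hιs.continuous))).integrable_of_hasCompactSupport
        ((hbps.mul_left (f := e)).mul_left)
    have i2 : Integrable (fun x => (c x : ℂ) * (e x * b' (p, x))) μ :=
      (hcc.mul (he.continuous.mul (hb'.continuous.comp hιs.continuous))).integrable_of_hasCompactSupport
        ((hb'ps.mul_left (f := e)).mul_left)
    rw [integral_add (i1.const_mul _) i2, integral_const_mul] at hz
    have hz' := eq_neg_of_add_eq_zero_right hz
    simp only [e] at hz'
    rw [hz', norm_neg, norm_mul, norm_mul]
    simp

/-- The divided difference `(φ (u + s • η, x) - φ (u, x)) / s` of a smooth function, extended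
smoothly to `s = 0`, as a function of `((u, s, η), x)`. -/
def divDiff {F E : Type} [NormedAddCommGroup F] [NormedSpace ℝ F] [NormedAddCommGroup E]
    [NormedSpace ℝ E] (φ : F × E → ℝ) (q : (F × ℝ × F) × E) : ℝ :=
  ∫ t in (0 : ℝ)..1, fderiv ℝ φ (q.1.1 + (t * q.1.2.1) • q.1.2.2, q.2) (q.1.2.2, 0)

section divDiff

variable {F E : Type} [NormedAddCommGroup F] [NormedSpace ℝ F]
  [NormedAddCommGroup E] [NormedSpace ℝ E] {φ : F × E → ℝ}

lemma divDiff_zero (u η : F) (x : E) : divDiff φ ((u, 0, η), x) = fderiv ℝ φ (u, x) (η, 0) := by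
  simp [divDiff]

lemma contDiff_divDiff [FiniteDimensional ℝ F] [FiniteDimensional ℝ E]
    (hφ : ContDiff ℝ (⊤ : ℕ∞) φ) : ContDiff ℝ (⊤ : ℕ∞) (divDiff φ) := by
  have h1 : ContDiff ℝ (⊤ : ℕ∞) (fderiv ℝ φ) := hφ.fderiv_right (by simp)
  have : ContDiff ℝ (⊤ : ℕ∞) (fun r : ((F × ℝ × F) × E) × ℝ =>
      fderiv ℝ φ (r.1.1.1 + (r.2 * r.1.1.2.1) • r.1.1.2.2, r.1.2) (r.1.1.2.2, 0)) := by
    refine (h1.comp ?_).clm_apply ?_ <;> fun_prop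
  exact this.intervalIntegral_param

lemma mul_divDiff (hφ : ContDiff ℝ (⊤ : ℕ∞) φ) (u η : F) (s : ℝ) (x : E) :
    s * divDiff φ ((u, s, η), x) = φ (u + s • η, x) - φ (u, x) := by
  have hd : ∀ t : ℝ, HasDerivAt (fun t : ℝ => φ (u + (t * s) • η, x))
      (s * fderiv ℝ φ (u + (t * s) • η, x) (η, 0)) t := by
    intro t
    have h1 : HasDerivAt (fun t : ℝ => (u + (t * s) • η, x)) (s • η, (0 : E)) t := by
      refine HasDerivAt.prodMk ?_ (hasDerivAt_const t x)
      simpa using (((hasDerivAt_id t).mul_const s).smul_const η).const_add u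
    have h2 := (hφ.differentiable (by simp) (u + (t * s) • η, x)).hasFDerivAt.comp_hasDerivAt t h1
    rw [show ((s • η, (0 : E)) : F × E) = s • (η, 0) by simp, map_smul, smul_eq_mul] at h2
    exact h2
  have hcont : Continuous fun t : ℝ => s * fderiv ℝ φ (u + (t * s) • η, x) (η, 0) := by
    have h1 : ContDiff ℝ (⊤ : ℕ∞) (fderiv ℝ φ) := hφ.fderiv_right (by simp)
    exact continuous_const.mul ((h1.continuous.comp (by fun_prop)).clm_apply continuous_const)
  have := intervalIntegral.integral_eq_sub_of_hasDerivAt (a := 0) (b := 1)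
    (fun t _ => hd t) (hcont.intervalIntegrable 0 1)
  rw [intervalIntegral.integral_const_mul] at this
  simpa [divDiff] using this

end divDiff

/-- Decay of integrals with phase `φ (u + s • η, x) - φ (u, x)`, where `η` is restricted to a set
`T`, where amplitudes are supported near `x₀`, and where the cutoffs have vanishing derivatives in
the directions in `W`. -/
def DiffDecay {F E : Type} [NormedAddCommGroup F] [NormedSpace ℝ F]
    [NormedAddCommGroup E] [NormedSpace ℝ E] [MeasurableSpace E] (μ : Measure E)
    (φ : F × E → ℝ) (u₀ : F) (x₀ : E) (W : Set E) (ρ : ℝ) (T : Set F) : Prop :=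
  ∀ b : F × F × E → ℂ, ContDiff ℝ (⊤ : ℕ∞) b →
    (∀ u u' x, b (u, u', x) ≠ 0 → x ∈ Metric.closedBall x₀ ρ) → ∀ N : ℕ, ∃ C : ℝ, 0 ≤ C ∧
    ∀ u ∈ Metric.closedBall u₀ ρ, ∀ s : ℝ, |s| ≤ ρ → ∀ η ∈ T, ∀ (lam : ℝ) (c : E → ℝ),
      ContDiff ℝ 1 c → (∀ v ∈ W, ∀ x, fderiv ℝ c x v = 0) →
      |lam * s| ^ N * ‖∫ x, (c x : ℂ) * (Complex.exp
          (Complex.I * ((lam * (φ (u + s • η, x) - φ (u, x)) : ℝ) : ℂ)) *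
            b (u, u + s • η, x)) ∂μ‖ ≤ C * ∫ x in Metric.closedBall x₀ 1, |c x| ∂μ

section decay

variable {F E : Type} [NormedAddCommGroup F] [NormedSpace ℝ F]
  [NormedAddCommGroup E] [NormedSpace ℝ E] [MeasurableSpace E] {μ : Measure E} {φ : F × E → ℝ}

lemma DiffDecay.mono {u₀ : F} {x₀ : E} {W : Set E} {ρ ρ' : ℝ} {T T' : Set F}
    (h : DiffDecay μ φ u₀ x₀ W ρ T) (hρ : ρ' ≤ ρ) (hT : T' ⊆ T) :
    DiffDecay μ φ u₀ x₀ W ρ' T' := by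
  intro b hb hbs N
  obtain ⟨C, hC0, hC⟩ := h b hb
    (fun u u' x hx => Metric.closedBall_subset_closedBall hρ (hbs u u' x hx)) N
  exact ⟨C, hC0, fun u hu s hs η hη => hC u (Metric.closedBall_subset_closedBall hρ hu) s
    (hs.trans hρ) η (hT hη)⟩

lemma DiffDecay.union {u₀ : F} {x₀ : E} {W : Set E} {ρ : ℝ} {T T' : Set F}
    (h : DiffDecay μ φ u₀ x₀ W ρ T) (h' : DiffDecay μ φ u₀ x₀ W ρ T') :
    DiffDecay μ φ u₀ x₀ W ρ (T ∪ T') := by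
  intro b hb hbs N
  obtain ⟨C, hC0, hC⟩ := h b hb hbs N
  obtain ⟨C', _, hC'⟩ := h' b hb hbs N
  refine ⟨max C C', le_max_of_le_left hC0, fun u hu s hs η hη lam c hc hcW => ?_⟩
  have h0 : 0 ≤ ∫ x in Metric.closedBall x₀ 1, |c x| ∂μ := integral_nonneg fun x => abs_nonneg _
  rcases hη with hη | hη
  · exact (hC u hu s hs η hη lam c hc hcW).trans (by gcongr; exact le_max_left _ _)
  · exact (hC' u hu s hs η hη lam c hc hcW).trans (by gcongr; exact le_max_right _ _)

variable [FiniteDimensional ℝ F] [FiniteDimensional ℝ E] [BorelSpace E] [μ.IsAddHaarMeasure]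

lemma exists_diffDecay_closedBall (hφ : ContDiff ℝ (⊤ : ℕ∞) φ) {u₀ η₀ : F} {x₀ v : E} {W : Set E}
    (hv : v ∈ W) (h : fderiv ℝ (fun x => fderiv ℝ φ (u₀, x) (η₀, 0)) x₀ v ≠ 0) :
    ∃ ρ : ℝ, 0 < ρ ∧ ρ ≤ 1 ∧ DiffDecay μ φ u₀ x₀ W ρ (Metric.closedBall η₀ ρ) := by
  have hD := contDiff_divDiff hφ
  set p₀ : F × ℝ × F := (u₀, 0, η₀) with hp₀
  have hne : fderiv ℝ (divDiff φ) (p₀, x₀) (0, v) ≠ 0 := by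
    have h1 := ((hD.differentiable (by simp) (p₀, x₀)).hasFDerivAt.comp x₀
      (hasFDerivAt_prodMk_right p₀ x₀)).fderiv
    have h2 : (divDiff φ ∘ fun x : E => (p₀, x)) = fun x => fderiv ℝ φ (u₀, x) (η₀, 0) := by
      ext x
      exact divDiff_zero u₀ η₀ x
    rw [h2] at h1
    rw [h1] at h
    simpa using h
  have hcont : Continuous fun q => fderiv ℝ (divDiff φ) q (0, v) :=
    (hD.continuous_fderiv (by simp)).clm_apply continuous_const
  obtain ⟨δ, hδ, hball⟩ := Metric.nhds_basis_closedBall.eventually_iff.1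
    (hcont.continuousAt.eventually_ne hne)
  set ρ := min (δ / 2) 1 with hρdef
  have hρ : 0 < ρ := lt_min (by positivity) one_pos
  have hρ1 : ρ ≤ 1 := min_le_right _ _
  have hρδ : 2 * ρ ≤ δ := by have := min_le_left (δ / 2) 1; rw [← hρdef] at this; linarith
  refine ⟨ρ, hρ, hρ1, fun b hb hbs N => ?_⟩
  let χ : ContDiffBump p₀ := ⟨ρ, 2 * ρ, hρ, by linarith⟩
  let b' : (F × ℝ × F) × E → ℂ := fun q =>
    ((χ q.1 : ℝ) : ℂ) * b (q.1.1, q.1.1 + q.1.2.1 • q.1.2.2, q.2)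
  have hb' : ContDiff ℝ (⊤ : ℕ∞) b' := by
    refine (Complex.ofRealCLM.contDiff.comp (χ.contDiff.comp contDiff_fst)).mul (hb.comp ?_)
    fun_prop
  have hsub : ∀ q, b' q ≠ 0 → q ∈ Metric.closedBall p₀ (2 * ρ) ×ˢ Metric.closedBall x₀ ρ := by
    intro q hq
    refine ⟨?_, hbs _ _ _ (right_ne_zero_of_mul hq)⟩
    have : χ q.1 ≠ 0 := by simpa using left_ne_zero_of_mul hq
    have h3 : q.1 ∈ Function.support χ := this
    rw [χ.support_eq] at h3
    exact Metric.ball_subset_closedBall h3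
  have hcpt : IsCompact (Metric.closedBall p₀ (2 * ρ) ×ˢ Metric.closedBall x₀ ρ) :=
    (isCompact_closedBall _ _).prod (isCompact_closedBall _ _)
  have htsub : tsupport b' ⊆ Metric.closedBall p₀ (2 * ρ) ×ˢ Metric.closedBall x₀ ρ :=
    closure_minimal hsub hcpt.isClosed
  obtain ⟨C, hC0, hC⟩ := nonstationary_phase μ hD v (isCompact_closedBall x₀ ρ) N b' hb'
    (hcpt.of_isClosed_subset (isClosed_tsupport _) htsub) (fun q hq => (htsub hq).2)
    (fun q hq => hball (by
      rw [← closedBall_prod_same]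
      exact ⟨Metric.closedBall_subset_closedBall hρδ (htsub hq).1,
        Metric.closedBall_subset_closedBall (by linarith) (htsub hq).2⟩))
  refine ⟨C, hC0, fun u hu s hs η hη lam c hc hcW => ?_⟩
  have key := hC (u, s, η) (lam * s) c hc (hcW v hv)
  have hχ : χ (u, s, η) = 1 := by
    have hmem : (u, s, η) ∈ Metric.closedBall p₀ ρ := by
      rw [hp₀, ← closedBall_prod_same, ← closedBall_prod_same]
      exact ⟨hu, by simpa using hs, hη⟩
    exact χ.one_of_mem_closedBall hmem
  simp only [b', hχ, mul_assoc, mul_divDiff hφ, Complex.ofReal_one, one_mul] at key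
  refine key.trans (mul_le_mul_of_nonneg_left (setIntegral_mono_set
    (hc.continuous.abs.continuousOn.integrableOn_compact (isCompact_closedBall _ _))
    (Filter.Eventually.of_forall fun x => abs_nonneg _)
    (Metric.closedBall_subset_closedBall hρ1).eventuallyLE) hC0)

lemma exists_diffDecay_of_isCompact (hφ : ContDiff ℝ (⊤ : ℕ∞) φ) {u₀ : F} {x₀ : E} {W : Set E}
    {S : Set F} (hS : IsCompact S)
    (h : ∀ η₀ ∈ S, ∃ v ∈ W, fderiv ℝ (fun x => fderiv ℝ φ (u₀, x) (η₀, 0)) x₀ v ≠ 0) :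
    ∃ ρ : ℝ, 0 < ρ ∧ ρ ≤ 1 ∧ DiffDecay μ φ u₀ x₀ W ρ S := by
  refine hS.induction_on (p := fun T => ∃ ρ : ℝ, 0 < ρ ∧ ρ ≤ 1 ∧ DiffDecay μ φ u₀ x₀ W ρ T)
    ?_ ?_ ?_ ?_
  · exact ⟨1, one_pos, le_rfl, fun b _ _ N => ⟨0, le_rfl, fun _ _ _ _ η hη => hη.elim⟩⟩
  · rintro T T' hT ⟨ρ, hρ, hρ1, hd⟩
    exact ⟨ρ, hρ, hρ1, hd.mono le_rfl hT⟩
  · rintro T T' ⟨ρ, hρ, hρ1, hd⟩ ⟨ρ', hρ', hρ1', hd'⟩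
    exact ⟨min ρ ρ', lt_min hρ hρ', (min_le_left _ _).trans hρ1,
      (hd.mono (min_le_left _ _) le_rfl).union (hd'.mono (min_le_right _ _) le_rfl)⟩
  · intro η₀ hη₀
    obtain ⟨v, hv, hne⟩ := h η₀ hη₀
    obtain ⟨ρ, hρ, hρ1, hd⟩ := exists_diffDecay_closedBall (μ := μ) hφ hv hne
    exact ⟨_, mem_nhdsWithin_of_mem_nhds (Metric.closedBall_mem_nhds η₀ hρ), ρ, hρ, hρ1, hd⟩

end decay

lemma sq_norm_integral_le_of_autocorrelation {E : Type} [NormedAddCommGroup E] [NormedSpace ℝ E]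
    [FiniteDimensional ℝ E] [MeasurableSpace E] [BorelSpace E] (μ : Measure E) [μ.IsAddHaarMeasure] {G : E → ℂ}
    (hG : Continuous G) (hGs : HasCompactSupport G) {g : E → ℝ} (hg : Integrable g μ)
    (h : ∀ k, ‖∫ y, G (y + k) * starRingEnd ℂ (G y) ∂μ‖ ≤ g k) :
    ‖∫ y, G y ∂μ‖ ^ 2 ≤ ∫ k, g k ∂μ := by
  have hInteg : Integrable (Function.uncurry fun y k => G (y + k) * starRingEnd ℂ (G y))
      (μ.prod μ) := by
    refine Continuous.integrable_of_hasCompactSupport (by fun_prop) ?_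
    refine HasCompactSupport.intro (K := (fun q : E × E => (q.2, q.1 - q.2)) '' (tsupport G ×ˢ tsupport G))
      ((hGs.isCompact.prod hGs.isCompact).image (by fun_prop)) ?_
    rintro ⟨y, k⟩ hyk
    by_contra h0
    exact hyk ⟨(y + k, y), ⟨subset_tsupport _ fun h1 => h0 (by simp [h1]),
      subset_tsupport _ fun h1 => h0 (by simp [h1])⟩, by simp⟩
  have key : (∫ y, G y ∂μ) * starRingEnd ℂ (∫ y, G y ∂μ)
      = ∫ k, ∫ y, G (y + k) * starRingEnd ℂ (G y) ∂μ ∂μ := by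
    rw [← integral_integral_swap hInteg, ← integral_conj, ← integral_const_mul]
    congr 1 with y
    rw [integral_mul_const]
    congr 1
    exact (integral_add_left_eq_self G y).symm
  have hn : ‖(∫ y, G y ∂μ) * starRingEnd ℂ (∫ y, G y ∂μ)‖ = ‖∫ y, G y ∂μ‖ ^ 2 := by
    rw [norm_mul, RCLike.norm_conj, sq]
  rw [← hn, key]
  exact norm_integral_le_of_norm_le hg (Filter.Eventually.of_forall h)

/-- Decay of the kernel of `T T*` at pairs of points `z + r • ω`, `z` with `ω ∈ T`. -/
def KernelDecay {F E : Type} [NormedAddCommGroup F] [NormedSpace ℝ F] [NormedAddCommGroup E]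
    [NormedSpace ℝ E] [MeasurableSpace E] (μ : Measure E) (φ : F × E → ℝ) (x₀ : F) (y₀ : E) (ρ : ℝ) (T : Set F) : Prop :=
  ∀ a : F × E → ℂ, ContDiff ℝ (⊤ : ℕ∞) a →
    (∀ x y, a (x, y) ≠ 0 → y ∈ Metric.closedBall y₀ ρ) → ∃ C : ℝ, 0 ≤ C ∧
    ∀ z ∈ Metric.closedBall x₀ ρ, ∀ r : ℝ, |r| ≤ ρ → ∀ ω ∈ T, ∀ lam : ℝ, lam * r ≠ 0 →
      |lam * r| ^ Module.finrank ℝ E * ‖∫ y, Complex.exp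
          (Complex.I * ((lam * (φ (z + r • ω, y) - φ (z, y)) : ℝ) : ℂ)) *
            (a (z + r • ω, y) * starRingEnd ℂ (a (z, y))) ∂μ‖ ^ 2 ≤ C

section kernel

variable {F E : Type} [NormedAddCommGroup F] [NormedSpace ℝ F] [NormedAddCommGroup E]
  [NormedSpace ℝ E] [MeasurableSpace E] {μ : Measure E} {φ : F × E → ℝ} {x₀ : F} {y₀ : E}

lemma KernelDecay.mono {ρ ρ' : ℝ} {T T' : Set F}
    (h : KernelDecay μ φ x₀ y₀ ρ T) (hρ : ρ' ≤ ρ) (hT : T' ⊆ T) :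
    KernelDecay μ φ x₀ y₀ ρ' T' := by
  intro b hb hbs
  obtain ⟨C, hC0, hC⟩ := h b hb
    (fun x y hxy => Metric.closedBall_subset_closedBall hρ (hbs x y hxy))
  exact ⟨C, hC0, fun u hu s hs η hη => hC u (Metric.closedBall_subset_closedBall hρ hu) s
    (hs.trans hρ) η (hT hη)⟩

lemma KernelDecay.union {ρ : ℝ} {T T' : Set F}
    (h : KernelDecay μ φ x₀ y₀ ρ T) (h' : KernelDecay μ φ x₀ y₀ ρ T') :
    KernelDecay μ φ x₀ y₀ ρ (T ∪ T') := by
  intro b hb hbs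
  obtain ⟨C, hC0, hC⟩ := h b hb hbs
  obtain ⟨C', _, hC'⟩ := h' b hb hbs
  refine ⟨max C C', le_max_of_le_left hC0, fun z hz r hr ω hω lam hl => ?_⟩
  rcases hω with hω | hω
  · exact (hC z hz r hr ω hω lam hl).trans (le_max_left _ _)
  · exact (hC' z hz r hr ω hω lam hl).trans (le_max_right _ _)

/-- Stationary phase bound for the kernel of `T T*`. -/
lemma KernelDecay.exists_bound {ρ : ℝ} (hρ : 0 < ρ)
    (h : KernelDecay μ φ x₀ y₀ ρ (Metric.sphere 0 1)) {a : F × E → ℂ}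
    (ha : ContDiff ℝ (⊤ : ℕ∞) a)
    (has : ∀ x y, a (x, y) ≠ 0 → x ∈ Metric.closedBall x₀ (ρ / 2) ∧ y ∈ Metric.closedBall y₀ ρ) :
    ∃ C : ℝ, 0 ≤ C ∧ ∀ x z : F, x ≠ z → ∀ lam : ℝ, 0 < lam →
      (lam * ‖x - z‖) ^ Module.finrank ℝ E * ‖∫ y, Complex.exp
          (Complex.I * ((lam * (φ (x, y) - φ (z, y)) : ℝ) : ℂ)) *
            (a (x, y) * starRingEnd ℂ (a (z, y))) ∂μ‖ ^ 2 ≤ C := by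
  obtain ⟨C, hC0, hC⟩ := h a ha fun x y hxy => (has x y hxy).2
  refine ⟨C, hC0, fun x z hxz lam hlam => ?_⟩
  have hx0 : 0 < ‖x - z‖ := norm_pos_iff.2 (sub_ne_zero.2 hxz)
  by_cases hxz' : x ∈ Metric.closedBall x₀ (ρ / 2) ∧ z ∈ Metric.closedBall x₀ (ρ / 2)
  · have hr : ‖x - z‖ ≤ ρ := by
      rw [← dist_eq_norm]
      have := dist_triangle_right x z x₀
      have h1 := Metric.mem_closedBall.1 hxz'.1
      have h2 := Metric.mem_closedBall.1 hxz'.2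
      linarith
    have hω : ‖x - z‖⁻¹ • (x - z) ∈ Metric.sphere (0 : F) 1 := by
      rw [mem_sphere_zero_iff_norm, norm_smul, norm_inv, norm_norm, inv_mul_cancel₀ hx0.ne']
    have hx : z + ‖x - z‖ • ‖x - z‖⁻¹ • (x - z) = x := by
      rw [smul_smul, mul_inv_cancel₀ hx0.ne', one_smul, add_sub_cancel]
    have := hC z (Metric.closedBall_subset_closedBall (by linarith) hxz'.2) ‖x - z‖
      (by rwa [abs_norm]) _ hω lam (by positivity)
    rwa [hx, abs_of_pos (by positivity)] at this
  · have h0 : ∀ y, a (x, y) * starRingEnd ℂ (a (z, y)) = 0 := by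
      intro y
      by_contra h0
      exact hxz' ⟨(has x y (left_ne_zero_of_mul h0)).1,
        (has z y fun h => h0 (by simp [h])).1⟩
    simpa [h0] using hC0

variable [FiniteDimensional ℝ F] [FiniteDimensional ℝ E] [BorelSpace E] [μ.IsAddHaarMeasure]

lemma exists_kernelDecay_of_fderiv_ne (hφ : ContDiff ℝ (⊤ : ℕ∞) φ) {ω₀ : F} {v : E}
    (h : fderiv ℝ (fun y => fderiv ℝ φ (x₀, y) (ω₀, 0)) y₀ v ≠ 0) :
    ∃ ρ : ℝ, 0 < ρ ∧ ρ ≤ 1 ∧ KernelDecay μ φ x₀ y₀ ρ (Metric.closedBall ω₀ ρ) := by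
  obtain ⟨ρ, hρ, hρ1, hd⟩ := exists_diffDecay_closedBall (μ := μ) hφ (Set.mem_univ v) h
  refine ⟨ρ, hρ, hρ1, fun a ha has => ?_⟩
  let b : F × F × E → ℂ := fun q => a (q.2.1, q.2.2) * starRingEnd ℂ (a (q.1, q.2.2))
  have hb : ContDiff ℝ (⊤ : ℕ∞) b := by
    refine (ha.comp (by fun_prop)).mul (Complex.conjCLE.contDiff.comp (ha.comp ?_))
    fun_prop
  have hbs : ∀ u u' x, b (u, u', x) ≠ 0 → x ∈ Metric.closedBall y₀ ρ :=
    fun u u' x hx => has _ _ (left_ne_zero_of_mul hx)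
  set A : ℝ := ∫ _ in Metric.closedBall y₀ 1, |(1 : ℝ)| ∂μ
  obtain ⟨C, hC0, hC⟩ := hd b hb hbs (Module.finrank ℝ E)
  obtain ⟨C', hC0', hC'⟩ := hd b hb hbs 0
  have hA : 0 ≤ A := integral_nonneg fun _ => abs_nonneg _
  refine ⟨C * A * (C' * A), by positivity, fun z hz r hr ω hω lam _ => ?_⟩
  have h1 := hC z hz r hr ω hω lam (fun _ => 1) contDiff_const (by simp)
  have h2 := hC' z hz r hr ω hω lam (fun _ => 1) contDiff_const (by simp)
  simp only [Complex.ofReal_one, one_mul, pow_zero, b] at h1 h2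
  rw [sq, ← mul_assoc]
  exact mul_le_mul h1 h2 (norm_nonneg _) (by positivity)

lemma exists_kernelDecay_of_hessian [Nontrivial E] (hφ : ContDiff ℝ (⊤ : ℕ∞) φ) {ω₀ : F}
    (h : ∀ η : E, η ≠ 0 → ∃ v : E, fderiv ℝ (fun y => fderiv ℝ
      (fun y' => fderiv ℝ φ (x₀, y') (ω₀, 0)) y η) y₀ v ≠ 0) :
    ∃ ρ : ℝ, 0 < ρ ∧ ρ ≤ 1 ∧ KernelDecay μ φ x₀ y₀ ρ (Metric.closedBall ω₀ ρ) := by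
  have hD := contDiff_divDiff hφ
  set p₀ : F × ℝ × F := (x₀, 0, ω₀) with hp₀
  let φ' : ((F × ℝ × F) × E) × E → ℝ := fun q => divDiff φ (q.1.1, q.2 + q.1.2)
  have hφ' : ContDiff ℝ (⊤ : ℕ∞) φ' := hD.comp (by fun_prop)
  have hder : ∀ (y η : E), fderiv ℝ φ' ((p₀, 0), y) (((0 : F × ℝ × F), η), 0)
      = fderiv ℝ (fun y' => fderiv ℝ φ (x₀, y') (ω₀, 0)) y η := by
    intro y η
    have h1 : (fun y' => fderiv ℝ φ (x₀, y') (ω₀, 0)) = fun y' => divDiff φ (p₀, y') := by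
      ext y'
      exact (divDiff_zero x₀ ω₀ y').symm
    let L : ((F × ℝ × F) × E) × E →L[ℝ] (F × ℝ × F) × E :=
      ((ContinuousLinearMap.fst ℝ (F × ℝ × F) E).comp
        (ContinuousLinearMap.fst ℝ ((F × ℝ × F) × E) E)).prod
          (ContinuousLinearMap.snd ℝ ((F × ℝ × F) × E) E +
            (ContinuousLinearMap.snd ℝ (F × ℝ × F) E).comp
              (ContinuousLinearMap.fst ℝ ((F × ℝ × F) × E) E))
    have hl : HasFDerivAt (fun q : ((F × ℝ × F) × E) × E => (q.1.1, q.2 + q.1.2)) L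
        ((p₀, (0 : E)), y) := L.hasFDerivAt
    have hD' : HasFDerivAt (divDiff φ) (fderiv ℝ (divDiff φ) (p₀, y)) (p₀, y + 0) := by
      rw [add_zero]
      exact (hD.differentiable (by simp) _).hasFDerivAt
    have h2 : HasFDerivAt φ' ((fderiv ℝ (divDiff φ) (p₀, y)).comp L) ((p₀, (0 : E)), y) :=
      HasFDerivAt.comp (g := divDiff φ)
        (f := fun q : ((F × ℝ × F) × E) × E => (q.1.1, q.2 + q.1.2)) _ hD' hl
    have h3 := (hD.differentiable (by simp) (p₀, y)).hasFDerivAt.comp y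
      (hasFDerivAt_prodMk_right p₀ y)
    have h4 : fderiv ℝ (fun y' => divDiff φ (p₀, y')) y = _ := h3.fderiv
    rw [h1, h2.fderiv, h4]
    simp [L]
  let S : Set ((F × ℝ × F) × E) := {(0 : F × ℝ × F)} ×ˢ Metric.sphere (0 : E) 1
  have hS : IsCompact S := isCompact_singleton.prod (isCompact_sphere _ _)
  obtain ⟨ρ, hρ, hρ1, hd⟩ := exists_diffDecay_of_isCompact (μ := μ) (u₀ := (p₀, (0 : E)))
    (x₀ := y₀) (W := Set.univ) hφ' hS (by
      rintro ⟨p, η⟩ ⟨hp, hη⟩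
      obtain rfl : p = 0 := hp
      obtain ⟨v, hv⟩ := h η (by
        rintro rfl
        simp at hη)
      refine ⟨v, Set.mem_univ _, ?_⟩
      simpa only [hder] using hv)
  refine ⟨ρ / 2, by positivity, by linarith, fun a ha has => ?_⟩
  let b₂ : (F × ℝ × F) × E → ℂ := fun q =>
    a (q.1.1 + q.1.2.1 • q.1.2.2, q.2) * starRingEnd ℂ (a (q.1.1, q.2))
  have hb₂ : ContDiff ℝ (⊤ : ℕ∞) b₂ := by
    refine (ha.comp (by fun_prop)).mul (Complex.conjCLE.contDiff.comp (ha.comp ?_))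
    fun_prop
  have hb₂s : ∀ p y, b₂ (p, y) ≠ 0 → y ∈ Metric.closedBall y₀ (ρ / 2) :=
    fun p y hx => has _ _ (left_ne_zero_of_mul hx)
  let b : ((F × ℝ × F) × E) × ((F × ℝ × F) × E) × E → ℂ := fun q =>
    b₂ (q.1.1, q.2.2 + q.2.1.2) * starRingEnd ℂ (b₂ (q.1.1, q.2.2))
  have hb : ContDiff ℝ (⊤ : ℕ∞) b := by
    refine (hb₂.comp (by fun_prop)).mul (Complex.conjCLE.contDiff.comp (hb₂.comp ?_))
    fun_prop
  have hbs : ∀ u u' x, b (u, u', x) ≠ 0 → x ∈ Metric.closedBall y₀ ρ := by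
    intro u u' x hx
    refine Metric.closedBall_subset_closedBall (by linarith) (hb₂s u.1 x fun h0 => hx ?_)
    simp [b, h0]
  set m := Module.finrank ℝ E with hm
  set A : ℝ := ∫ _ in Metric.closedBall y₀ 1, |(1 : ℝ)| ∂μ
  have hA : 0 ≤ A := integral_nonneg fun _ => abs_nonneg _
  obtain ⟨C, hC0, hC⟩ := hd b hb hbs (m + 1)
  obtain ⟨C', hC0', hC'⟩ := hd b hb hbs 0
  set D : ℝ := 2 ^ m * (C' * A + C * A) with hDdef
  have hD0 : 0 ≤ D := by positivity
  have hInteg : Integrable (fun k : E => (1 + ‖k‖) ^ (-((m : ℝ) + 1))) μ :=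
    integrable_one_add_norm (by rw [← hm]; linarith)
  have hint0 : 0 ≤ ∫ k : E, (1 + ‖k‖) ^ (-((m : ℝ) + 1)) ∂μ :=
    integral_nonneg fun k => by positivity
  refine ⟨D * ∫ k : E, (1 + ‖k‖) ^ (-((m : ℝ) + 1)) ∂μ, by positivity,
    fun z hz r hr ω hω lam hl => ?_⟩
  set p : F × ℝ × F := (z, r, ω) with hp
  have hpmem : (p, (0 : E)) ∈ Metric.closedBall (p₀, (0 : E)) ρ := by
    rw [hp₀, ← closedBall_prod_same, ← closedBall_prod_same, ← closedBall_prod_same]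
    have hle : ρ / 2 ≤ ρ := by linarith
    exact ⟨⟨Metric.closedBall_subset_closedBall hle hz, by simpa using hr.trans hle,
      Metric.closedBall_subset_closedBall hle hω⟩, by simpa using hρ.le⟩
  let G : E → ℂ := fun y =>
    Complex.exp (Complex.I * ((lam * r * divDiff φ (p, y) : ℝ) : ℂ)) * b₂ (p, y)
  have hGc : Continuous G := by
    have h1 : Continuous fun y => divDiff φ (p, y) := hD.continuous.comp (by fun_prop)
    have h2 : Continuous fun y => b₂ (p, y) := hb₂.continuous.comp (by fun_prop)
    fun_prop
  have hGsupp : ∀ y, G y ≠ 0 → y ∈ Metric.closedBall y₀ (ρ / 2) :=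
    fun y hy => hb₂s p y (right_ne_zero_of_mul hy)
  have hGs : HasCompactSupport G :=
    HasCompactSupport.intro (isCompact_closedBall y₀ (ρ / 2)) fun y hy => by
      by_contra h0
      exact hy (hGsupp y h0)
  have hGG : ∀ y k : E, G (y + k) * starRingEnd ℂ (G y) = Complex.exp (Complex.I *
      ((lam * r * (divDiff φ (p, y + k) - divDiff φ (p, y)) : ℝ) : ℂ)) *
        (b₂ (p, y + k) * starRingEnd ℂ (b₂ (p, y))) := by
    intro y k
    simp only [G, map_mul, ← Complex.exp_conj, Complex.conj_I, Complex.conj_ofReal]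
    rw [mul_mul_mul_comm, ← Complex.exp_add]
    congr 2
    push_cast
    ring
  have hauto : ∀ k, ‖∫ y, G (y + k) * starRingEnd ℂ (G y) ∂μ‖
      ≤ D * (1 + ‖(lam * r) • k‖) ^ (-((m : ℝ) + 1)) := by
    intro k
    by_cases hk : ‖k‖ ≤ ρ
    · obtain ⟨s, η, hs, hη, rfl⟩ : ∃ (s : ℝ) (η : E), |s| = ‖k‖ ∧ (k ≠ 0 → ‖η‖ = 1) ∧ k = s • η := by
        by_cases hk0 : k = 0
        · exact ⟨0, 0, by simp [hk0], fun h => (h hk0).elim, by simp [hk0]⟩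
        · exact ⟨‖k‖, ‖k‖⁻¹ • k, by simp, fun _ => by
            rw [norm_smul, norm_inv, norm_norm, inv_mul_cancel₀ (norm_ne_zero_iff.2 hk0)], by
            rw [smul_smul, mul_inv_cancel₀ (norm_ne_zero_iff.2 hk0), one_smul]⟩
      set J := ‖∫ y, G (y + s • η) * starRingEnd ℂ (G y) ∂μ‖ with hJ
      have hJ0 : 0 ≤ J := norm_nonneg _
      obtain ⟨hJ1, hJ2⟩ : J ≤ C' * A ∧ |lam * r * s| ^ (m + 1) * J ≤ C * A := by
        by_cases hk0 : s • η = 0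
        · have hs0 : s = 0 := by simpa [hk0] using hs
          obtain ⟨w, hw⟩ := NormedSpace.sphere_nonempty (E := E) (x := 0) (r := 1) |>.2 zero_le_one
          have h2 := hC' (p, 0) hpmem 0 (by simpa using hρ.le) (0, w) ⟨rfl, hw⟩ (lam * r)
            (fun _ => 1) contDiff_const (by simp)
          simp only [hJ, hGG, hk0]
          constructor
          · simpa [b, φ', A] using h2
          · simpa [hs0] using (by positivity : 0 ≤ C * A)
        · have hη' : ((0 : F × ℝ × F), η) ∈ S := ⟨rfl, by simpa using hη hk0⟩
          have h1 := hC (p, 0) hpmem s (by rw [hs]; exact hk) (0, η) hη' (lam * r) (fun _ => 1)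
            contDiff_const (by simp)
          have h2 := hC' (p, 0) hpmem s (by rw [hs]; exact hk) (0, η) hη' (lam * r) (fun _ => 1)
            contDiff_const (by simp)
          simp only [Complex.ofReal_one, one_mul, pow_zero, b, φ', Prod.smul_mk, smul_zero,
            Prod.mk_add_mk, add_zero, zero_add] at h1 h2
          simp only [hJ, hGG]
          exact ⟨h2, h1⟩
      have hn : ‖(lam * r) • s • η‖ = |lam * r * s| := by
        rw [norm_smul, ← hs, Real.norm_eq_abs, ← abs_mul]
      rw [hn, Real.rpow_neg (by positivity), ← div_eq_mul_inv, le_div_iff₀ (by positivity)]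
      have h3 : (1 + |lam * r * s|) ^ ((m : ℝ) + 1) ≤ 2 ^ m * (1 + |lam * r * s| ^ (m + 1)) := by
        have := add_pow_le (zero_le_one' ℝ) (abs_nonneg (lam * r * s)) (m + 1)
        rw [one_pow, Nat.add_sub_cancel] at this
        exact_mod_cast this
      calc J * (1 + |lam * r * s|) ^ ((m : ℝ) + 1)
          ≤ J * (2 ^ m * (1 + |lam * r * s| ^ (m + 1))) := by gcongr
        _ = 2 ^ m * (J + |lam * r * s| ^ (m + 1) * J) := by ring
        _ ≤ D := by rw [hDdef]; gcongr
    · have h0 : ∀ y, G (y + k) * starRingEnd ℂ (G y) = 0 := by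
        intro y
        by_contra h0
        have h1 := hGsupp (y + k) (left_ne_zero_of_mul h0)
        have h2 := hGsupp y fun h => h0 (by simp [h])
        refine hk ?_
        have h3 := dist_triangle_right (y + k) y y₀
        rw [Metric.mem_closedBall] at h1 h2
        simp only [dist_self_add_left] at h3
        linarith
      simp only [h0, integral_zero, norm_zero]
      positivity
  have hgi : Integrable (fun k : E => D * (1 + ‖(lam * r) • k‖) ^ (-((m : ℝ) + 1))) μ :=
    (hInteg.comp_smul hl).const_mul D
  have hfin := sq_norm_integral_le_of_autocorrelation μ hGc hGs hgi hauto
  rw [integral_const_mul, Measure.integral_comp_smul μ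
    (fun k : E => (1 + ‖k‖) ^ (-((m : ℝ) + 1)))] at hfin
  have hGe : ∀ y, G y = Complex.exp (Complex.I * ((lam * (φ (z + r • ω, y) - φ (z, y)) : ℝ) : ℂ)) *
      (a (z + r • ω, y) * starRingEnd ℂ (a (z, y))) := by
    intro y
    simp only [G, mul_assoc, hp, mul_divDiff hφ, b₂]
  simp only [hGe] at hfin
  have hpos : 0 < |lam * r| ^ m := by positivity
  calc _ ≤ |lam * r| ^ m * (D * |((lam * r) ^ m)⁻¹| • ∫ k : E, (1 + ‖k‖) ^ (-((m : ℝ) + 1)) ∂μ) := by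
        gcongr
    _ = _ := by
        rw [abs_inv, abs_pow, smul_eq_mul]
        field_simp

lemma exists_kernelDecay_of_isCompact [Nontrivial E] (hφ : ContDiff ℝ (⊤ : ℕ∞) φ) {S : Set F}
    (hS : IsCompact S)
    (h : ∀ ω ∈ S, fderiv ℝ (fun y => fderiv ℝ φ (x₀, y) (ω, 0)) y₀ = 0 →
      ∀ η : E, η ≠ 0 → ∃ v : E, fderiv ℝ (fun y => fderiv ℝ
        (fun y' => fderiv ℝ φ (x₀, y') (ω, 0)) y η) y₀ v ≠ 0) :
    ∃ ρ : ℝ, 0 < ρ ∧ ρ ≤ 1 ∧ KernelDecay μ φ x₀ y₀ ρ S := by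
  refine hS.induction_on (p := fun T => ∃ ρ : ℝ, 0 < ρ ∧ ρ ≤ 1 ∧ KernelDecay μ φ x₀ y₀ ρ T)
    ?_ ?_ ?_ ?_
  · exact ⟨1, one_pos, le_rfl, fun b _ _ => ⟨0, le_rfl, fun _ _ _ _ ω hω => hω.elim⟩⟩
  · rintro T T' hT ⟨ρ, hρ, hρ1, hd⟩
    exact ⟨ρ, hρ, hρ1, hd.mono le_rfl hT⟩
  · rintro T T' ⟨ρ, hρ, hρ1, hd⟩ ⟨ρ', hρ', hρ1', hd'⟩
    exact ⟨min ρ ρ', lt_min hρ hρ', (min_le_left _ _).trans hρ1,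
      (hd.mono (min_le_left _ _) le_rfl).union (hd'.mono (min_le_right _ _) le_rfl)⟩
  · intro ω hω
    obtain ⟨ρ, hρ, hρ1, hd⟩ :
        ∃ ρ : ℝ, 0 < ρ ∧ ρ ≤ 1 ∧ KernelDecay μ φ x₀ y₀ ρ (Metric.closedBall ω ρ) := by
      by_cases h0 : fderiv ℝ (fun y => fderiv ℝ φ (x₀, y) (ω, 0)) y₀ = 0
      · exact exists_kernelDecay_of_hessian hφ (h ω hω h0)
      · obtain ⟨v, hv⟩ := DFunLike.ne_iff.1 h0
        exact exists_kernelDecay_of_fderiv_ne hφ hv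
    exact ⟨_, mem_nhdsWithin_of_mem_nhds (Metric.closedBall_mem_nhds ω hρ), ρ, hρ, hρ1, hd⟩

end kernel

lemma lintegral_closedBall_comp_inner_le {E : Type} [NormedAddCommGroup E] [InnerProductSpace ℝ E]
    [FiniteDimensional ℝ E] [MeasurableSpace E] [BorelSpace E] (x₀ : E) {N : E} (hN : ‖N‖ = 1)
    {g : ℝ → ℝ≥0∞} (hg : Measurable g) :
    ∫⁻ x in Metric.closedBall x₀ 1, g ⟪x, N⟫ ≤ volume (Metric.closedBall x₀ 2) * ∫⁻ s, g s := by
  have hτ : ∀ τ ∈ Set.Icc (0 : ℝ) 1, ∫⁻ x in Metric.closedBall x₀ 1, g ⟪x, N⟫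
      ≤ ∫⁻ x in Metric.closedBall x₀ 2, g (⟪x, N⟫ - τ) := by
    intro τ hτ
    rw [← lintegral_indicator measurableSet_closedBall,
      ← lintegral_indicator measurableSet_closedBall,
      ← lintegral_sub_right_eq_self _ (τ • N)]
    refine lintegral_mono fun x => ?_
    by_cases hx : x - τ • N ∈ Metric.closedBall x₀ 1
    · have hx2 : x ∈ Metric.closedBall x₀ 2 := by
        rw [Metric.mem_closedBall] at hx ⊢
        have h1 := dist_triangle x (x - τ • N) x₀
        have h2 : dist x (x - τ • N) = τ := by
          rw [dist_eq_norm, sub_sub_cancel, norm_smul, hN, mul_one, Real.norm_of_nonneg hτ.1]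
        linarith [hτ.2]
      rw [Set.indicator_of_mem hx, Set.indicator_of_mem hx2, inner_sub_left, inner_smul_left,
        real_inner_self_eq_norm_sq, hN]
      simp
    · rw [Set.indicator_of_notMem hx]
      exact zero_le
  have hm : Measurable (Function.uncurry fun (τ : ℝ) (x : E) => g (⟪x, N⟫ - τ)) := by
    refine hg.comp ?_
    fun_prop
  calc ∫⁻ x in Metric.closedBall x₀ 1, g ⟪x, N⟫
      = ∫⁻ _ in Set.Icc (0 : ℝ) 1, ∫⁻ x in Metric.closedBall x₀ 1, g ⟪x, N⟫ := by simp
    _ ≤ ∫⁻ τ in Set.Icc (0 : ℝ) 1, ∫⁻ x in Metric.closedBall x₀ 2, g (⟪x, N⟫ - τ) :=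
        setLIntegral_mono' measurableSet_Icc hτ
    _ ≤ ∫⁻ τ, ∫⁻ x in Metric.closedBall x₀ 2, g (⟪x, N⟫ - τ) := setLIntegral_le_lintegral _ _
    _ = ∫⁻ x in Metric.closedBall x₀ 2, ∫⁻ τ, g (⟪x, N⟫ - τ) :=
        lintegral_lintegral_swap hm.aemeasurable
    _ = volume (Metric.closedBall x₀ 2) * ∫⁻ s, g s := by
        simp_rw [lintegral_sub_left_eq_self g]
        rw [setLIntegral_const, mul_comm]

/-- Schur's test for a translation invariant even kernel. -/
lemma lintegral_lintegral_mul_mul_le {F : Type} [NormedAddCommGroup F] [MeasurableSpace F]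
    [BorelSpace F] [SecondCountableTopology F] (ν : Measure F) [SFinite ν]
    [ν.IsAddLeftInvariant] {h k : F → ℝ≥0∞} (hh : AEMeasurable h ν) (hk : Measurable k)
    (hneg : ∀ w, k (-w) = k w) :
    ∫⁻ q, h q.1 * h q.2 * k (q.1 - q.2) ∂(ν.prod ν) ≤ 2 * ((∫⁻ y, h y ^ 2 ∂ν) * ∫⁻ w, k w ∂ν) := by
  have hks : Measurable fun q : F × F => k (q.1 - q.2) := hk.comp (by fun_prop)
  have hright : ∀ y, ∫⁻ z, k (z - y) ∂ν = ∫⁻ w, k w ∂ν := fun y =>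
    lintegral_sub_right_eq_self k y
  have hleft : ∀ z, ∫⁻ y, k (z - y) ∂ν = ∫⁻ w, k w ∂ν := fun z => by
    rw [← hright z]
    congr 1 with y
    rw [← hneg, neg_sub]
  have h1 : AEMeasurable (fun q : F × F => h q.1 ^ 2 * k (q.1 - q.2)) (ν.prod ν) :=
    (hh.comp_fst.pow_const 2).mul hks.aemeasurable
  have h2 : AEMeasurable (fun q : F × F => h q.2 ^ 2 * k (q.1 - q.2)) (ν.prod ν) :=
    (hh.comp_snd.pow_const 2).mul hks.aemeasurable
  calc ∫⁻ q, h q.1 * h q.2 * k (q.1 - q.2) ∂(ν.prod ν)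
      ≤ ∫⁻ q, (h q.1 ^ 2 * k (q.1 - q.2) + h q.2 ^ 2 * k (q.1 - q.2)) ∂(ν.prod ν) := by
        refine lintegral_mono fun q => ?_
        rw [← add_mul]
        refine mul_le_mul_left ?_ _
        rcases le_total (h q.1) (h q.2) with hle | hle
        · refine le_add_of_nonneg_of_le zero_le ?_
          rw [sq]
          gcongr
        · refine le_add_of_le_of_nonneg ?_ zero_le
          rw [sq]
          gcongr
    _ = (∫⁻ y, h y ^ 2 ∂ν) * (∫⁻ w, k w ∂ν) + (∫⁻ y, h y ^ 2 ∂ν) * ∫⁻ w, k w ∂ν := by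
        rw [lintegral_add_left' h1, lintegral_prod _ h1, lintegral_prod_symm _ h2]
        have e1 : ∀ z, ∫⁻ y, h z ^ 2 * k (z - y) ∂ν = h z ^ 2 * ∫⁻ w, k w ∂ν := fun z => by
          have : Measurable fun y => k (z - y) := hk.comp (by fun_prop)
          rw [lintegral_const_mul _ this, hleft]
        have e2 : ∀ y, ∫⁻ z, h y ^ 2 * k (z - y) ∂ν = h y ^ 2 * ∫⁻ w, k w ∂ν := fun y => by
          have : Measurable fun z => k (z - y) := hk.comp (by fun_prop)
          rw [lintegral_const_mul _ this, hright]
        simp only [e1, e2]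
        rw [lintegral_mul_const'' _ (hh.pow_const 2)]
    _ = _ := (two_mul _).symm

section strip

variable {F E : Type} [NormedAddCommGroup F] [NormedSpace ℝ F] [Nontrivial F]
  [NormedAddCommGroup E] [InnerProductSpace ℝ E] [FiniteDimensional ℝ E] [MeasurableSpace E]
  [BorelSpace E] {φ : E × F → ℝ} {x₀ N : E} {y₀ : F} {ρ : ℝ} {a : E × F → ℂ}

/-- Pointwise bound for the kernel of `T* c T`, where `c` localises to a thin slab. -/
lemma DiffDecay.exists_bound
    (hρ : 0 < ρ) (hd : DiffDecay volume (fun q : F × E => φ (q.2, q.1)) y₀ x₀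
      {v | ⟪v, N⟫ = 0} ρ (Metric.sphere 0 1))
    (ha : ContDiff ℝ (⊤ : ℕ∞) a)
    (has : ∀ x y, a (x, y) ≠ 0 → x ∈ Metric.closedBall x₀ ρ ∧ y ∈ Metric.closedBall y₀ (ρ / 2))
    (m : ℕ) :
    ∃ C : ℝ, 0 ≤ C ∧ ∀ (lam : ℝ) (c : E → ℝ), ContDiff ℝ 1 c →
      (∀ v, ⟪v, N⟫ = 0 → ∀ x, fderiv ℝ c x v = 0) → ∀ z y : F,
      ‖∫ x, (c x : ℂ) * (Complex.exp (Complex.I * ((lam * (φ (x, z) - φ (x, y)) : ℝ) : ℂ)) *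
        (a (x, z) * starRingEnd ℂ (a (x, y))))‖ ≤
          C * (∫ x in Metric.closedBall x₀ 1, |c x|) *
            (1 + ‖lam • (z - y)‖) ^ (-((m : ℝ) + 1)) := by
  let b : F × F × E → ℂ := fun q => a (q.2.2, q.2.1) * starRingEnd ℂ (a (q.2.2, q.1))
  have hb : ContDiff ℝ (⊤ : ℕ∞) b := by
    refine (ha.comp (by fun_prop)).mul (Complex.conjCLE.contDiff.comp (ha.comp ?_))
    fun_prop
  have hbs : ∀ u u' x, b (u, u', x) ≠ 0 → x ∈ Metric.closedBall x₀ ρ :=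
    fun u u' x hx => (has _ _ (left_ne_zero_of_mul hx)).1
  obtain ⟨C, hC0, hC⟩ := hd b hb hbs (m + 1)
  obtain ⟨C', hC0', hC'⟩ := hd b hb hbs 0
  refine ⟨2 ^ m * (C' + C), by positivity, fun lam c hc hcN z y => ?_⟩
  set A := ∫ x in Metric.closedBall x₀ 1, |c x| with hA
  have hA0 : 0 ≤ A := integral_nonneg fun _ => abs_nonneg _
  by_cases hzy : z ∈ Metric.closedBall y₀ (ρ / 2) ∧ y ∈ Metric.closedBall y₀ (ρ / 2)
  · obtain ⟨s, η, hs, hη, hzs⟩ : ∃ (s : ℝ) (η : F), |s| = ‖z - y‖ ∧ ‖η‖ = 1 ∧ z - y = s • η := by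
      by_cases hk0 : z - y = 0
      · obtain ⟨w, hw⟩ := NormedSpace.sphere_nonempty (E := F) (x := 0) (r := 1) |>.2 zero_le_one
        exact ⟨0, w, by simp [hk0], by simpa using hw, by simp [hk0]⟩
      · exact ⟨‖z - y‖, ‖z - y‖⁻¹ • (z - y), by simp, by
          rw [norm_smul, norm_inv, norm_norm, inv_mul_cancel₀ (norm_ne_zero_iff.2 hk0)], by
          rw [smul_smul, mul_inv_cancel₀ (norm_ne_zero_iff.2 hk0), one_smul]⟩
    obtain rfl : z = y + s • η := by rw [← hzs, add_sub_cancel]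
    have hsρ : |s| ≤ ρ := by
      rw [hs, ← dist_eq_norm]
      have := dist_triangle_right (y + s • η) y y₀
      have h1 := Metric.mem_closedBall.1 hzy.1
      have h2 := Metric.mem_closedBall.1 hzy.2
      linarith
    have hy : y ∈ Metric.closedBall y₀ ρ :=
      Metric.closedBall_subset_closedBall (by linarith) hzy.2
    have hη' : η ∈ Metric.sphere (0 : F) 1 := by simpa using hη
    have h1 := hC y hy s hsρ η hη' lam c hc hcN
    have h2 := hC' y hy s hsρ η hη' lam c hc hcN
    simp only [pow_zero, one_mul, b] at h1 h2
    have hn : ‖lam • (y + s • η - y)‖ = |lam * s| := by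
      rw [add_sub_cancel_left, smul_smul, norm_smul, hη, mul_one, Real.norm_eq_abs]
    rw [hn, Real.rpow_neg (by positivity), ← div_eq_mul_inv, le_div_iff₀ (by positivity)]
    set J := ‖∫ x, (c x : ℂ) * (Complex.exp
      (Complex.I * ((lam * (φ (x, y + s • η) - φ (x, y)) : ℝ) : ℂ)) *
        (a (x, y + s • η) * starRingEnd ℂ (a (x, y))))‖
    have hJ0 : 0 ≤ J := norm_nonneg _
    have h3 : (1 + |lam * s|) ^ ((m : ℝ) + 1) ≤ 2 ^ m * (1 + |lam * s| ^ (m + 1)) := by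
      have := add_pow_le (zero_le_one' ℝ) (abs_nonneg (lam * s)) (m + 1)
      rw [one_pow, Nat.add_sub_cancel] at this
      exact_mod_cast this
    calc J * (1 + |lam * s|) ^ ((m : ℝ) + 1)
        ≤ J * (2 ^ m * (1 + |lam * s| ^ (m + 1))) := by gcongr
      _ = 2 ^ m * (J + |lam * s| ^ (m + 1) * J) := by ring
      _ ≤ 2 ^ m * (C' * A + C * A) := by gcongr
      _ = _ := by ring
  · have h0 : ∀ x, a (x, z) * starRingEnd ℂ (a (x, y)) = 0 := by
      intro x
      by_contra h0
      exact hzy ⟨(has x z (left_ne_zero_of_mul h0)).2,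
        (has x y fun h => h0 (by simp [h])).2⟩
    simp only [h0, mul_zero, integral_zero, norm_zero]
    positivity

variable [FiniteDimensional ℝ F] [MeasurableSpace F] [BorelSpace F]

/-- `L²` bound for the operator localised to a slab orthogonal to `N`. -/
lemma DiffDecay.exists_slab_bound (ν : Measure F) [ν.IsAddHaarMeasure]
    (hφ : ContDiff ℝ (⊤ : ℕ∞) φ) (hN : ‖N‖ = 1)
    (hρ : 0 < ρ) (hd : DiffDecay volume (fun q : F × E => φ (q.2, q.1)) y₀ x₀
      {v | ⟪v, N⟫ = 0} ρ (Metric.sphere 0 1))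
    (ha : ContDiff ℝ (⊤ : ℕ∞) a)
    (has : ∀ x y, a (x, y) ≠ 0 → x ∈ Metric.closedBall x₀ ρ ∧ y ∈ Metric.closedBall y₀ (ρ / 2)) :
    ∃ C : ℝ, 0 ≤ C ∧ ∀ lam : ℝ, 0 < lam → ∀ R : ℝ, 0 < R → ∀ (t : ℝ) (h : F → ℂ), MemLp h 2 ν →
      ∫⁻ x in {x | t ≤ ⟪x, N⟫ / R ∧ ⟪x, N⟫ / R ≤ t + 1},
        ‖∫ y, Complex.exp (Complex.I * ((lam * φ (x, y) : ℝ) : ℂ)) * a (x, y) * h y ∂ν‖ₑ ^ 2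
      ≤ ENNReal.ofReal (C * (R * (lam ^ Module.finrank ℝ F)⁻¹)) * ∫⁻ y, ‖h y‖ₑ ^ 2 ∂ν := by
  set m := Module.finrank ℝ F with hm
  obtain ⟨C, hC0, hC⟩ := hd.exists_bound hρ ha has m
  obtain ⟨M, hM⟩ : ∃ M, ∀ q, ‖a q‖ ≤ M := by
    refine ha.continuous.bounded_above_of_compact_support (HasCompactSupport.intro
      ((isCompact_closedBall x₀ ρ).prod (isCompact_closedBall y₀ (ρ / 2))) ?_)
    rintro ⟨x, y⟩ hxy
    by_contra h0
    exact hxy (has x y h0)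
  let χ : ContDiffBump (1 / 2 : ℝ) := ⟨1 / 2, 1, by norm_num, by norm_num⟩
  set I₀ : ℝ := ∫ w : F, (1 + ‖w‖) ^ (-((m : ℝ) + 1)) ∂ν with hI₀
  have hInteg : Integrable (fun w : F => (1 + ‖w‖) ^ (-((m : ℝ) + 1))) ν :=
    integrable_one_add_norm (by rw [← hm]; linarith)
  have hI0 : 0 ≤ I₀ := integral_nonneg fun k => by positivity
  set V₀ : ℝ := volume.real (Metric.closedBall x₀ 2)
  refine ⟨2 * (C * (V₀ * 2) * I₀), by positivity, fun lam hlam R hR t h hh => ?_⟩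
  let c : E → ℝ := fun x => χ (⟪x, N⟫ / R - t)
  have hc : ContDiff ℝ 1 c := 
    χ.contDiff.comp (((contDiff_id.inner ℝ contDiff_const).div_const R).sub contDiff_const)
  have hcN : ∀ v, ⟪v, N⟫ = 0 → ∀ x, fderiv ℝ c x v = 0 := by
    intro v hv x
    have h1 : HasDerivAt (fun s : ℝ => c (x + s • v)) (fderiv ℝ c x v) 0 := by
      have := (hc.differentiable (by simp) (x + (0 : ℝ) • v)).hasFDerivAt.comp_hasDerivAt (0 : ℝ)
        (((hasDerivAt_id (0 : ℝ)).smul_const v).const_add x)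
      simpa only [Function.comp_def, id_eq, zero_smul, add_zero, one_smul] using this
    have h2 : (fun s : ℝ => c (x + s • v)) = fun _ => c x := by
      ext s
      simp [c, inner_add_left, inner_smul_left, hv]
    rw [h2] at h1
    exact h1.unique (hasDerivAt_const _ _)
  have hc1 : ∀ x, ‖(c x : ℂ)‖ ≤ 1 := fun x => by
    rw [Complex.norm_real, Real.norm_of_nonneg χ.nonneg]
    exact χ.le_one
  set A := ∫ x in Metric.closedBall x₀ 1, |c x| with hA
  have hA0 : 0 ≤ A := integral_nonneg fun _ => abs_nonneg _
  have hAle : A ≤ V₀ * 2 * R := by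
    have hχ : ∀ s : ℝ, ENNReal.ofReal |χ (s / R - t)| ≤
        (Set.Icc (R * (t - 1 / 2)) (R * (t + 3 / 2))).indicator 1 s := by
      intro s
      by_cases hs : χ (s / R - t) = 0
      · simp [hs]
      · have h1 : s / R - t ∈ Metric.ball (1 / 2 : ℝ) 1 := by
          rw [← χ.support_eq]
          exact hs
        rw [Real.ball_eq_Ioo] at h1
        have h2 : s / R * R = s := div_mul_cancel₀ s hR.ne'
        rw [Set.indicator_of_mem, abs_of_nonneg χ.nonneg]
        · exact ENNReal.ofReal_le_one.2 χ.le_one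
        · constructor <;> nlinarith [h1.1, h1.2]
    have h1 := lintegral_closedBall_comp_inner_le x₀ hN (g := fun s => ENNReal.ofReal |χ (s / R - t)|)
      (by
        have := χ.continuous
        exact Measurable.ennreal_ofReal (Continuous.measurable (by fun_prop)))
    have h2 : ∫⁻ s, ENNReal.ofReal |χ (s / R - t)| ≤ ENNReal.ofReal (2 * R) := by
      refine (lintegral_mono hχ).trans ?_
      rw [lintegral_indicator_one measurableSet_Icc, Real.volume_Icc]
      exact ENNReal.ofReal_le_ofReal (by linarith)
    have h3 : volume (Metric.closedBall x₀ 2) ≠ ∞ := measure_closedBall_lt_top.ne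
    rw [hA, integral_eq_lintegral_of_nonneg_ae (Filter.Eventually.of_forall fun _ => abs_nonneg _)
      hc.continuous.abs.aestronglyMeasurable]
    refine ENNReal.toReal_le_of_le_ofReal (by positivity) (h1.trans ?_)
    rw [mul_assoc, ENNReal.ofReal_mul measureReal_nonneg, ofReal_measureReal h3]
    gcongr
  let K : E → F → ℂ := fun x y =>
    Complex.exp (Complex.I * ((lam * φ (x, y) : ℝ) : ℂ)) * a (x, y)
  have hK : Continuous (Function.uncurry K) := by
    have := hφ.continuous
    have := ha.continuous
    fun_prop
  have hKM : ∀ x y, ‖K x y‖ ≤ M := fun x y => by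
    rw [norm_mul, mul_comm Complex.I, Complex.norm_exp_ofReal_mul_I, one_mul]
    exact hM _
  have hKs : ∀ x y, K x y ≠ 0 → x ∈ Metric.closedBall x₀ ρ ∧ y ∈ Metric.closedBall y₀ (ρ / 2) :=
    fun x y hxy => has x y (right_ne_zero_of_mul hxy)
  let g : F → ℂ := (Metric.closedBall y₀ (ρ / 2)).indicator h
  have hg : MemLp g 2 ν := hh.indicator measurableSet_closedBall
  have hgi : Integrable g ν := by
    have : IsFiniteMeasure (ν.restrict (Metric.closedBall y₀ (ρ / 2))) :=
      isFiniteMeasure_restrict.2 measure_closedBall_lt_top.ne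
    have := (hh.restrict (Metric.closedBall y₀ (ρ / 2))).integrable one_le_two
    exact (integrable_indicator_iff measurableSet_closedBall).2 this
  have hKg : ∀ x y, K x y * h y = K x y * g y := by
    intro x y
    by_cases h0 : K x y = 0
    · simp [h0]
    · simp only [g, Set.indicator_of_mem (hKs x y h0).2]
  let Ψ : E → F × F → ℂ := fun x q => (c x : ℂ) * (K x q.1 * g q.1 * starRingEnd ℂ (K x q.2 * g q.2))
  have hΨ : Integrable (Function.uncurry Ψ) (volume.prod (ν.prod ν)) := by
    have h1 : Integrable ((Metric.closedBall x₀ ρ).indicator fun _ : E => (1 : ℂ)) :=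
      (integrable_indicator_iff measurableSet_closedBall).2
        (integrableOn_const measure_closedBall_lt_top.ne)
    have h2 : Integrable (fun y => starRingEnd ℂ (g y)) ν := hgi.norm.mono'
      (Complex.continuous_conj.comp_aestronglyMeasurable hgi.1) (by simp)
    have h3 := h1.mul_prod (hgi.mul_prod h2)
    have h4 : Continuous fun q : E × F × F =>
        (c q.1 : ℂ) * (K q.1 q.2.1 * starRingEnd ℂ (K q.1 q.2.2)) := by
      have h5 := hc.continuous
      have h6 : Continuous fun q : E × F × F => K q.1 q.2.1 :=
        hK.comp (continuous_fst.prodMk continuous_snd.fst)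
      have h7 : Continuous fun q : E × F × F => K q.1 q.2.2 :=
        hK.comp (continuous_fst.prodMk continuous_snd.snd)
      fun_prop
    have h5 := h3.bdd_mul (c := 1 * (M * M)) h4.aestronglyMeasurable
      (Filter.Eventually.of_forall fun q => by
        have hM0 : 0 ≤ M := (norm_nonneg _).trans (hM 0)
        rw [norm_mul, norm_mul, RCLike.norm_conj]
        gcongr
        · exact hc1 _
        · exact hKM _ _
        · exact hKM _ _)
    refine h5.congr (Filter.Eventually.of_forall fun q => ?_)
    obtain ⟨x, z, y⟩ := q
    simp only [Function.uncurry_apply_pair, Ψ, map_mul]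
    by_cases h0 : K x z = 0
    · simp [h0]
    · rw [Set.indicator_of_mem (hKs x z h0).1]
      ring
  have hΨ1 : ∀ x, ∫ q, Ψ x q ∂(ν.prod ν) = ((c x * ‖∫ y, K x y * g y ∂ν‖ ^ 2 : ℝ) : ℂ) := by
    intro x
    rw [integral_const_mul, integral_prod_mul (fun y => K x y * g y)
      (fun y => starRingEnd ℂ (K x y * g y)), integral_conj, Complex.mul_conj,
      Complex.normSq_eq_norm_sq, Complex.ofReal_mul]
  have hΨ2 : ∀ q : F × F, ‖∫ x, Ψ x q‖ ≤ ‖g q.1‖ * ‖g q.2‖ *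
      (C * A * (1 + ‖lam • (q.1 - q.2)‖) ^ (-((m : ℝ) + 1))) := by
    rintro ⟨z, y⟩
    have h1 : ∀ x, Ψ x (z, y) = (g z * starRingEnd ℂ (g y)) * ((c x : ℂ) *
        (Complex.exp (Complex.I * ((lam * (φ (x, z) - φ (x, y)) : ℝ) : ℂ)) *
          (a (x, z) * starRingEnd ℂ (a (x, y))))) := by
      intro x
      have h2 : Complex.exp (Complex.I * ((lam * (φ (x, z) - φ (x, y)) : ℝ) : ℂ)) =
          Complex.exp (Complex.I * ((lam * φ (x, z) : ℝ) : ℂ)) *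
            starRingEnd ℂ (Complex.exp (Complex.I * ((lam * φ (x, y) : ℝ) : ℂ))) := by
        rw [← Complex.exp_conj, ← Complex.exp_add, map_mul, Complex.conj_I, Complex.conj_ofReal]
        congr 1
        push_cast
        ring
      simp only [Ψ, K, map_mul, h2]
      ring
    simp only [h1]
    rw [integral_const_mul, norm_mul, norm_mul, RCLike.norm_conj]
    gcongr
    exact hC lam c hc hcN z y
  let k : F → ℝ≥0∞ := fun w => ENNReal.ofReal (C * A * (1 + ‖lam • w‖) ^ (-((m : ℝ) + 1)))
  have hk : ∫⁻ w, k w ∂ν = ENNReal.ofReal (C * A * ((lam ^ m)⁻¹ * I₀)) := by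
    rw [← ofReal_integral_eq_lintegral_ofReal ((hInteg.comp_smul hlam.ne').const_mul _)
      (Filter.Eventually.of_forall fun w => by positivity), integral_const_mul,
      Measure.integral_comp_smul ν (fun w : F => (1 + ‖w‖) ^ (-((m : ℝ) + 1))), ← hm,
      abs_of_pos (by positivity), smul_eq_mul]
  have hkm : Measurable k := by
    refine Measurable.ennreal_ofReal (Continuous.measurable ?_)
    refine continuous_const.mul (Continuous.rpow_const (by fun_prop) fun w => Or.inl ?_)
    positivity
  have hre : Integrable (fun x => c x * ‖∫ y, K x y * g y ∂ν‖ ^ 2) := by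
    have := hΨ.integral_prod_left
    simp only [Function.uncurry_apply_pair, hΨ1] at this
    exact this.re
  calc ∫⁻ x in {x | t ≤ ⟪x, N⟫ / R ∧ ⟪x, N⟫ / R ≤ t + 1},
        ‖∫ y, Complex.exp (Complex.I * ((lam * φ (x, y) : ℝ) : ℂ)) * a (x, y) * h y ∂ν‖ₑ ^ 2
      ≤ ∫⁻ x in {x | t ≤ ⟪x, N⟫ / R ∧ ⟪x, N⟫ / R ≤ t + 1},
          ENNReal.ofReal (c x * ‖∫ y, K x y * g y ∂ν‖ ^ 2) := by
        refine setLIntegral_mono' ?_ fun x hx => ?_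
        · have h1 : Continuous fun x : E => ⟪x, N⟫ / R := by fun_prop
          exact ((isClosed_le continuous_const h1).inter
            (isClosed_le h1 continuous_const)).measurableSet
        · have h1 : c x = 1 := χ.one_of_mem_closedBall (by
            rw [Real.closedBall_eq_Icc]
            constructor <;> norm_num <;> linarith [hx.1, hx.2])
          simp only [h1, one_mul, ← hKg]
          rw [ENNReal.ofReal_pow (norm_nonneg _), ofReal_norm]
    _ ≤ ∫⁻ x, ENNReal.ofReal (c x * ‖∫ y, K x y * g y ∂ν‖ ^ 2) := setLIntegral_le_lintegral _ _
    _ = ‖∫ x, ∫ q, Ψ x q ∂(ν.prod ν)‖ₑ := by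
        have hnn : 0 ≤ fun x => c x * ‖∫ y, K x y * g y ∂ν‖ ^ 2 :=
          fun x => mul_nonneg χ.nonneg (by positivity)
        simp only [hΨ1]
        rw [integral_complex_ofReal, ← ofReal_integral_eq_lintegral_ofReal hre
          (Filter.Eventually.of_forall hnn), ← ofReal_norm, Complex.norm_real,
          Real.norm_of_nonneg (integral_nonneg hnn)]
    _ = ‖∫ q, (∫ x, Ψ x q) ∂(ν.prod ν)‖ₑ := by rw [integral_integral_swap hΨ]
    _ ≤ ∫⁻ q, ‖∫ x, Ψ x q‖ₑ ∂(ν.prod ν) := enorm_integral_le_lintegral_enorm _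
    _ ≤ ∫⁻ q, ‖g q.1‖ₑ * ‖g q.2‖ₑ * k (q.1 - q.2) ∂(ν.prod ν) := by
        refine lintegral_mono fun q => ?_
        rw [← ofReal_norm, ← ofReal_norm, ← ofReal_norm,
          ← ENNReal.ofReal_mul (norm_nonneg _), ← ENNReal.ofReal_mul (by positivity)]
        exact ENNReal.ofReal_le_ofReal (hΨ2 q)
    _ ≤ 2 * ((∫⁻ y, ‖g y‖ₑ ^ 2 ∂ν) * ∫⁻ w, k w ∂ν) :=
        lintegral_lintegral_mul_mul_le ν hg.1.enorm hkm fun w => by simp [k]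
    _ ≤ 2 * ((∫⁻ y, ‖h y‖ₑ ^ 2 ∂ν) * ENNReal.ofReal ((C * (V₀ * 2 * R) * ((lam ^ m)⁻¹ * I₀)))) := by
        rw [hk]
        gcongr with y
        exact enorm_indicator_le_enorm_self h y
    _ = _ := by
        rw [mul_comm (∫⁻ y, ‖h y‖ₑ ^ 2 ∂ν), ← mul_assoc, ← ENNReal.ofReal_ofNat 2,
          ← ENNReal.ofReal_mul zero_le_two]
        congr 2
        ring

end strip

/-- Almost orthogonality for a family indexed by integers. -/
lemma sq_norm_sum_le_of_almost_orthogonal {H : Type} [NormedAddCommGroup H] [InnerProductSpace ℂ H]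
    (J : Finset ℤ) (G : ℤ → H) (w : ℤ → ℝ) (hw : ∀ i, 0 ≤ w i) {B : ℝ} (hB : 0 ≤ B)
    (h : ∀ i j, 1 < |i - j| → ‖inner ℂ (G i) (G j)‖ ≤ B * (w i * w j)) :
    ‖∑ j ∈ J, G j‖ ^ 2 ≤ 3 * ∑ j ∈ J, ‖G j‖ ^ 2 + B * (∑ j ∈ J, w j) ^ 2 := by
  have h1 : ‖∑ j ∈ J, G j‖ ^ 2 ≤ ∑ i ∈ J, ∑ j ∈ J, ‖inner ℂ (G i) (G j)‖ := by
    have h0 : ‖inner ℂ (∑ j ∈ J, G j) (∑ j ∈ J, G j)‖ = ‖∑ j ∈ J, G j‖ ^ 2 := by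
      rw [inner_self_eq_norm_sq_to_K]
      simp
    rw [← h0, sum_inner]
    refine (norm_sum_le _ _).trans (Finset.sum_le_sum fun i _ => ?_)
    rw [inner_sum]
    exact norm_sum_le _ _
  have h2 : ∀ i j, ‖inner ℂ (G i) (G j)‖ ≤
      ((if |i - j| ≤ 1 then ‖G i‖ ^ 2 / 2 else 0) + (if |i - j| ≤ 1 then ‖G j‖ ^ 2 / 2 else 0)) +
        B * (w i * w j) := by
    intro i j
    have h3 : 0 ≤ B * (w i * w j) := mul_nonneg hB (mul_nonneg (hw i) (hw j))
    split_ifs with hij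
    · have h4 := norm_inner_le_norm (𝕜 := ℂ) (G i) (G j)
      nlinarith [sq_nonneg (‖G i‖ - ‖G j‖)]
    · simpa using h i j (not_le.1 hij)
  have h3 : ∀ i, ∑ j ∈ J, (if |i - j| ≤ 1 then ‖G i‖ ^ 2 / 2 else 0) ≤ 3 * (‖G i‖ ^ 2 / 2) := by
    intro i
    rw [← Finset.sum_filter, Finset.sum_const, nsmul_eq_mul]
    have h4 : (J.filter fun j => |i - j| ≤ 1).card ≤ 3 := by
      have h5 : (J.filter fun j => |i - j| ≤ 1) ⊆ Finset.Icc (i - 1) (i + 1) := by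
        intro j hj
        have := abs_le.1 (Finset.mem_filter.1 hj).2
        rw [Finset.mem_Icc]
        omega
      refine (Finset.card_le_card h5).trans ?_
      rw [Int.card_Icc]
      omega
    gcongr
    exact_mod_cast h4
  have h4 : ∑ i ∈ J, ∑ j ∈ J, (if |i - j| ≤ 1 then ‖G j‖ ^ 2 / 2 else 0) =
      ∑ i ∈ J, ∑ j ∈ J, (if |i - j| ≤ 1 then ‖G i‖ ^ 2 / 2 else 0) := by
    rw [Finset.sum_comm]
    simp only [abs_sub_comm]
  calc ‖∑ j ∈ J, G j‖ ^ 2 ≤ ∑ i ∈ J, ∑ j ∈ J, ‖inner ℂ (G i) (G j)‖ := h1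
    _ ≤ ∑ i ∈ J, ∑ j ∈ J, (((if |i - j| ≤ 1 then ‖G i‖ ^ 2 / 2 else 0) +
          (if |i - j| ≤ 1 then ‖G j‖ ^ 2 / 2 else 0)) + B * (w i * w j)) := by
        gcongr with i _ j _
        exact h2 i j
    _ = 2 * (∑ i ∈ J, ∑ j ∈ J, (if |i - j| ≤ 1 then ‖G i‖ ^ 2 / 2 else 0)) +
          B * (∑ j ∈ J, w j) ^ 2 := by
        simp only [Finset.sum_add_distrib]
        rw [h4, ← two_mul, sq, Finset.sum_mul_sum, Finset.mul_sum]
        simp only [Finset.mul_sum]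
    _ ≤ 2 * (∑ i ∈ J, 3 * (‖G i‖ ^ 2 / 2)) + B * (∑ j ∈ J, w j) ^ 2 := by
        gcongr with i _
        exact h3 i
    _ = _ := by
        congr 1
        rw [Finset.mul_sum, Finset.mul_sum]
        refine Finset.sum_congr rfl fun i _ => ?_
        ring

section level

variable {H E : Type} [NormedAddCommGroup H] [InnerProductSpace ℂ H] [CompleteSpace H]
  [NormedAddCommGroup E] [InnerProductSpace ℝ E] [FiniteDimensional ℝ E] [MeasurableSpace E]
  [BorelSpace E]

/-- Level set estimate for the family of functionals `⟪k x, ·⟫`. -/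
lemma sq_mul_measureReal_level_le {k : E → H} (hk : Continuous k) (hks : HasCompactSupport k)
    {N : E} (hN : ‖N‖ = 1) {R B₁ B₂ : ℝ} (hR : 0 < R) (hB₁ : 0 < B₁) (hB₂ : 0 ≤ B₂)
    (hslab : ∀ (t : ℝ) (h : H), ∫⁻ x in {x | t ≤ ⟪x, N⟫ / R ∧ ⟪x, N⟫ / R ≤ t + 1},
      ‖inner ℂ (k x) h‖ₑ ^ 2 ≤ ENNReal.ofReal B₁ * ‖h‖ₑ ^ 2)
    (hdec : ∀ x z, R ≤ ‖x - z‖ → ‖inner ℂ (k x) (k z)‖ ≤ B₂)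
    (f : H) {α : ℝ} (hα : 0 < α) :
    α ^ 2 * volume.real {x | α < ‖inner ℂ (k x) f‖} ≤
      ‖f‖ ^ 2 * (3 * B₁ + B₂ * volume.real {x | α < ‖inner ℂ (k x) f‖}) := by
  set S := {x | α < ‖inner ℂ (k x) f‖} with hS
  have hSm : MeasurableSet S := (isOpen_lt continuous_const (by fun_prop)).measurableSet
  have hSk : S ⊆ tsupport k := fun x hx => subset_tsupport _ fun h0 => by
    simp only [hS, Set.mem_ofPred_eq, h0, inner_zero_left, norm_zero] at hx
    linarith
  have hSfin : volume S ≠ ∞ := ((measure_mono hSk).trans_lt hks.isCompact.measure_lt_top).ne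
  let g : E → ℂ := fun x => inner ℂ (k x) f / ‖inner ℂ (k x) f‖
  have hgm : Measurable g := by
    have : Continuous fun x => inner ℂ (k x) f := by fun_prop
    exact this.measurable.div (Complex.continuous_ofReal.comp this.norm).measurable
  have hg1 : ∀ x, ‖g x‖ ≤ 1 := fun x => by
    simp only [g, norm_div, Complex.norm_real, norm_norm]
    exact div_self_le_one _
  have hgk : ∀ T : Set E, IntegrableOn (fun x => g x • k x) T := by
    intro T
    have h1 : Integrable k := hk.integrable_of_hasCompactSupport hks
    exact (h1.bdd_smul 1 hgm.aestronglyMeasurable (Filter.Eventually.of_forall hg1)).integrableOn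
  let S' : ℤ → Set E := fun j => S ∩ {x | ⌊⟪x, N⟫ / R⌋ = j}
  have hSm' : ∀ j, MeasurableSet (S' j) := by
    intro j
    have h1 : Measurable fun x : E => ⌊⟪x, N⟫ / R⌋ :=
      Int.measurable_floor.comp (Continuous.measurable (by fun_prop))
    exact hSm.inter (h1 (measurableSet_singleton j))
  have hSfin' : ∀ j, volume (S' j) ≠ ∞ := fun j =>
    ((measure_mono Set.inter_subset_left).trans_lt hSfin.lt_top).ne
  obtain ⟨J, hJ⟩ : ∃ J : Finset ℤ, S = ⋃ j ∈ J, S' j := by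
    obtain ⟨L, hL⟩ := hks.isCompact.exists_bound_of_continuousOn
      (f := fun x : E => ⟪x, N⟫ / R) (by fun_prop)
    refine ⟨Finset.Icc ⌊-L⌋ ⌊L⌋, ?_⟩
    ext x
    simp only [S', Set.mem_iUnion, Set.mem_inter_iff, Set.mem_ofPred_eq, exists_prop, Finset.mem_Icc]
    refine ⟨fun hx => ⟨_, ?_, hx, rfl⟩, fun ⟨_, _, hx, _⟩ => hx⟩
    have := abs_le.1 (hL x (hSk hx))
    exact ⟨Int.floor_le_floor this.1, Int.floor_le_floor this.2⟩
  have hdisj : Set.PairwiseDisjoint (J : Set ℤ) S' := by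
    intro i _ j _ hij
    refine Set.disjoint_left.2 fun x hx hx' => hij ?_
    exact hx.2.symm.trans hx'.2
  have hSsum : volume.real S = ∑ j ∈ J, volume.real (S' j) := by
    conv_lhs => rw [hJ]
    exact measureReal_biUnion_finset hdisj (fun j _ => hSm' j) (fun j _ => hSfin' j)
  let G : ℤ → H := fun j => ∫ x in S' j, g x • k x
  have hGi : ∀ j h, inner ℂ (G j) h = ∫ x in S' j, starRingEnd ℂ (g x) * inner ℂ (k x) h := by
    intro j h
    rw [← inner_conj_symm, ← integral_inner (hgk _), ← integral_conj]
    congr 1 with x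
    rw [inner_smul_right, map_mul, inner_conj_symm]
  have hki : ∀ (j : ℤ) (h : H), IntegrableOn (fun x => ‖inner ℂ (k x) h‖) (S' j) := by
    intro j h
    refine (Continuous.integrable_of_hasCompactSupport (by fun_prop) ?_).integrableOn
    exact HasCompactSupport.intro hks fun x hx => by simp [image_eq_zero_of_notMem_tsupport hx]
  have hGle : ∀ j h, ‖inner ℂ (G j) h‖ ≤ ∫ x in S' j, ‖inner ℂ (k x) h‖ := by
    intro j h
    rw [hGi]
    refine norm_integral_le_of_norm_le (hki j h) (Filter.Eventually.of_forall fun x => ?_)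
    rw [norm_mul, RCLike.norm_conj]
    exact mul_le_of_le_one_left (norm_nonneg _) (hg1 x)
  have hGsq : ∀ j, ‖G j‖ ^ 2 ≤ B₁ * volume.real (S' j) := by
    intro j
    have hsq : IntegrableOn (fun x => ‖inner ℂ (k x) (G j)‖ ^ 2) (S' j) := by
      refine (Continuous.integrable_of_hasCompactSupport (by fun_prop) ?_).integrableOn
      exact HasCompactSupport.intro hks fun x hx => by simp [image_eq_zero_of_notMem_tsupport hx]
    have h1 : ∫ x in S' j, ‖inner ℂ (k x) (G j)‖ ^ 2 ≤ B₁ * ‖G j‖ ^ 2 := by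
      rw [integral_eq_lintegral_of_nonneg_ae (Filter.Eventually.of_forall fun _ => by positivity) hsq.1]
      refine ENNReal.toReal_le_of_le_ofReal (by positivity) ?_
      calc ∫⁻ x in S' j, ENNReal.ofReal (‖inner ℂ (k x) (G j)‖ ^ 2)
          = ∫⁻ x in S' j, ‖inner ℂ (k x) (G j)‖ₑ ^ 2 := by
            simp only [ENNReal.ofReal_pow (norm_nonneg _), ofReal_norm]
        _ ≤ ∫⁻ x in {x | (j : ℝ) ≤ ⟪x, N⟫ / R ∧ ⟪x, N⟫ / R ≤ j + 1},
              ‖inner ℂ (k x) (G j)‖ₑ ^ 2 := by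
            refine lintegral_mono_set fun x hx => ?_
            have h2 : ⌊⟪x, N⟫ / R⌋ = j := hx.2
            rw [← h2]
            exact ⟨Int.floor_le _, (Int.lt_floor_add_one _).le⟩
        _ ≤ _ := hslab j (G j)
        _ = _ := by
            rw [ENNReal.ofReal_mul hB₁.le, ENNReal.ofReal_pow (norm_nonneg _), ofReal_norm]
    have h2 : ‖G j‖ ^ 2 ≤ ∫ x in S' j, ‖inner ℂ (k x) (G j)‖ := by
      refine le_trans (le_of_eq ?_) (hGle j (G j))
      rw [inner_self_eq_norm_sq_to_K]
      simp
    have h3 : 2 * B₁ * ∫ x in S' j, ‖inner ℂ (k x) (G j)‖ ≤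
        B₁ ^ 2 * volume.real (S' j) + ∫ x in S' j, ‖inner ℂ (k x) (G j)‖ ^ 2 := by
      have h4 : IntegrableOn (fun _ : E => B₁ ^ 2) (S' j) := integrableOn_const (hSfin' j)
      have h5 : B₁ ^ 2 * volume.real (S' j) = ∫ x in S' j, B₁ ^ 2 := by
        rw [setIntegral_const, smul_eq_mul, mul_comm]
      rw [← integral_const_mul, h5, ← integral_add h4 hsq]
      refine integral_mono ((hki j _).const_mul _) (h4.add hsq) fun x => ?_
      nlinarith [sq_nonneg (B₁ - ‖inner ℂ (k x) (G j)‖)]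
    refine le_of_mul_le_mul_left ?_ hB₁
    nlinarith
  have hfar : ∀ i j, 1 < |i - j| →
      ‖inner ℂ (G i) (G j)‖ ≤ B₂ * (volume.real (S' i) * volume.real (S' j)) := by
    intro i j hij
    have h1 : ∀ x ∈ S' i, ‖inner ℂ (k x) (G j)‖ ≤ B₂ * volume.real (S' j) := by
      intro x hx
      rw [norm_inner_symm]
      refine (hGle j (k x)).trans ?_
      refine (setIntegral_mono_on (hki j _) (integrableOn_const (C := B₂) (hSfin' j)) (hSm' j)
        fun z hz => hdec z x ?_).trans (le_of_eq ?_)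
      · have hi : ⌊⟪x, N⟫ / R⌋ = i := hx.2
        have hj : ⌊⟪z, N⟫ / R⌋ = j := hz.2
        have h2 : (1 : ℝ) ≤ |⟪z, N⟫ / R - ⟪x, N⟫ / R| := by
          have h3 := Int.floor_le (⟪x, N⟫ / R)
          have h4 := Int.lt_floor_add_one (⟪x, N⟫ / R)
          have h5 := Int.floor_le (⟪z, N⟫ / R)
          have h6 := Int.lt_floor_add_one (⟪z, N⟫ / R)
          rw [hi] at h3 h4
          rw [hj] at h5 h6
          rcases lt_abs.1 hij with h7 | h7
          · have h8 : ((j : ℤ) : ℝ) + 2 ≤ i := by exact_mod_cast (by omega : j + 2 ≤ i)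
            rw [abs_sub_comm]
            exact le_trans (by linarith) (le_abs_self _)
          · have h8 : ((i : ℤ) : ℝ) + 2 ≤ j := by exact_mod_cast (by omega : i + 2 ≤ j)
            exact le_trans (by linarith) (le_abs_self _)
        rw [← sub_div, ← inner_sub_left, abs_div, abs_of_pos hR, le_div_iff₀ hR, one_mul] at h2
        refine h2.trans ((abs_real_inner_le_norm _ _).trans ?_)
        rw [hN, mul_one]
      · rw [setIntegral_const, smul_eq_mul, mul_comm]
    refine (hGle i (G j)).trans ((setIntegral_mono_on (hki i _)
      (integrableOn_const (C := B₂ * volume.real (S' j)) (hSfin' i)) (hSm' i) h1).trans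
        (le_of_eq ?_))
    rw [setIntegral_const, smul_eq_mul]
    ring
  have hGf : α * volume.real S ≤ ‖f‖ * ‖∑ j ∈ J, G j‖ := by
    have h1 : ∀ j, α * volume.real (S' j) ≤ RCLike.re (inner ℂ (G j) f) := by
      intro j
      have h2 : ∀ x, starRingEnd ℂ (g x) * inner ℂ (k x) f = ((‖inner ℂ (k x) f‖ : ℝ) : ℂ) := by
        intro x
        by_cases h0 : inner ℂ (k x) f = 0
        · simp [h0]
        · have h3 : ((‖inner ℂ (k x) f‖ : ℝ) : ℂ) ≠ 0 := by simpa using h0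
          simp only [g, map_div₀, Complex.conj_ofReal]
          rw [div_mul_eq_mul_div, div_eq_iff h3, mul_comm, Complex.mul_conj,
            Complex.normSq_eq_norm_sq]
          push_cast
          ring
      rw [hGi]
      simp only [h2]
      rw [integral_complex_ofReal, RCLike.re_eq_complex_re, Complex.ofReal_re]
      refine le_trans (le_of_eq ?_) (setIntegral_mono_on
        (integrableOn_const (C := α) (hSfin' j)) (hki j f) (hSm' j) fun x hx => hx.1.le)
      rw [setIntegral_const, smul_eq_mul, mul_comm]
    calc α * volume.real S = ∑ j ∈ J, α * volume.real (S' j) := by rw [hSsum, Finset.mul_sum]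
      _ ≤ ∑ j ∈ J, RCLike.re (inner ℂ (G j) f) := Finset.sum_le_sum fun j _ => h1 j
      _ = RCLike.re (inner ℂ (∑ j ∈ J, G j) f) := by rw [sum_inner, map_sum]
      _ ≤ ‖∑ j ∈ J, G j‖ * ‖f‖ := re_inner_le_norm _ _
      _ = _ := mul_comm _ _
  have hGG : ‖∑ j ∈ J, G j‖ ^ 2 ≤ 3 * B₁ * volume.real S + B₂ * volume.real S ^ 2 := by
    refine (sq_norm_sum_le_of_almost_orthogonal J G _ (fun j => measureReal_nonneg) hB₂ hfar).trans ?_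
    rw [← hSsum, mul_assoc, hSsum, Finset.mul_sum _ _ B₁]
    gcongr with j _
    exact hGsq j
  rcases eq_or_lt_of_le (measureReal_nonneg (μ := volume) (s := S)) with h0 | h0
  · rw [← h0]
    simp
    positivity
  · refine le_of_mul_le_mul_right ?_ h0
    calc α ^ 2 * volume.real S * volume.real S = (α * volume.real S) ^ 2 := by ring
      _ ≤ (‖f‖ * ‖∑ j ∈ J, G j‖) ^ 2 := by gcongr
      _ = ‖f‖ ^ 2 * ‖∑ j ∈ J, G j‖ ^ 2 := by ring
      _ ≤ ‖f‖ ^ 2 * (3 * B₁ * volume.real S + B₂ * volume.real S ^ 2) := by gcongr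
      _ = _ := by ring

end level

lemma lintegral_rpow_le_of_level_le {E : Type} [MeasurableSpace E] {μ : Measure E} {G : E → ℝ}
    (hG : Measurable G) (hG0 : ∀ x, 0 ≤ G x) {c W s p : ℝ} (hc : 0 ≤ c) (hGc : ∀ x, G x ≤ c)
    (hp : 0 < p) (hsp : s < p) (hW : 0 ≤ W)
    (hlev : ∀ t, 0 < t → μ {x | t < G x} ≤ ENNReal.ofReal (W * t ^ (-s))) :
    ∫⁻ x, ENNReal.ofReal (G x ^ p) ∂μ ≤ ENNReal.ofReal (p * (W * (c ^ (p - s) / (p - s)))) := by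
  rw [lintegral_rpow_eq_lintegral_meas_lt_mul μ (Filter.Eventually.of_forall hG0) hG.aemeasurable hp,
    ENNReal.ofReal_mul hp.le]
  gcongr
  have hexp : -1 < p - s - 1 := by linarith
  have hii : IntervalIntegrable (fun t : ℝ => t ^ (p - s - 1)) volume 0 c :=
    intervalIntegral.intervalIntegrable_rpow' hexp
  have hInteg : IntegrableOn (fun t : ℝ => W * t ^ (p - s - 1)) (Set.Ioc 0 c) :=
    ((intervalIntegrable_iff_integrableOn_Ioc_of_le hc).1 hii).const_mul W
  have hval : ∫ t in Set.Ioc 0 c, W * t ^ (p - s - 1) = W * (c ^ (p - s) / (p - s)) := by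
    rw [integral_const_mul, ← intervalIntegral.integral_of_le hc, integral_rpow (Or.inl hexp)]
    simp only [sub_add_cancel]
    rw [Real.zero_rpow (by linarith), sub_zero]
  rw [← hval, ofReal_integral_eq_lintegral_ofReal hInteg
    ((ae_restrict_iff' measurableSet_Ioc).2 (Filter.Eventually.of_forall fun t ht =>
      mul_nonneg hW (Real.rpow_nonneg ht.1.le _))),
    ← lintegral_indicator measurableSet_Ioc, ← lintegral_indicator measurableSet_Ioi]
  refine lintegral_mono fun t => ?_
  by_cases ht : 0 < t
  · rw [Set.indicator_of_mem (Set.mem_Ioi.2 ht)]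
    by_cases htc : t ≤ c
    · rw [Set.indicator_of_mem (Set.mem_Ioc.2 ⟨ht, htc⟩)]
      calc μ {x | t < G x} * ENNReal.ofReal (t ^ (p - 1))
          ≤ ENNReal.ofReal (W * t ^ (-s)) * ENNReal.ofReal (t ^ (p - 1)) := by
            gcongr
            exact hlev t ht
        _ = _ := by
            rw [← ENNReal.ofReal_mul (by positivity), mul_assoc, ← Real.rpow_add ht]
            congr 3
            ring
    · have : {x | t < G x} = ∅ := by
        ext x
        simpa using (hGc x).trans (not_le.1 htc).le
      simp [this]
  · rw [Set.indicator_of_notMem (by simpa using ht)]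
    exact zero_le

section kernel

variable {E F : Type} [NormedAddCommGroup E] [NormedAddCommGroup F] [MeasurableSpace F]
  [BorelSpace F] {ν : Measure F} [IsFiniteMeasureOnCompacts ν]

lemma exists_continuous_toLp_kernel {K : E → F → ℂ} (hK : Continuous (Function.uncurry K))
    (hKs : HasCompactSupport (Function.uncurry K)) :
    ∃ k : E → Lp ℂ 2 ν, Continuous k ∧ HasCompactSupport k ∧
      (∀ (x : E) (h : Lp ℂ 2 ν), inner ℂ (k x) h = ∫ y, K x y * h y ∂ν) ∧
      ∀ x z, inner ℂ (k x) (k z) = ∫ y, K x y * starRingEnd ℂ (K z y) ∂ν := by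
  set A := Prod.fst '' tsupport (Function.uncurry K)
  set B := Prod.snd '' tsupport (Function.uncurry K)
  have hA : IsCompact A := hKs.isCompact.image continuous_fst
  have hB : IsCompact B := hKs.isCompact.image continuous_snd
  have hsupp : ∀ x y, K x y ≠ 0 → x ∈ A ∧ y ∈ B := fun x y hxy =>
    ⟨⟨(x, y), subset_tsupport _ hxy, rfl⟩, ⟨(x, y), subset_tsupport _ hxy, rfl⟩⟩
  have hcont : ∀ x, Continuous fun y => starRingEnd ℂ (K x y) := fun x =>
    Complex.continuous_conj.comp (hK.comp (Continuous.prodMk_right x))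
  have hmem : ∀ x, MemLp (fun y => starRingEnd ℂ (K x y)) 2 ν := fun x =>
    (hcont x).memLp_of_hasCompactSupport (HasCompactSupport.intro hB fun y hy => by
      by_contra h0
      exact hy (hsupp x y fun h => h0 (by simp [h])).2)
  have hkk : ∀ x z, inner ℂ ((hmem x).toLp _) ((hmem z).toLp _) =
      ∫ y, K x y * starRingEnd ℂ (K z y) ∂ν := by
    intro x z
    rw [L2.inner_def]
    refine integral_congr_ae ?_
    filter_upwards [(hmem x).coeFn_toLp, (hmem z).coeFn_toLp] with y hy hy'
    rw [hy, hy']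
    simp [mul_comm]
  refine ⟨fun x => (hmem x).toLp _, ?_, ?_, ?_, hkk⟩
  · have hG : Continuous fun q : E × E => ∫ y, K q.1 y * starRingEnd ℂ (K q.2 y) ∂ν := by
      rw [← continuousOn_univ]
      refine continuousOn_integral_of_compact_support hB ?_ fun q y _ hy => ?_
      · refine Continuous.continuousOn ((hK.comp (f := fun w : (E × E) × F => (w.1.1, w.2))
          (by fun_prop)).mul (Complex.continuous_conj.comp
          (hK.comp (f := fun w : (E × E) × F => (w.1.2, w.2)) (by fun_prop))))
      · have : K q.1 y = 0 := by
          by_contra h0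
          exact hy (hsupp _ _ h0).2
        simp [this]
    simp only [← hkk] at hG
    rw [continuous_iff_continuousAt]
    intro z
    rw [ContinuousAt, tendsto_iff_norm_sub_tendsto_zero]
    have hsq : ∀ x, ‖(hmem x).toLp _ - (hmem z).toLp _‖ = Real.sqrt (RCLike.re
        (inner ℂ ((hmem x).toLp _) ((hmem x).toLp _) - inner ℂ ((hmem x).toLp _) ((hmem z).toLp _)
        - inner ℂ ((hmem z).toLp _) ((hmem x).toLp _)
        + inner ℂ ((hmem z).toLp _) ((hmem z).toLp _))) := by
      intro x
      rw [norm_eq_sqrt_re_inner (𝕜 := ℂ), inner_sub_sub_self]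
    simp only [hsq]
    have hc : Continuous fun x => Real.sqrt (RCLike.re
        (inner ℂ ((hmem x).toLp _) ((hmem x).toLp _) - inner ℂ ((hmem x).toLp _) ((hmem z).toLp _)
        - inner ℂ ((hmem z).toLp _) ((hmem x).toLp _)
        + inner ℂ ((hmem z).toLp _) ((hmem z).toLp _))) := by
      refine Real.continuous_sqrt.comp (RCLike.continuous_re.comp ?_)
      exact (((hG.comp (f := fun x => (x, x)) (by fun_prop)).sub
        (hG.comp (f := fun x => (x, z)) (by fun_prop))).sub
        (hG.comp (f := fun x => (z, x)) (by fun_prop))).add continuous_const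
    have := hc.tendsto z
    simpa using this
  · refine HasCompactSupport.intro hA fun x hx => ?_
    have : (fun y => starRingEnd ℂ (K x y)) = 0 := by
      ext y
      by_contra h0
      exact hx (hsupp x y fun h => h0 (by simp [h])).1
    simp [this]
  · intro x h
    rw [L2.inner_def]
    refine integral_congr_ae ?_
    filter_upwards [(hmem x).coeFn_toLp] with y hy
    rw [hy]
    simp [mul_comm]

end kernel

section abstract_bounds

variable {E H : Type} [NormedAddCommGroup E] [InnerProductSpace ℝ E] [FiniteDimensional ℝ E]
  [MeasurableSpace E] [BorelSpace E] [NormedAddCommGroup H] [InnerProductSpace ℂ H] {k : E → H}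

lemma measureReal_level_le [CompleteSpace H] {N : E} {m : ℕ} {lam C₁ C₂ α : ℝ}
    (hk : Continuous k) (hks : HasCompactSupport k) (hN : ‖N‖ = 1) (hm : 0 < m) (hlam : 0 < lam)
    (hC₁ : 0 < C₁) (hC₂ : 0 < C₂)
    (hslab : ∀ R, 0 < R → ∀ t h, ∫⁻ x in {x | t ≤ ⟪x, N⟫ / R ∧ ⟪x, N⟫ / R ≤ t + 1},
      ‖inner ℂ (k x) h‖ₑ ^ 2 ≤ ENNReal.ofReal (C₁ * (R * (lam ^ m)⁻¹)) * ‖h‖ₑ ^ 2)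
    (hdec : ∀ x z, x ≠ z → (lam * ‖x - z‖) ^ m * ‖inner ℂ (k x) (k z)‖ ^ 2 ≤ C₂)
    (f : H) (hα : 0 < α) :
    volume.real {x | α < ‖inner ℂ (k x) f‖} ≤
      6 * C₁ * (4 * C₂) ^ (1 / m : ℝ) * lam ^ (-(m + 1) : ℝ) * (‖f‖ / α) ^ (2 + 4 / m : ℝ) := by
  rcases eq_or_ne f 0 with rfl | hf
  · have : {x | α < ‖inner ℂ (k x) (0 : H)‖} = ∅ := by
      ext x
      simpa using hα.le
    rw [this]
    simp only [measureReal_empty]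
    positivity
  have hA : 0 < ‖f‖ := norm_pos_iff.2 hf
  set β := ‖f‖ / α with hβdef
  have hβ : 0 < β := div_pos hA hα
  set τ := (4 * C₂ * β ^ 4) ^ (1 / m : ℝ) with hτdef
  have hτ : 0 < τ := by positivity
  have hτm : τ ^ m = 4 * C₂ * β ^ 4 := by
    rw [hτdef, ← Real.rpow_natCast, ← Real.rpow_mul (by positivity)]
    rw [one_div_mul_cancel (by positivity), Real.rpow_one]
  have hR : 0 < τ / lam := div_pos hτ hlam
  have key := sq_mul_measureReal_level_le (B₁ := C₁ * (τ / lam * (lam ^ m)⁻¹))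
    (B₂ := 1 / (2 * β ^ 2)) hk hks hN hR (by positivity) (by positivity) (hslab _ hR) ?_ f hα
  · set L := volume.real {x | α < ‖inner ℂ (k x) f‖}
    have hAf : ‖f‖ ^ 2 = β ^ 2 * α ^ 2 := by
      rw [hβdef]
      field_simp
    have hL : L ≤ 6 * β ^ 2 * (C₁ * (τ / lam * (lam ^ m)⁻¹)) := by
      rw [hAf] at key
      have h1 : β ^ 2 * α ^ 2 * (3 * (C₁ * (τ / lam * (lam ^ m)⁻¹)) + 1 / (2 * β ^ 2) * L) =
        α ^ 2 * (3 * β ^ 2 * (C₁ * (τ / lam * (lam ^ m)⁻¹)) + L / 2) := by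
        field_simp
      rw [h1] at key
      have := le_of_mul_le_mul_left key (by positivity)
      linarith
    refine hL.trans_eq ?_
    have e1 : τ = (4 * C₂) ^ (1 / m : ℝ) * β ^ (4 / m : ℝ) := by
      rw [hτdef, Real.mul_rpow (by positivity) (by positivity), ← Real.rpow_natCast β 4,
        ← Real.rpow_mul hβ.le]
      congr 2
      push_cast
      ring
    have e2 : lam ^ (-(m + 1) : ℝ) = lam⁻¹ * (lam ^ m)⁻¹ := by
      rw [Real.rpow_neg hlam.le, ← Nat.cast_succ, Real.rpow_natCast, pow_succ, mul_inv, mul_comm]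
    rw [e1, e2, Real.rpow_add hβ, Real.rpow_ofNat]
    ring
  · intro x z hxz
    have hne : x ≠ z := by
      rintro rfl
      simp only [sub_self, norm_zero] at hxz
      linarith
    have h1 := hdec x z hne
    have h2 : 4 * C₂ * β ^ 4 ≤ (lam * ‖x - z‖) ^ m := by
      rw [← hτm]
      gcongr
      rwa [div_le_iff₀' hlam] at hxz
    have h3 : 4 * C₂ * β ^ 4 * ‖inner ℂ (k x) (k z)‖ ^ 2 ≤ C₂ :=
      (mul_le_mul_of_nonneg_right h2 (by positivity)).trans h1
    refine abs_le_of_sq_le_sq' ?_ (by positivity) |>.2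
    rw [div_pow, le_div_iff₀ (by positivity)]
    refine le_of_mul_le_mul_left ?_ hC₂
    nlinarith

lemma eLpNorm_inner_le_of_level_le {d q p ε c₀ D : ℝ} (hd : 0 < d) (hq : 0 < q) (hqp : q ≤ p)
    (hε : 0 < ε) (hc₀ : 0 ≤ c₀) (hD : 0 ≤ D) {B : Set E} (hB : volume B ≠ ∞) :
    ∃ C, 0 ≤ C ∧ ∀ (k : E → H) (lam : ℝ), Continuous k → (∀ x, ‖k x‖ ≤ c₀) →
      (∀ x, x ∉ B → k x = 0) → 1 ≤ lam → ∀ f : H,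
      (∀ α, 0 < α → volume.real {x | α < ‖inner ℂ (k x) f‖} ≤
        D * lam ^ (-d) * (‖f‖ / α) ^ q) →
      eLpNorm (fun x => inner ℂ (k x) f) (ENNReal.ofReal p) volume ≤
        ENNReal.ofReal (C * lam ^ (-d / p + ε)) * ‖f‖ₑ := by
  have hp : 0 < p := hq.trans_le hqp
  set δ := min (1 / 2) (ε * p / d) with hδ
  have hδ0 : 0 < δ := lt_min (by norm_num) (by positivity)
  have hδ1 : δ ≤ 1 / 2 := min_le_left _ _
  have hδ2 : d * δ ≤ ε * p := by
    have := min_le_right (1 / 2) (ε * p / d)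
    rwa [← hδ, le_div_iff₀' hd] at this
  set θ := 1 - δ with hθ
  have hθ0 : 0 < θ := by linarith
  set s := q * θ with hs
  have hs0 : 0 < s := by positivity
  have hsp : s < p := by nlinarith
  set b := volume.real B with hb
  have hb0 : 0 ≤ b := measureReal_nonneg
  set M := p * (b ^ δ * D ^ θ * (c₀ ^ (p - s) / (p - s))) with hM
  have hps : 0 < p - s := by linarith
  have hM0 : 0 ≤ M := by positivity
  refine ⟨M ^ (1 / p), by positivity, fun k lam hk hkc hkB hlam f hlev => ?_⟩
  have hlam0 : 0 < lam := by linarith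
  set A := ‖f‖ with hA
  have hA0 : 0 ≤ A := norm_nonneg f
  have hmeas : Continuous fun x => ‖inner ℂ (k x) f‖ := (hk.inner continuous_const).norm
  have main := lintegral_rpow_le_of_level_le (μ := volume) (G := fun x => ‖inner ℂ (k x) f‖)
    (c := c₀ * A) (W := b ^ δ * (D * lam ^ (-d) * A ^ q) ^ θ) (s := s) (p := p)
    hmeas.measurable (fun _ => norm_nonneg _) (by positivity)
    (fun x => (norm_inner_le_norm _ _).trans (mul_le_mul_of_nonneg_right (hkc x) hA0))
    hp hsp (by positivity) ?_
  · rw [eLpNorm_eq_lintegral_rpow_enorm_toReal (by simpa using hp) ENNReal.ofReal_ne_top,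
      ENNReal.toReal_ofReal hp.le]
    have e1 : ∀ x, ‖inner ℂ (k x) f‖ₑ ^ p = ENNReal.ofReal (‖inner ℂ (k x) f‖ ^ p) := fun x => by
      rw [← ofReal_norm, ENNReal.ofReal_rpow_of_nonneg (norm_nonneg _) hp.le]
    simp only [e1]
    have e2 : p * (b ^ δ * (D * lam ^ (-d) * A ^ q) ^ θ * ((c₀ * A) ^ (p - s) / (p - s))) =
        M * lam ^ (-d * θ) * A ^ p := by
      rw [Real.mul_rpow (by positivity) (by positivity), Real.mul_rpow hD (by positivity),
        ← Real.rpow_mul hlam0.le, ← Real.rpow_mul hA0, Real.mul_rpow hc₀ hA0, ← hs, hM]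
      have : A ^ p = A ^ s * A ^ (p - s) := by
        rw [← Real.rpow_add_of_nonneg hA0 hs0.le hps.le]
        congr 1
        ring
      rw [this]
      ring
    rw [e2] at main
    calc _ ≤ (ENNReal.ofReal (M * lam ^ (-d * θ) * A ^ p)) ^ (1 / p) := by gcongr
      _ = ENNReal.ofReal ((M * lam ^ (-d * θ) * A ^ p) ^ (1 / p)) :=
          ENNReal.ofReal_rpow_of_nonneg (by positivity) (by positivity)
      _ ≤ ENNReal.ofReal (M ^ (1 / p) * lam ^ (-d / p + ε) * A) := by
          refine ENNReal.ofReal_le_ofReal ?_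
          rw [Real.mul_rpow (by positivity) (by positivity), Real.mul_rpow hM0 (by positivity),
            ← Real.rpow_mul hlam0.le, ← Real.rpow_mul hA0, mul_one_div_cancel hp.ne',
            Real.rpow_one]
          gcongr
          rw [mul_one_div, div_le_iff₀ hp, add_mul, div_mul_cancel₀ _ hp.ne', hθ]
          linarith
      _ = _ := by
          rw [ENNReal.ofReal_mul (by positivity), ← ofReal_norm]
  · intro t ht
    set S := {x | t < ‖inner ℂ (k x) f‖} with hS
    have hSB : S ⊆ B := by
      intro x hx
      by_contra hxB
      rw [hS, Set.mem_ofPred_eq, hkB x hxB] at hx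
      simp at hx
      linarith
    have hSfin : volume S ≠ ∞ := ne_top_of_le_ne_top hB (measure_mono hSB)
    rw [← ENNReal.ofReal_toReal hSfin]
    refine ENNReal.ofReal_le_ofReal ?_
    change volume.real S ≤ _
    have hv0 : 0 ≤ volume.real S := measureReal_nonneg
    calc volume.real S = volume.real S ^ δ * volume.real S ^ θ := by
          rw [← Real.rpow_add_of_nonneg hv0 hδ0.le hθ0.le, hθ]
          simp
      _ ≤ b ^ δ * (D * lam ^ (-d) * (A / t) ^ q) ^ θ := by
          gcongr
          · exact measureReal_mono hSB hB
          · exact hlev t ht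
      _ = _ := by
          rw [Real.div_rpow hA0 ht.le, ← mul_div_assoc, Real.div_rpow (by positivity) (by positivity),
            ← Real.rpow_mul ht.le, ← hs, Real.rpow_neg ht.le]
          ring

end abstract_bounds

lemma sq_enorm_lp_two {F : Type} [MeasurableSpace F] {ν : Measure F} (h : Lp ℂ 2 ν) :
    ∫⁻ y, ‖h y‖ₑ ^ 2 ∂ν = ‖h‖ₑ ^ 2 := by
  have := eLpNorm_nnreal_pow_eq_lintegral (f := h) (μ := ν) (p := 2) two_ne_zero
  rw [Lp.enorm_def]
  simpa using this.symm

section local_bound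

variable {E F : Type} [NormedAddCommGroup E] [InnerProductSpace ℝ E] [FiniteDimensional ℝ E]
  [MeasurableSpace E] [BorelSpace E] [NormedAddCommGroup F] [NormedSpace ℝ F]
  [FiniteDimensional ℝ F] [MeasurableSpace F] [BorelSpace F] [Nontrivial F]
  {φ : E × F → ℝ} {a : E × F → ℂ} {N : E} {x₀ : E} {y₀ : F} {ρ : ℝ}

lemma exists_level_bound (ν : Measure F) [ν.IsAddHaarMeasure]
    (hφ : ContDiff ℝ (⊤ : ℕ∞) φ) (hN : ‖N‖ = 1) (hρ : 0 < ρ)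
    (hd : DiffDecay volume (fun q : F × E => φ (q.2, q.1)) y₀ x₀
      {v | ⟪v, N⟫ = 0} ρ (Metric.sphere 0 1))
    (hkd : KernelDecay ν φ x₀ y₀ ρ (Metric.sphere 0 1))
    (ha : ContDiff ℝ (⊤ : ℕ∞) a)
    (has : ∀ x y, a (x, y) ≠ 0 →
      x ∈ Metric.closedBall x₀ (ρ / 2) ∧ y ∈ Metric.closedBall y₀ (ρ / 2)) :
    ∃ D : ℝ, 0 ≤ D ∧ ∀ lam : ℝ, 0 < lam → ∀ k : E → Lp ℂ 2 ν, Continuous k →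
      HasCompactSupport k →
      (∀ (x : E) (h : Lp ℂ 2 ν), inner ℂ (k x) h =
        ∫ y, Complex.exp (Complex.I * ((lam * φ (x, y) : ℝ) : ℂ)) * a (x, y) * h y ∂ν) →
      (∀ x z, inner ℂ (k x) (k z) = ∫ y, Complex.exp (Complex.I * ((lam * φ (x, y) : ℝ) : ℂ)) *
        a (x, y) * starRingEnd ℂ (Complex.exp (Complex.I * ((lam * φ (z, y) : ℝ) : ℂ)) *
        a (z, y)) ∂ν) →
      ∀ (f : Lp ℂ 2 ν) (α : ℝ), 0 < α → volume.real {x | α < ‖inner ℂ (k x) f‖} ≤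
        D * lam ^ (-(Module.finrank ℝ F + 1) : ℝ) *
          (‖f‖ / α) ^ (2 + 4 / Module.finrank ℝ F : ℝ) := by
  have hle : ρ / 2 ≤ ρ := by linarith
  obtain ⟨C₁, hC₁, hslab⟩ := hd.exists_slab_bound ν hφ hN hρ ha fun x y hxy =>
    ⟨Metric.closedBall_subset_closedBall hle (has x y hxy).1, (has x y hxy).2⟩
  obtain ⟨C₂, hC₂, hdec⟩ := hkd.exists_bound hρ ha fun x y hxy =>
    ⟨(has x y hxy).1, Metric.closedBall_subset_closedBall hle (has x y hxy).2⟩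
  set m := Module.finrank ℝ F
  refine ⟨6 * (C₁ + 1) * (4 * (C₂ + 1)) ^ (1 / m : ℝ), by positivity,
    fun lam hlam k hk hks hin hkk f α hα => ?_⟩
  refine measureReal_level_le hk hks hN Module.finrank_pos hlam (by positivity) (by positivity)
    ?_ ?_ f hα
  · intro R hR t h
    have := hslab lam hlam R hR t h (Lp.memLp h)
    simp only [← hin, sq_enorm_lp_two] at this
    refine this.trans ?_
    gcongr
    linarith
  · intro x z hxz
    refine le_trans (le_of_eq ?_) ((hdec x z hxz lam hlam).trans (by linarith))
    rw [hkk]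
    congr 3
    refine integral_congr_ae (Filter.Eventually.of_forall fun y => ?_)
    have : Complex.exp (Complex.I * ((lam * (φ (x, y) - φ (z, y)) : ℝ) : ℂ)) =
        Complex.exp (Complex.I * ((lam * φ (x, y) : ℝ) : ℂ)) *
          starRingEnd ℂ (Complex.exp (Complex.I * ((lam * φ (z, y) : ℝ) : ℂ))) := by
      rw [← Complex.exp_conj, ← Complex.exp_add, map_mul, Complex.conj_I, Complex.conj_ofReal]
      congr 1
      push_cast
      ring
    simp only [this, map_mul]
    ring

lemma exists_local_bound (ν : Measure F) [ν.IsAddHaarMeasure]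
    (hφ : ContDiff ℝ (⊤ : ℕ∞) φ) (hN : ‖N‖ = 1) (hρ : 0 < ρ)
    (hd : DiffDecay volume (fun q : F × E => φ (q.2, q.1)) y₀ x₀
      {v | ⟪v, N⟫ = 0} ρ (Metric.sphere 0 1))
    (hkd : KernelDecay ν φ x₀ y₀ ρ (Metric.sphere 0 1))
    (ha : ContDiff ℝ (⊤ : ℕ∞) a)
    (has : ∀ x y, a (x, y) ≠ 0 →
      x ∈ Metric.closedBall x₀ (ρ / 2) ∧ y ∈ Metric.closedBall y₀ (ρ / 2))
    {p ε : ℝ} (hp : 2 + 4 / Module.finrank ℝ F ≤ p) (hε : 0 < ε) :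
    ∃ C : ℝ, 0 ≤ C ∧ ∀ lam : ℝ, 1 ≤ lam → ∀ f : F → ℂ, MemLp f (ENNReal.ofReal p) ν →
      eLpNorm (fun x => ∫ y, Complex.exp (Complex.I * ((lam * φ (x, y) : ℝ) : ℂ)) *
        a (x, y) * f y ∂ν) (ENNReal.ofReal p) volume ≤
      ENNReal.ofReal (C * lam ^ (-(Module.finrank ℝ F + 1) / p + ε)) *
        eLpNorm f (ENNReal.ofReal p) ν := by
  obtain ⟨D, hD, hlev⟩ := exists_level_bound ν hφ hN hρ hd hkd ha has
  have hm : (0 : ℝ) < Module.finrank ℝ F := by exact_mod_cast Module.finrank_pos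
  set m := Module.finrank ℝ F
  have hcs : ∀ lam : ℝ, HasCompactSupport (Function.uncurry fun x y =>
      Complex.exp (Complex.I * ((lam * φ (x, y) : ℝ) : ℂ)) * a (x, y)) := fun lam => by
    refine HasCompactSupport.intro ((isCompact_closedBall x₀ (ρ / 2)).prod
      (isCompact_closedBall y₀ (ρ / 2))) fun q hq => ?_
    have : a q = 0 := by
      by_contra h0
      exact hq (has q.1 q.2 h0)
    simp [Function.uncurry, this]
  have hφc := hφ.continuous
  have hac := ha.continuous
  have hK : ∀ lam : ℝ, Continuous (Function.uncurry fun x y =>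
      Complex.exp (Complex.I * ((lam * φ (x, y) : ℝ) : ℂ)) * a (x, y)) := fun lam => by
    unfold Function.uncurry
    fun_prop
  choose k hk hks hin hkk using fun lam : ℝ =>
    exists_continuous_toLp_kernel (ν := ν) (hK lam) (hcs lam)
  obtain ⟨c, hc⟩ := (hk 0).bounded_above_of_compact_support (hks 0)
  have hc0 : 0 ≤ c := (norm_nonneg _).trans (hc 0)
  have hunit : ∀ t : ℝ, Complex.exp (Complex.I * t) *
      starRingEnd ℂ (Complex.exp (Complex.I * t)) = 1 := fun t => by
    rw [← Complex.exp_conj, ← Complex.exp_add, map_mul, Complex.conj_I, Complex.conj_ofReal]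
    simp
  have hself : ∀ lam x, inner ℂ (k lam x) (k lam x) =
      ∫ y, a (x, y) * starRingEnd ℂ (a (x, y)) ∂ν := fun lam x => by
    rw [hkk]
    refine integral_congr_ae (Filter.Eventually.of_forall fun y => ?_)
    simp only [map_mul]
    calc _ = (Complex.exp (Complex.I * ((lam * φ (x, y) : ℝ) : ℂ)) *
        starRingEnd ℂ (Complex.exp (Complex.I * ((lam * φ (x, y) : ℝ) : ℂ)))) *
        (a (x, y) * starRingEnd ℂ (a (x, y))) := by ring
      _ = _ := by rw [hunit, one_mul]
  have hkc : ∀ lam x, ‖k lam x‖ ≤ c := fun lam x => by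
    refine le_trans (le_of_eq ?_) (hc x)
    rw [norm_eq_sqrt_re_inner (𝕜 := ℂ), norm_eq_sqrt_re_inner (𝕜 := ℂ) (k 0 x), hself, hself]
  have hkB : ∀ lam x, x ∉ Metric.closedBall x₀ (ρ / 2) → k lam x = 0 := fun lam x hx => by
    rw [← inner_self_eq_zero (𝕜 := ℂ), hself]
    have : ∀ y, a (x, y) = 0 := fun y => by
      by_contra h0
      exact hx (has x y h0).1
    simp [this]
  obtain ⟨C, hC0, hC⟩ := eLpNorm_inner_le_of_level_le (E := E) (H := Lp ℂ 2 ν) (d := m + 1)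
    (q := 2 + 4 / m) (p := p) (ε := ε) (c₀ := c) (D := D) (by positivity) (by positivity) hp hε hc0
    hD (B := Metric.closedBall x₀ (ρ / 2)) measure_closedBall_lt_top.ne
  set B := Metric.closedBall y₀ (ρ / 2)
  have hBm : MeasurableSet B := Metric.isClosed_closedBall.measurableSet
  have hBfin : ν B ≠ ∞ := measure_closedBall_lt_top.ne
  have hp2 : 2 ≤ p := le_trans (by linarith [show 0 < 4 / (m : ℝ) by positivity]) hp
  have hp2' : 2 ≤ ENNReal.ofReal p := by
    rw [← ENNReal.ofReal_ofNat]
    exact ENNReal.ofReal_le_ofReal hp2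
  have : Fact (ν B < ∞) := ⟨hBfin.lt_top⟩
  set e : ℝ := 1 / 2 - 1 / p with he
  have he0 : 0 ≤ e := by
    rw [he, sub_nonneg]
    exact one_div_le_one_div_of_le two_pos hp2
  refine ⟨C * (ν B).toReal ^ e, by positivity, fun lam hlam f hf => ?_⟩
  have hlam0 : 0 < lam := by linarith
  have hf2 : MemLp (B.indicator f) 2 ν :=
    (memLp_indicator_iff_restrict hBm).2 ((hf.restrict B).mono_exponent hp2')
  have key := hC (k lam) lam (hk lam) (hkc lam) (hkB lam) hlam hf2.toLp
    (fun α hα => hlev lam hlam0 (k lam) (hk lam) (hks lam) (hin lam) (hkk lam) _ α hα)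
  have hval : ∀ x, inner ℂ (k lam x) hf2.toLp =
      ∫ y, Complex.exp (Complex.I * ((lam * φ (x, y) : ℝ) : ℂ)) * a (x, y) * f y ∂ν := fun x => by
    rw [hin]
    refine integral_congr_ae ?_
    filter_upwards [hf2.coeFn_toLp] with y hy
    rw [hy]
    by_cases hyB : y ∈ B
    · rw [Set.indicator_of_mem hyB]
    · have : a (x, y) = 0 := by
        by_contra h0
        exact hyB (has x y h0).2
      simp [this]
  simp only [hval] at key
  refine key.trans ?_
  have hnorm : ‖hf2.toLp‖ₑ ≤ eLpNorm f (ENNReal.ofReal p) ν * ENNReal.ofReal ((ν B).toReal ^ e) := by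
    rw [Lp.enorm_toLp, eLpNorm_indicator_eq_eLpNorm_restrict hBm]
    refine (eLpNorm_le_eLpNorm_mul_rpow_measure_univ hp2'
      hf.aestronglyMeasurable.restrict).trans ?_
    rw [Measure.restrict_apply_univ, ENNReal.toReal_ofReal (by linarith),
      ← ENNReal.ofReal_rpow_of_nonneg ENNReal.toReal_nonneg he0, ENNReal.ofReal_toReal hBfin]
    exact mul_le_mul' (eLpNorm_mono_measure _ Measure.restrict_le_self) (le_of_eq (by simp [he]))
  calc _ ≤ ENNReal.ofReal (C * lam ^ (-(m + 1) / p + ε)) *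
        (eLpNorm f (ENNReal.ofReal p) ν * ENNReal.ofReal ((ν B).toReal ^ e)) := by gcongr
    _ = _ := by
      rw [mul_right_comm C, ENNReal.ofReal_mul (p := C * _) (by positivity)]
      ring

end local_bound

section geometry

variable {n m : ℕ} {ϕ : V n × V m → ℝ}

lemma fderiv_partial_left (hϕ : ContDiff ℝ (⊤ : ℕ∞) ϕ) (x v : V n) (y : V m) :
    fderiv ℝ (fun x' => ϕ (x', y)) x v = fderiv ℝ ϕ (x, y) (v, 0) := by
  have h1 : HasFDerivAt ϕ (fderiv ℝ ϕ (x, y)) (x, y) :=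
    (hϕ.differentiable (by simp) _).hasFDerivAt
  have h2 := HasFDerivAt.comp (g := ϕ) x h1 (hasFDerivAt_prodMk_left (𝕜 := ℝ) x y)
  have h3 : HasFDerivAt (fun x' => ϕ (x', y)) _ x := h2
  rw [h3.fderiv]
  simp

lemma gradX_apply (hϕ : ContDiff ℝ (⊤ : ℕ∞) ϕ) (x : V n) (y : V m) (i : Fin n) :
    gradX ϕ x y i = fderiv ℝ ϕ (x, y) (EuclideanSpace.single i 1, 0) := by
  rw [← fderiv_partial_left hϕ]
  rfl

lemma sum_smul_single {k : ℕ} (w : V k) :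
    w = ∑ i, w i • (EuclideanSpace.single i 1 : V k) := by
  have := (EuclideanSpace.basisFun (Fin k) ℝ).sum_repr w
  simpa using this.symm

lemma inner_gradX (hϕ : ContDiff ℝ (⊤ : ℕ∞) ϕ) (x w : V n) (y : V m) :
    (⟪gradX ϕ x y, w⟫ : ℝ) = fderiv ℝ ϕ (x, y) (w, 0) := by
  have h : (w, (0 : V m)) = ∑ i, w i • ((EuclideanSpace.single i 1 : V n), (0 : V m)) := by
    refine Prod.ext ?_ ?_
    · simpa [Prod.fst_sum] using sum_smul_single w
    · simp [Prod.snd_sum]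
  rw [h, map_sum, PiLp.inner_apply]
  refine Finset.sum_congr rfl fun i _ => ?_
  rw [gradX_apply hϕ, map_smul]
  simp

/-- The mixed second derivative of `ϕ`, as a bilinear expression in `v` and `η`. -/
def mixedForm (ϕ : V n × V m → ℝ) (x : V n) (y : V m) (v : V n) (η : V m) : ℝ :=
  fderiv ℝ (fderiv ℝ ϕ) (x, y) (0, η) (v, 0)

lemma differentiable_fderiv_phase (hϕ : ContDiff ℝ (⊤ : ℕ∞) ϕ) :
    Differentiable ℝ (fderiv ℝ ϕ) :=
  (hϕ.fderiv_right (m := (⊤ : ℕ∞)) (by simp)).differentiable (by simp)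

lemma fderiv_fderiv_right (hϕ : ContDiff ℝ (⊤ : ℕ∞) ϕ) (x v : V n) (y η : V m) :
    fderiv ℝ (fun y' => fderiv ℝ ϕ (x, y') (v, 0)) y η = mixedForm ϕ x y v η := by
  have h1 : HasFDerivAt (fderiv ℝ ϕ) (fderiv ℝ (fderiv ℝ ϕ) (x, y)) (x, y) :=
    (differentiable_fderiv_phase hϕ _).hasFDerivAt
  have h2 := (HasFDerivAt.comp (g := fderiv ℝ ϕ) y h1
    (hasFDerivAt_prodMk_right (𝕜 := ℝ) x y)).clm_apply
    (hasFDerivAt_const ((v, 0) : V n × V m) y)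
  have h3 : HasFDerivAt (fun y' => fderiv ℝ ϕ (x, y') (v, 0)) _ y := h2
  rw [h3.fderiv]
  simp [mixedForm]

lemma fderiv_fderiv_swap_left (hϕ : ContDiff ℝ (⊤ : ℕ∞) ϕ) (x v : V n) (y η : V m) :
    fderiv ℝ (fun x' => fderiv ℝ (fun q : V m × V n => ϕ (q.2, q.1)) (y, x') (η, 0)) x v =
      mixedForm ϕ x y v η := by
  have h0 : ∀ x', fderiv ℝ (fun q : V m × V n => ϕ (q.2, q.1)) (y, x') (η, 0) =
      fderiv ℝ ϕ (x', y) (0, η) := by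
    intro x'
    have h1 : HasFDerivAt ϕ (fderiv ℝ ϕ (x', y)) (x', y) :=
      (hϕ.differentiable (by simp) _).hasFDerivAt
    have h2 : HasFDerivAt (fun q : V m × V n => (q.2, q.1)) _ (y, x') :=
      (hasFDerivAt_snd (𝕜 := ℝ)).prodMk (hasFDerivAt_fst (𝕜 := ℝ))
    have h3 : HasFDerivAt (fun q : V m × V n => ϕ (q.2, q.1)) _ (y, x') :=
      HasFDerivAt.comp (g := ϕ) (y, x') h1 h2
    rw [h3.fderiv]
    simp
  simp only [h0]
  have h1 : HasFDerivAt (fderiv ℝ ϕ) (fderiv ℝ (fderiv ℝ ϕ) (x, y)) (x, y) :=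
    (differentiable_fderiv_phase hϕ _).hasFDerivAt
  have h2 := (HasFDerivAt.comp (g := fderiv ℝ ϕ) x h1
    (hasFDerivAt_prodMk_left (𝕜 := ℝ) x y)).clm_apply
    (hasFDerivAt_const ((0, η) : V n × V m) x)
  have h3 : HasFDerivAt (fun x' => fderiv ℝ ϕ (x', y) (0, η)) _ x := h2
  rw [h3.fderiv]
  have hsymm : IsSymmSndFDerivAt ℝ ϕ (x, y) :=
    hϕ.contDiffAt.isSymmSndFDerivAt (by
      rw [minSmoothness_of_isRCLikeNormedField]
      exact WithTop.coe_le_coe.2 (le_top : (2 : ℕ∞) ≤ ⊤))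
  simpa [mixedForm] using hsymm.eq (v, 0) (0, η)

lemma csMixed_apply (hϕ : ContDiff ℝ (⊤ : ℕ∞) ϕ) (x : V n) (y : V m) (i : Fin n) (j : Fin m) :
    csMixed ϕ x y i j =
      mixedForm ϕ x y (EuclideanSpace.single i 1) (EuclideanSpace.single j 1) := by
  simp only [csMixed, Matrix.of_apply, fderiv_partial_left hϕ, fderiv_fderiv_right hϕ]

lemma mixedForm_eq_sum_left (x v : V n) (y η : V m) :
    mixedForm ϕ x y v η = ∑ i, v i * mixedForm ϕ x y (EuclideanSpace.single i 1) η := by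
  have h : (v, (0 : V m)) = ∑ i, v i • ((EuclideanSpace.single i 1 : V n), (0 : V m)) := by
    refine Prod.ext ?_ ?_
    · simpa [Prod.fst_sum] using sum_smul_single v
    · simp [Prod.snd_sum]
  simp only [mixedForm, h, map_sum, map_smul, smul_eq_mul]

lemma mixedForm_eq_sum_right (x v : V n) (y η : V m) :
    mixedForm ϕ x y v η = ∑ j, η j * mixedForm ϕ x y v (EuclideanSpace.single j 1) := by
  have h : ((0 : V n), η) = ∑ j, η j • ((0 : V n), (EuclideanSpace.single j 1 : V m)) := by
    refine Prod.ext ?_ ?_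
    · simp [Prod.fst_sum]
    · simpa [Prod.snd_sum] using sum_smul_single η
  simp only [mixedForm, h, map_sum, map_smul, smul_eq_mul, sum_apply,
    smul_apply]

/-- The linear map given by the mixed Hessian. -/
def mixedMap (ϕ : V n × V m → ℝ) (x : V n) (y : V m) : V m →ₗ[ℝ] V n :=
  Matrix.toLpLin 2 2 (csMixed ϕ x y)

lemma inner_mixedMap (hϕ : ContDiff ℝ (⊤ : ℕ∞) ϕ) (x v : V n) (y η : V m) :
    (⟪mixedMap ϕ x y η, v⟫ : ℝ) = mixedForm ϕ x y v η := by
  rw [mixedForm_eq_sum_left, PiLp.inner_apply]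
  refine Finset.sum_congr rfl fun i _ => ?_
  rw [mixedForm_eq_sum_right]
  simp [mixedMap, Matrix.toLpLin_apply, Matrix.mulVec, dotProduct, csMixed_apply hϕ, mul_comm]

lemma mixedMap_injective {x : V n} {y : V m} (h : (csMixed ϕ x y).rank = m) :
    Function.Injective (mixedMap ϕ x y) := by
  have h1 : Function.Injective (csMixed ϕ x y).mulVecLin := by
    rw [← LinearMap.ker_eq_bot, ← Submodule.finrank_eq_zero (R := ℝ)]
    have := LinearMap.finrank_range_add_finrank_ker (csMixed ϕ x y).mulVecLin
    rw [Matrix.rank] at h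
    rw [h] at this
    simpa using this
  intro u v huv
  have h2 : (csMixed ϕ x y).mulVecLin u.ofLp = (csMixed ϕ x y).mulVecLin v.ofLp := by
    simpa [mixedMap, Matrix.toLpLin_apply] using huv
  exact (WithLp.ofLp_injective 2) (h1 h2)

lemma exists_unit_normal (hmn : m < n) (x : V n) (y : V m) :
    ∃ N : V n, ‖N‖ = 1 ∧ ∀ η, (⟪mixedMap ϕ x y η, N⟫ : ℝ) = 0 := by
  set K := LinearMap.range (mixedMap ϕ x y)
  have hK : K ≠ ⊤ := by
    intro h
    have h1 := LinearMap.finrank_range_le (mixedMap ϕ x y)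
    rw [show LinearMap.range (mixedMap ϕ x y) = ⊤ from h, finrank_top] at h1
    simp only [finrank_euclideanSpace, Fintype.card_fin] at h1
    omega
  have hK' : Kᗮ ≠ ⊥ := fun h => hK ((Submodule.orthogonal_eq_bot_iff).1 h)
  obtain ⟨w, hw, hw0⟩ := Submodule.exists_mem_ne_zero_of_ne_bot hK'
  refine ⟨‖w‖⁻¹ • w, norm_smul_inv_norm hw0, fun η => ?_⟩
  rw [inner_smul_right, Submodule.inner_right_of_mem_orthogonal (LinearMap.mem_range_self _ η) hw,
    mul_zero]

lemma csCurv_mulVec_apply (hϕ : ContDiff ℝ (⊤ : ℕ∞) ϕ) (x ω : V n) (y η : V m) (j : Fin m) :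
    (csCurv ϕ x y ω).mulVec η.ofLp j =
      fderiv ℝ (fun y' => fderiv ℝ (fun y'' => fderiv ℝ ϕ (x, y'') (ω, 0)) y' η) y
        (EuclideanSpace.single j 1) := by
  set g : V m → ℝ := fun y'' => fderiv ℝ ϕ (x, y'') (ω, 0) with hg
  have hgs : ContDiff ℝ (⊤ : ℕ∞) g := by
    have h1 : ContDiff ℝ (⊤ : ℕ∞) (fderiv ℝ ϕ) := hϕ.fderiv_right (by simp)
    exact (h1.comp (contDiff_prodMk_right x)).clm_apply contDiff_const
  have hd : Differentiable ℝ (fderiv ℝ g) :=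
    (hgs.fderiv_right (m := (⊤ : ℕ∞)) (by simp)).differentiable (by simp)
  have key : ∀ v w, fderiv ℝ (fun y' => fderiv ℝ g y' v) y w = fderiv ℝ (fderiv ℝ g) y w v := by
    intro v w
    have h2 := (hd y).hasFDerivAt.clm_apply (hasFDerivAt_const v y)
    rw [h2.fderiv]
    simp
  simp only [Matrix.mulVec, dotProduct, csCurv, Matrix.of_apply, inner_gradX hϕ]
  rw [← hg, key]
  conv_rhs => rw [sum_smul_single η, map_sum]
  refine Finset.sum_congr rfl fun k _ => ?_
  rw [key, map_smul, smul_eq_mul, mul_comm]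

/-- The Carleson–Sjölin condition at a point yields decay near that point. -/
lemma exists_decay_of_rank_of_curv (hϕ : ContDiff ℝ (⊤ : ℕ∞) ϕ) (hm : 0 < m) (hmn : m < n)
    {x : V n} {y : V m} (hrank : (csMixed ϕ x y).rank = m)
    (hcurv : ∀ N : V n, ‖N‖ = 1 →
      (∀ j : Fin m, (⟪N, (EuclideanSpace.equiv (Fin n) ℝ).symm fun i => csMixed ϕ x y i j⟫ : ℝ) = 0) →
      (csCurv ϕ x y N).det ≠ 0) :
    ∃ (N : V n) (ρ : ℝ), ‖N‖ = 1 ∧ 0 < ρ ∧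
      DiffDecay volume (fun q : V m × V n => ϕ (q.2, q.1)) y x {v | ⟪v, N⟫ = 0} ρ
        (Metric.sphere 0 1) ∧
      KernelDecay volume ϕ x y ρ (Metric.sphere 0 1) := by
  have : Nontrivial (V m) := Module.nontrivial_of_finrank_pos (R := ℝ) (by simpa using hm)
  obtain ⟨N, hN, hperp⟩ := exists_unit_normal (ϕ := ϕ) hmn x y
  obtain ⟨ρ₁, hρ₁, -, h₁⟩ := exists_diffDecay_of_isCompact (μ := (volume : Measure (V n)))
    (φ := fun q : V m × V n => ϕ (q.2, q.1)) (u₀ := y) (x₀ := x) (W := {v | ⟪v, N⟫ = 0})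
    (hϕ.comp (contDiff_snd.prodMk contDiff_fst)) (isCompact_sphere (0 : V m) 1) (by
      intro η hη
      refine ⟨mixedMap ϕ x y η, hperp η, ?_⟩
      rw [fderiv_fderiv_swap_left hϕ, ← inner_mixedMap hϕ, ne_eq, inner_self_eq_zero]
      intro h0
      have : η = 0 := mixedMap_injective hrank (by simpa using h0)
      simp [this] at hη)
  obtain ⟨ρ₂, hρ₂, -, h₂⟩ := exists_kernelDecay_of_isCompact (μ := (volume : Measure (V m)))
    (φ := ϕ) (x₀ := x) (y₀ := y) hϕ (isCompact_sphere (0 : V n) 1) (by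
      intro ω hω h0 η hη
      have hω1 : ‖ω‖ = 1 := by simpa using hω
      have hdet := hcurv ω hω1 fun j => by
        have h1 := fderiv_fderiv_right hϕ x ω y (EuclideanSpace.single j 1)
        rw [h0, mixedForm_eq_sum_left] at h1
        rw [PiLp.inner_apply]
        simpa [csMixed_apply hϕ, mul_comm] using h1.symm
      by_contra! hall
      have : η.ofLp = 0 := Matrix.eq_zero_of_mulVec_eq_zero hdet (by
        ext j
        rw [csCurv_mulVec_apply hϕ, hall]
        rfl)
      exact hη ((WithLp.ofLp_injective 2) this))
  exact ⟨N, min ρ₁ ρ₂, hN, lt_min hρ₁ hρ₂, h₁.mono (min_le_left _ _) subset_rfl,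
    h₂.mono (min_le_right _ _) subset_rfl⟩

end geometry

section globalization

variable {n : ℕ} {ϕ : V n × V (n - 1) → ℝ} {a b : V n × V (n - 1) → ℂ} {p s : ℝ}

lemma continuous_oscInt {lam : ℝ} (hϕ : Continuous ϕ) (ha : Continuous a)
    (has : HasCompactSupport a) {f : V (n - 1) → ℂ} (hf : Continuous f) :
    Continuous (oscInt lam ϕ a f) := by
  rw [← continuousOn_univ]
  refine continuousOn_integral_of_compact_support
    (has.isCompact.image continuous_snd) ?_ fun x y _ hy => ?_
  · unfold Function.uncurry
    exact Continuous.continuousOn (by fun_prop)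
  · have : a (x, y) = 0 := by
      by_contra h0
      exact hy ⟨(x, y), subset_tsupport _ h0, rfl⟩
    simp [this]

lemma integrable_oscInt {lam : ℝ} (hϕ : Continuous ϕ) (ha : Continuous a)
    (has : HasCompactSupport a) {f : V (n - 1) → ℂ} (hf : Continuous f) (x : V n) :
    Integrable fun y => Complex.exp (Complex.I * ((lam * ϕ (x, y) : ℝ) : ℂ)) * a (x, y) * f y := by
  refine Continuous.integrable_of_hasCompactSupport (by fun_prop)
    (HasCompactSupport.intro (has.isCompact.image continuous_snd) fun y hy => ?_)
  have : a (x, y) = 0 := by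
    by_contra h0
    exact hy ⟨(x, y), subset_tsupport _ h0, rfl⟩
  simp [this]

/-- The estimate `‖T_λ f‖_p ≤ C λ ^ s ‖f‖_p` for the operator with amplitude `a`. -/
def OscBound (ϕ : V n × V (n - 1) → ℝ) (p s : ℝ) (a : V n × V (n - 1) → ℂ) : Prop :=
  ∃ C : ℝ, 0 ≤ C ∧ ∀ lam : ℝ, 1 ≤ lam → ∀ f : SchwartzMap (V (n - 1)) ℂ,
    eLpNorm (oscInt lam ϕ a ⇑f) (ENNReal.ofReal p) volume ≤
      ENNReal.ofReal (C * lam ^ s) * eLpNorm (⇑f) (ENNReal.ofReal p) volume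

lemma OscBound.add (hϕ : Continuous ϕ) (hp : 1 ≤ p) (ha : Continuous a) (hb : Continuous b)
    (has : HasCompactSupport a) (hbs : HasCompactSupport b) (h : OscBound ϕ p s a)
    (h' : OscBound ϕ p s b) : OscBound ϕ p s (a + b) := by
  obtain ⟨C, hC0, hC⟩ := h
  obtain ⟨C', hC0', hC'⟩ := h'
  refine ⟨C + C', by positivity, fun lam hlam f => ?_⟩
  have hlam0 : 0 < lam := by linarith
  have hadd : oscInt lam ϕ (a + b) f = oscInt lam ϕ a f + oscInt lam ϕ b f := by
    ext x
    simp only [oscInt, Pi.add_apply]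
    rw [← integral_add (integrable_oscInt hϕ ha has f.continuous x)
      (integrable_oscInt hϕ hb hbs f.continuous x)]
    refine integral_congr_ae (Filter.Eventually.of_forall fun y => ?_)
    simp only
    ring
  have hp' : 1 ≤ ENNReal.ofReal p := by simpa using hp
  rw [hadd]
  refine (eLpNorm_add_le (continuous_oscInt hϕ ha has f.continuous).aestronglyMeasurable
    (continuous_oscInt hϕ hb hbs f.continuous).aestronglyMeasurable hp').trans ?_
  refine (add_le_add (hC lam hlam f) (hC' lam hlam f)).trans (le_of_eq ?_)
  rw [← add_mul, ← ENNReal.ofReal_add (by positivity) (by positivity), add_mul C]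

lemma oscBound_of_locally (hϕ : Continuous ϕ) (hp : 1 ≤ p)
    {K : Set (V n × V (n - 1))} (hK : IsCompact K)
    (hloc : ∀ q ∈ K, ∃ r : ℝ, 0 < r ∧ ∀ b : V n × V (n - 1) → ℂ, ContDiff ℝ (⊤ : ℕ∞) b →
      HasCompactSupport b → (∀ w, b w ≠ 0 → w ∈ Metric.closedBall q r) → OscBound ϕ p s b)
    (ha : ContDiff ℝ (⊤ : ℕ∞) a) (has : HasCompactSupport a) (haK : ∀ w, a w ≠ 0 → w ∈ K) :
    OscBound ϕ p s a := by
  obtain ⟨χ, hχ, hχ1, hχb⟩ : ∃ χ : V n × V (n - 1) → ℂ, ContDiff ℝ (⊤ : ℕ∞) χ ∧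
      (∀ w ∈ K, χ w = 1) ∧ ∀ b : V n × V (n - 1) → ℂ, ContDiff ℝ (⊤ : ℕ∞) b →
        HasCompactSupport b → OscBound ϕ p s (χ * b) := by
    refine hK.induction_on (p := fun S => ∃ χ : V n × V (n - 1) → ℂ, ContDiff ℝ (⊤ : ℕ∞) χ ∧
      (∀ w ∈ S, χ w = 1) ∧ ∀ b : V n × V (n - 1) → ℂ, ContDiff ℝ (⊤ : ℕ∞) b →
        HasCompactSupport b → OscBound ϕ p s (χ * b)) ?_ ?_ ?_ ?_
    · refine ⟨0, contDiff_const, by simp, fun b _ _ => ⟨0, le_rfl, fun lam _ f => ?_⟩⟩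
      have : oscInt lam ϕ (0 * b) f = 0 := by
        ext x
        simp [oscInt]
      rw [this, eLpNorm_zero]
      exact zero_le
    · rintro S S' hS ⟨χ, hχ, hχ1, hχb⟩
      exact ⟨χ, hχ, fun w hw => hχ1 w (hS hw), hχb⟩
    · rintro S S' ⟨χ, hχ, hχ1, hχb⟩ ⟨χ', hχ', hχ1', hχb'⟩
      refine ⟨χ + (1 - χ) * χ', hχ.add ((contDiff_const.sub hχ).mul hχ'), ?_, fun b hb hbs => ?_⟩
      · rintro w (hw | hw)
        · simp [hχ1 w hw]
        · simp [hχ1' w hw]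
      · have e : (χ + (1 - χ) * χ') * b = χ * b + χ' * ((1 - χ) * b) := by ring
        have hb' : ContDiff ℝ (⊤ : ℕ∞) ((1 - χ) * b) := (contDiff_const.sub hχ).mul hb
        have hbs' : HasCompactSupport ((1 - χ) * b) := hbs.mul_left
        rw [e]
        exact (hχb b hb hbs).add hϕ hp (hχ.mul hb).continuous (hχ'.mul hb').continuous
          hbs.mul_left hbs'.mul_left (hχb' _ hb' hbs')
    · intro q hq
      obtain ⟨r, hr, hbd⟩ := hloc q hq
      let β : ContDiffBump q := ⟨r / 2, r, by positivity, by linarith⟩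
      refine ⟨Metric.closedBall q (r / 2), mem_nhdsWithin_of_mem_nhds
        (Metric.closedBall_mem_nhds _ (by positivity)), fun w => ((β w : ℝ) : ℂ),
        Complex.ofRealCLM.contDiff.comp β.contDiff, fun w hw => ?_, fun b hb hbs => ?_⟩
      · simp [β.one_of_mem_closedBall hw]
      · refine hbd _ ((Complex.ofRealCLM.contDiff.comp β.contDiff).mul hb) hbs.mul_left
          fun w hw => ?_
        have h1 : β w ≠ 0 := fun h0 => hw (by simp [h0])
        have h2 : w ∈ Function.support β := h1
        rw [β.support_eq] at h2
        exact Metric.ball_subset_closedBall h2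
  have : a = χ * a := by
    ext w
    by_cases hw : a w = 0
    · simp [hw]
    · simp [hχ1 w (haK w hw)]
  rw [this]
  exact hχb a ha has

end globalization

/-- a weak form of Stein's oscillatory integral theorem: for `n ≥ 2`,
`2(n+1)/(n−1) ≤ p < ∞`, any phase/amplitude pair satisfying the Carleson–Sjölin
condition, and any `ε > 0`, one has
`‖T_λ f‖_{L^p(ℝⁿ)} ≤ C_ε λ^{−n/p+ε}‖f‖_{L^p(ℝ^{n−1})}` for `λ ≥ 1`. -/
theorem carleson_sjolin_oscillatory_bound (n : ℕ) (hn : 2 ≤ n) (p : ℝ)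
    (hp : 2 * (n + 1) / (n - 1) ≤ p)
    (ϕ : V n × V (n - 1) → ℝ) (a : V n × V (n - 1) → ℂ)
    (hϕ : ContDiff ℝ (⊤ : ℕ∞) ϕ) (haSmooth : ContDiff ℝ (⊤ : ℕ∞) a)
    (haSupp : HasCompactSupport a)
    (hCS : CarlesonSjolin n a ϕ) :
    ∀ ε : ℝ, 0 < ε →
      ∃ C : ℝ, ∀ lam : ℝ, 1 ≤ lam → ∀ f : SchwartzMap (V (n - 1)) ℂ,
        eLpNorm (oscInt lam ϕ a ⇑f) (ENNReal.ofReal p) volume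
          ≤ ENNReal.ofReal (C * lam ^ (-(n : ℝ) / p + ε)) *
              eLpNorm (⇑f) (ENNReal.ofReal p) volume := by
  intro ε hε
  have hm : 0 < n - 1 := by omega
  have : Nontrivial (V (n - 1)) := Module.nontrivial_of_finrank_pos (R := ℝ) (by simpa using hm)
  have hcast : ((n - 1 : ℕ) : ℝ) = n - 1 := by
    rw [Nat.cast_sub (by omega), Nat.cast_one]
  have hn1 : (0 : ℝ) < n - 1 := by
    rw [← hcast]
    exact_mod_cast hm
  have hq : 2 + 4 / (Module.finrank ℝ (V (n - 1)) : ℝ) ≤ p := by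
    rw [finrank_euclideanSpace, Fintype.card_fin, hcast]
    refine le_trans (le_of_eq ?_) hp
    field_simp
    ring
  have hp1 : 1 ≤ p := by
    have : 0 ≤ 4 / (Module.finrank ℝ (V (n - 1)) : ℝ) := by positivity
    linarith
  suffices h : OscBound ϕ p (-(n : ℝ) / p + ε) a by
    obtain ⟨C, -, hC⟩ := h
    exact ⟨C, hC⟩
  refine oscBound_of_locally hϕ.continuous hp1 haSupp.isCompact (fun q hqa => ?_) haSmooth haSupp
    fun w hw => subset_tsupport _ hw
  obtain ⟨N, ρ, hN, hρ, hd, hk⟩ := exists_decay_of_rank_of_curv hϕ hm (by omega)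
    (hCS.1 q hqa) (hCS.2 q hqa)
  refine ⟨ρ / 2, by positivity, fun b hb hbs hbq => ?_⟩
  obtain ⟨C, hC0, hC⟩ := exists_local_bound volume hϕ hN hρ hd hk hb (fun x y hxy => by
    have := hbq (x, y) hxy
    rwa [← closedBall_prod_same, Set.mem_prod] at this) hq hε
  refine ⟨C, hC0, fun lam hlam f => ?_⟩
  have := hC lam hlam f (f.memLp _ _)
  rwa [finrank_euclideanSpace, Fintype.card_fin, hcast, sub_add_cancel] at this
end
end
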